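/- arXiv:math/0411067 — 2 statements merged into one kernel-verified Lean document; each statement's English description precedes it below -/
import Mathlib

section
/- There exist a compact metrizable space X and a natural uniform algebra A on X such that: (i) A has dense invertibles; (ii) every Gleason part of A is a single point, i.e., any two distinct characters φ, ψ of A satisfy ‖φ − ψ‖ = 2 in the dual norm of A; and (iii) there exists a proper closed subset S ⊊ X with sup_{x ∈ S} |f(x)| = sup_{x ∈ X} |f(x)| for all f ∈ A (so the Shilov boundary of A is a proper subset of X). -/
open Polynomial Metric Set Filter Topology
open scoped Polynomial.Bivariate

section Bivariate

lemma continuous_evalEval (P : ℂ[X][Y]) : Continuous fun q : ℂ × ℂ => P.evalEval q.1 q.2 := by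
  induction P using Polynomial.induction_on' with
  | add p q hp hq => simpa only [evalEval_add] using hp.fun_add hq
  | monomial n a =>
    simp only [evalEval, eval_monomial, eval_mul, eval_pow, eval_C]
    fun_prop

lemma exists_hasDerivAt_evalEval_left (P : ℂ[X][Y]) :
    ∃ P' : ℂ[X][Y], ∀ z w, HasDerivAt (fun z => P.evalEval z w) (P'.evalEval z w) z := by
  induction P using Polynomial.induction_on' with
  | add p q hp hq =>
    obtain ⟨p', hp'⟩ := hp
    obtain ⟨q', hq'⟩ := hq
    refine ⟨p' + q', fun z w => ?_⟩
    simpa only [evalEval_add] using (hp' z w).fun_add (hq' z w)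
  | monomial n a =>
    refine ⟨monomial n (derivative a), fun z w => ?_⟩
    simp only [evalEval, eval_monomial, eval_mul, eval_pow, eval_C]
    exact (a.hasDerivAt z).mul_const _

lemma differentiableOn_circleIntegral_evalEval_div {A B : ℂ[X][Y]} {c : ℂ} {r : ℝ} (hr : 0 ≤ r)
    {U : Set ℂ} (hU : IsOpen U)
    (hB : ∀ z ∈ U, ∀ w ∈ sphere c r, B.evalEval z w ≠ 0) :
    DifferentiableOn ℂ (fun z => ∮ w in C(c, r), A.evalEval z w / B.evalEval z w) U := by
  intro z₀ hz₀
  refine DifferentiableAt.differentiableWithinAt ?_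
  obtain ⟨A', hA'⟩ := exists_hasDerivAt_evalEval_left A
  obtain ⟨B', hB'⟩ := exists_hasDerivAt_evalEval_left B
  obtain ⟨ρ, hρ, hρU⟩ := Metric.nhds_basis_closedBall.mem_iff.1 (hU.mem_nhds hz₀)
  have hm : ∀ t, circleMap c r t ∈ sphere c r := fun t => circleMap_mem_sphere c hr t
  have hc : Continuous fun t => circleMap 0 r t * Complex.I := by fun_prop
  have cB := continuous_evalEval B
  have cA := continuous_evalEval A
  have cA' := continuous_evalEval A'
  have cB' := continuous_evalEval B'
  let D : ℂ × ℂ → ℂ := fun q => (A'.evalEval q.1 q.2 * B.evalEval q.1 q.2 -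
    A.evalEval q.1 q.2 * B'.evalEval q.1 q.2) / B.evalEval q.1 q.2 ^ 2
  have hD : ContinuousOn D (closedBall z₀ ρ ×ˢ sphere c r) := by
    refine ContinuousOn.div (((cA'.mul cB).sub (cA.mul cB')).continuousOn) ((cB.pow 2).continuousOn) ?_
    rintro ⟨z, w⟩ ⟨hz, hw⟩
    exact pow_ne_zero _ (hB z (hρU hz) w hw)
  obtain ⟨K, hK⟩ := ((isCompact_closedBall z₀ ρ).prod (isCompact_sphere c r)).exists_bound_of_continuousOn hD
  have key := intervalIntegral.hasDerivAt_integral_of_dominated_loc_of_deriv_le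
    (μ := MeasureTheory.volume) (a := 0) (b := 2 * Real.pi)
    (F := fun z t => deriv (circleMap c r) t • (A.evalEval z (circleMap c r t) / B.evalEval z (circleMap c r t)))
    (F' := fun z t => deriv (circleMap c r) t • D (z, circleMap c r t))
    (x₀ := z₀) (s := closedBall z₀ ρ) (bound := fun t => ‖deriv (circleMap c r) t‖ * K)
    (Metric.closedBall_mem_nhds z₀ hρ) ?_ ?_ ?_ ?_ ?_ ?_
  · exact key.2.differentiableAt
  · have : ∀ᶠ z in 𝓝 z₀, z ∈ closedBall z₀ ρ := Metric.closedBall_mem_nhds z₀ hρ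
    filter_upwards [this] with z hz
    refine Continuous.aestronglyMeasurable ?_
    simp only [deriv_circleMap]
    refine Continuous.smul hc (Continuous.div ?_ ?_ fun t => hB z (hρU hz) _ (hm t))
    · exact cA.comp (by fun_prop : Continuous fun t => (z, circleMap c r t))
    · exact cB.comp (by fun_prop : Continuous fun t => (z, circleMap c r t))
  · refine Continuous.intervalIntegrable ?_ _ _
    simp only [deriv_circleMap]
    refine Continuous.smul hc (Continuous.div ?_ ?_ fun t => hB z₀ hz₀ _ (hm t))
    · exact cA.comp (by fun_prop : Continuous fun t => (z₀, circleMap c r t))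
    · exact cB.comp (by fun_prop : Continuous fun t => (z₀, circleMap c r t))
  · refine Continuous.aestronglyMeasurable ?_
    simp only [deriv_circleMap]
    refine Continuous.smul hc ?_
    exact hD.comp_continuous (by fun_prop : Continuous fun t => (z₀, circleMap c r t))
      fun t => ⟨mem_closedBall_self hρ.le, hm t⟩
  · refine MeasureTheory.ae_of_all _ fun t _ z hz => ?_
    rw [norm_smul]
    gcongr
    exact hK _ ⟨hz, hm t⟩
  · refine Continuous.intervalIntegrable ?_ _ _
    simp only [deriv_circleMap]
    fun_prop
  · refine MeasureTheory.ae_of_all _ fun t _ z hz => ?_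
    exact (HasDerivAt.fun_div (hA' z _) (hB' z _) (hB z (hρU hz) _ (hm t))).fun_const_smul
      (deriv (circleMap c r) t)

open scoped Classical in
/-- The residue theorem for `g p' / p` with polynomials `g` and `p`. -/
lemma circleIntegral_mul_derivative_div {p g : ℂ[X]} {c : ℂ} {r : ℝ} (hr : 0 < r)
    (hp : ∀ w ∈ sphere c r, p.eval w ≠ 0) :
    (∮ w in C(c, r), (g * derivative p).eval w / p.eval w) =
      2 * Real.pi * Complex.I * ((p.roots.filter (· ∈ ball c r)).map g.eval).sum := by
  have hp0 : p ≠ 0 := by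
    rintro rfl
    exact hp (c + r) (by simp [abs_of_pos hr]) (by simp)
  have hroots : ∀ ζ ∈ p.roots, ζ ∉ sphere c r := fun ζ hζ hs => hp ζ hs (isRoot_of_mem_roots hζ)
  have h1 : (∮ w in C(c, r), (g * derivative p).eval w / p.eval w) =
      ∮ w in C(c, r), (p.roots.map fun ζ => g.eval w / (w - ζ)).sum := by
    refine circleIntegral.integral_congr hr.le fun w hw => ?_
    have := (IsAlgClosed.splits p).eval_derivative_div_eval_of_ne_zero (hp w hw)
    simp only [eval_mul, mul_div_assoc, this]
    rw [← Multiset.sum_map_mul_left]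
    simp only [mul_one_div]
  rw [h1]
  generalize p.roots = s at hroots
  induction s using Multiset.induction_on with
  | empty => simp [circleIntegral]
  | cons ζ s ih =>
    have hζ := hroots ζ (by simp)
    have hs : ∀ ξ ∈ s, ξ ∉ sphere c r := fun ξ hξ => hroots ξ (by simp [hξ])
    have hci : ∀ ξ, ξ ∉ sphere c r → ContinuousOn (fun w => g.eval w / (w - ξ)) (sphere c r) := by
      intro ξ hξ
      refine ContinuousOn.div (by fun_prop) (by fun_prop) fun w hw h => hξ ?_
      rwa [← sub_eq_zero.1 h]
    have hcs : ContinuousOn (fun w => (s.map fun ζ => g.eval w / (w - ζ)).sum) (sphere c r) := by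
      clear ih hroots
      induction s using Multiset.induction_on with
      | empty => simpa using continuousOn_const
      | cons ξ s ih2 =>
        simp only [Multiset.map_cons, Multiset.sum_cons]
        exact (hci ξ (hs ξ (by simp))).add (ih2 fun x hx => hs x (by simp [hx]))
    simp only [Multiset.map_cons, Multiset.sum_cons]
    rw [circleIntegral.integral_add ((hci ζ hζ).circleIntegrable hr.le)
      (hcs.circleIntegrable hr.le), ih hs]
    by_cases hb : ζ ∈ ball c r
    · rw [Multiset.filter_cons_of_pos _ hb, Multiset.map_cons, Multiset.sum_cons, mul_add]
      congr 1
      have := (g.differentiable.differentiableOn (s := closedBall c r)).circleIntegral_sub_inv_smul hb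
      simp only [smul_eq_mul] at this
      rw [← this]
      simp only [div_eq_inv_mul]
    · rw [Multiset.filter_cons_of_neg _ hb]
      convert zero_add _
      have hζ' : ∀ w ∈ closedBall c r, w - ζ ≠ 0 := by
        intro w hw h
        rw [sub_eq_zero.1 h, mem_closedBall] at hw
        rw [mem_ball] at hb
        exact hζ (mem_sphere.2 (by linarith))
      refine Complex.circleIntegral_eq_zero_of_differentiable_on_off_countable hr.le
        countable_empty ?_ ?_
      · exact ContinuousOn.div (by fun_prop) (by fun_prop) hζ'
      · intro w hw
        exact g.differentiableAt.div (by fun_prop) (hζ' w (ball_subset_closedBall hw.1))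

open scoped Classical in
lemma circleIntegral_evalEval_mul_derivative_div {P g : ℂ[X][Y]} {z c : ℂ} {r : ℝ} (hr : 0 < r)
    (hP : ∀ w ∈ sphere c r, P.evalEval z w ≠ 0) :
    (∮ w in C(c, r), (g * derivative P).evalEval z w / P.evalEval z w) =
      2 * Real.pi * Complex.I * (((P.map (evalRingHom z)).roots.filter (· ∈ ball c r)).map
        fun w => g.evalEval z w).sum := by
  have := circleIntegral_mul_derivative_div (p := P.map (evalRingHom z))
    (g := g.map (evalRingHom z)) hr (by simpa only [map_evalRingHom_eval] using hP)
  rw [derivative_map, ← Polynomial.map_mul] at this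
  simpa only [map_evalRingHom_eval] using this

lemma exists_mem_ball_norm_lt (y : ℂ) {ρ : ℝ} (hρ : 0 < ρ) : ∃ z ∈ ball y ρ, ‖y‖ < ‖z‖ := by
  by_contra! H
  have h := Complex.eventually_eq_of_isLocalMax_norm (f := fun z : ℂ => z) (c := y)
    (Eventually.of_forall fun z => differentiableAt_id)
    (by filter_upwards [ball_mem_nhds y hρ] with z hz using H z hz)
  have h2 : ∀ᶠ z in 𝓝[≠] y, z = y := h.filter_mono nhdsWithin_le_nhds
  obtain ⟨z, hz, hz'⟩ := (h2.and self_mem_nhdsWithin).exists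
  exact hz' hz

/-- Maximum principle on the part of an algebraic curve inside the bidisc. -/
theorem norm_evalEval_le_of_forall_boundary {P g : ℂ[X][Y]} {R : ℝ}
    (h : ∀ z w : ℂ, ‖z‖ ≤ 1 → ‖w‖ ≤ 1 → (‖z‖ = 1 ∨ ‖w‖ = 1) → P.evalEval z w = 0 →
      ‖g.evalEval z w‖ ≤ R)
    {a b : ℂ} (ha : ‖a‖ ≤ 1) (hb : ‖b‖ ≤ 1) (hab : P.evalEval a b = 0) :
    ‖g.evalEval a b‖ ≤ R := by
  classical
  by_contra! hlt
  have cP := continuous_evalEval P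
  have cg := continuous_evalEval g
  let K : Set (ℂ × ℂ) := (closedBall 0 1 ×ˢ closedBall 0 1) ∩ {q | P.evalEval q.1 q.2 = 0}
  have hK : IsCompact K := ((isCompact_closedBall _ _).prod (isCompact_closedBall _ _)).inter_right
    (isClosed_eq cP continuous_const)
  have hKmem : ∀ z w : ℂ, ‖z‖ ≤ 1 → ‖w‖ ≤ 1 → P.evalEval z w = 0 → (z, w) ∈ K :=
    fun z w hz hw hp => ⟨⟨by simpa using hz, by simpa using hw⟩, hp⟩
  obtain ⟨q, hqK, hqmax⟩ := hK.exists_isMaxOn ⟨(a, b), hKmem a b ha hb hab⟩ cg.norm.continuousOn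
  set M := ‖g.evalEval q.1 q.2‖ with hM
  have hmax : ∀ z w : ℂ, ‖z‖ ≤ 1 → ‖w‖ ≤ 1 → P.evalEval z w = 0 → ‖g.evalEval z w‖ ≤ M :=
    fun z w hz hw hp => hqmax (hKmem z w hz hw hp)
  have hRM : R < M := hlt.trans_le (hmax a b ha hb hab)
  have hEc : IsCompact (K ∩ {q | ‖g.evalEval q.1 q.2‖ = M}) :=
    hK.inter_right (isClosed_eq cg.norm continuous_const)
  obtain ⟨⟨y₁, y₂⟩, ⟨⟨⟨hy₁, hy₂⟩, hyP⟩, hyM⟩, hymax⟩ := hEc.exists_isMaxOn ⟨q, hqK, rfl⟩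
    (f := fun q => ‖q.1‖) (by fun_prop)
  simp only [mem_closedBall, dist_zero_right] at hy₁ hy₂
  replace hyP : P.evalEval y₁ y₂ = 0 := hyP
  replace hyM : ‖g.evalEval y₁ y₂‖ = M := hyM
  have hlarge : ∀ z w : ℂ, ‖z‖ ≤ 1 → ‖w‖ ≤ 1 → P.evalEval z w = 0 → ‖y₁‖ < ‖z‖ →
      ‖g.evalEval z w‖ < M := by
    intro z w hz hw hp hyz
    refine (hmax z w hz hw hp).lt_of_ne fun he => ?_
    exact absurd (hymax ⟨hKmem z w hz hw hp, he⟩) (not_le.2 hyz)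
  have hy₁' : ‖y₁‖ < 1 := hy₁.lt_of_ne fun he => by
    have := h y₁ y₂ hy₁ hy₂ (Or.inl he) hyP; linarith
  have hy₂' : ‖y₂‖ < 1 := hy₂.lt_of_ne fun he => by
    have := h y₁ y₂ hy₁ hy₂ (Or.inr he) hyP; linarith
  set p := P.map (evalRingHom y₁) with hp
  have hpe : ∀ w, p.eval w = P.evalEval y₁ w := fun w => map_evalRingHom_eval _ _ _
  by_cases hp0 : p = 0
  · have hP0 : ∀ w, P.evalEval y₁ w = 0 := fun w => by rw [← hpe, hp0, eval_zero]
    have : ‖g.evalEval y₁ y₂‖ ≤ R := by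
      have hd : Differentiable ℂ fun w => g.evalEval y₁ w := by
        simp only [← map_evalRingHom_eval]
        exact Polynomial.differentiable _
      refine Complex.norm_le_of_forall_mem_frontier_norm_le (U := ball (0 : ℂ) 1) isBounded_ball
        hd.diffContOnCl (fun w hw => ?_) (subset_closure (by simpa using hy₂'))
      rw [frontier_ball _ one_ne_zero, mem_sphere, dist_zero_right] at hw
      exact h y₁ w hy₁ hw.le (Or.inr hw) (hP0 w)
    linarith
  obtain ⟨r, hr, hr1, hrz⟩ : ∃ r > 0, closedBall y₂ r ⊆ ball 0 1 ∧
      ∀ w ∈ closedBall y₂ r, w ≠ y₂ → p.eval w ≠ 0 := by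
    have hfin : {w | p.eval w = 0 ∧ w ≠ y₂}.Finite :=
      (p.rootSet_finite ℂ).subset fun w hw => by
        rw [mem_rootSet]; exact ⟨hp0, by simpa using hw.1⟩
    have h1 : ∀ᶠ w in 𝓝 y₂, w ∉ {w | p.eval w = 0 ∧ w ≠ y₂} :=
      hfin.isClosed.isOpen_compl.mem_nhds (by simp)
    have h2 : ∀ᶠ w in 𝓝 y₂, w ∈ ball (0 : ℂ) 1 := isOpen_ball.mem_nhds (by simpa using hy₂')
    obtain ⟨r, hr, hrs⟩ := Metric.nhds_basis_closedBall.mem_iff.1 (h1.and h2)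
    refine ⟨r, hr, fun w hw => (hrs hw).2, fun w hw hne h0 => (hrs hw).1 ⟨h0, hne⟩⟩
  have hsph : ∀ w ∈ sphere y₂ r, P.evalEval y₁ w ≠ 0 := by
    intro w hw
    rw [← hpe]
    exact hrz w (sphere_subset_closedBall hw) (ne_of_mem_sphere hw hr.ne')
  obtain ⟨ρ, hρ, hρ1, hρz⟩ : ∃ ρ > 0, ball y₁ ρ ⊆ ball 0 1 ∧
      ∀ z ∈ ball y₁ ρ, ∀ w ∈ sphere y₂ r, P.evalEval z w ≠ 0 := by
    have h1 : ∀ᶠ z in 𝓝 y₁, ∀ w ∈ sphere y₂ r, P.evalEval z w ≠ 0 :=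
      (isCompact_sphere y₂ r).eventually_forall_of_forall_eventually fun w hw =>
        cP.continuousAt.eventually_ne (hsph w hw)
    have h2 : ∀ᶠ z in 𝓝 y₁, z ∈ ball (0 : ℂ) 1 := isOpen_ball.mem_nhds (by simpa using hy₁')
    obtain ⟨ρ, hρ, hρs⟩ := Metric.nhds_basis_ball.mem_iff.1 (h1.and h2)
    exact ⟨ρ, hρ, fun z hz => (hρs hz).2, fun z hz => (hρs hz).1⟩
  let s : ℂ → Multiset ℂ := fun z => (P.map (evalRingHom z)).roots.filter (· ∈ ball y₂ r)
  have hs : ∀ z ∈ ball y₁ ρ, ∀ ζ ∈ s z, ‖z‖ ≤ 1 ∧ ‖ζ‖ ≤ 1 ∧ P.evalEval z ζ = 0 := by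
    intro z hz ζ hζ
    rw [Multiset.mem_filter] at hζ
    refine ⟨(mem_ball_zero_iff.1 (hρ1 hz)).le, ?_, ?_⟩
    · exact (mem_ball_zero_iff.1 (hr1 (ball_subset_closedBall hζ.2))).le
    · rw [← map_evalRingHom_eval]; exact isRoot_of_mem_roots hζ.1
  have hd : ∀ f : ℂ[X][Y], DifferentiableOn ℂ
      (fun z => ((s z).map fun w => f.evalEval z w).sum) (ball y₁ ρ) := by
    intro f
    have h1 := (differentiableOn_circleIntegral_evalEval_div (A := f * derivative P) hr.le
      isOpen_ball hρz).const_mul (2 * Real.pi * Complex.I)⁻¹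
    refine h1.congr fun z hz => ?_
    rw [circleIntegral_evalEval_mul_derivative_div hr (hρz z hz),
      inv_mul_cancel_left₀ Complex.two_pi_I_ne_zero]
  obtain ⟨ρ', hρ', hρρ, hcard⟩ : ∃ ρ' > 0, ball y₁ ρ' ⊆ ball y₁ ρ ∧
      ∀ z ∈ ball y₁ ρ', (s z).card = (s y₁).card := by
    have h1 := ((hd 1).continuousOn.continuousAt (ball_mem_nhds y₁ hρ))
    simp only [evalEval_one, Multiset.map_const', Multiset.sum_replicate, nsmul_eq_mul,
      mul_one] at h1
    have h2 := (Metric.continuousAt_iff.1 h1) 1 one_pos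
    obtain ⟨δ, hδ, hδs⟩ := h2
    refine ⟨min δ ρ, lt_min hδ hρ, ball_subset_ball (min_le_right _ _), fun z hz => ?_⟩
    have h3 := hδs (lt_of_lt_of_le hz (min_le_left _ _))
    rw [Complex.dist_eq] at h3
    have h4 : ‖(((s z).card - (s y₁).card : ℤ) : ℂ)‖ < 1 := by push_cast; exact h3
    rw [Complex.norm_intCast] at h4
    have h5 : |((s z).card - (s y₁).card : ℤ)| < 1 := by exact_mod_cast h4
    have := Int.abs_lt_one_iff.1 h5
    lia
  have hs1 : ∀ ζ ∈ s y₁, ζ = y₂ := by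
    intro ζ hζ
    rw [Multiset.mem_filter] at hζ
    by_contra hne
    exact hrz ζ (ball_subset_closedBall hζ.2) hne (isRoot_of_mem_roots hζ.1)
  have hy₂s : y₂ ∈ s y₁ := by
    rw [Multiset.mem_filter]
    exact ⟨(mem_roots hp0).2 (by rw [IsRoot, hpe, hyP]), mem_ball_self hr⟩
  have hm : 0 < (s y₁).card := Multiset.card_pos_iff_exists_mem.2 ⟨y₂, hy₂s⟩
  let F : ℂ → ℂ := fun z => ((s z).map fun w => g.evalEval z w).sum
  have hFle : ∀ z, ‖F z‖ ≤ ((s z).map fun w => ‖g.evalEval z w‖).sum := by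
    intro z
    have := Multiset.le_sum_of_subadditive (norm : ℂ → ℝ) norm_zero.le norm_add_le
      ((s z).map fun w => g.evalEval z w)
    simpa [Multiset.map_map] using this
  have hF1 : F y₁ = (s y₁).card * g.evalEval y₁ y₂ := by
    have : s y₁ = Multiset.replicate (s y₁).card y₂ := Multiset.eq_replicate_card.2 hs1
    simp only [F]
    conv_lhs => rw [this]
    simp
  have hFmax : IsMaxOn (norm ∘ F) (ball y₁ ρ') y₁ := by
    intro z hz
    simp only [Function.comp]
    change ‖F z‖ ≤ ‖F y₁‖
    rw [hF1, norm_mul, hyM, Complex.norm_natCast, ← hcard z hz]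
    refine (hFle z).trans ?_
    have := Multiset.sum_le_card_nsmul ((s z).map fun w => ‖g.evalEval z w‖) M ?_
    · simpa using this
    · intro x hx
      obtain ⟨w, hw, rfl⟩ := Multiset.mem_map.1 hx
      obtain ⟨k1, k2, k3⟩ := hs z (hρρ hz) w hw
      exact hmax z w k1 k2 k3
  have hconst := Complex.norm_eqOn_of_isPreconnected_of_isMaxOn
    (convex_ball y₁ ρ').isPreconnected isOpen_ball ((hd g).mono hρρ) (mem_ball_self hρ') hFmax
  obtain ⟨z, hz, hyz⟩ := exists_mem_ball_norm_lt y₁ hρ'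
  have h1 : ‖F z‖ = (s z).card * M := by
    have : ‖F z‖ = ‖F y₁‖ := hconst hz
    rw [this, hF1, norm_mul, hyM, Complex.norm_natCast, hcard z hz]
  have h2 : ((s z).map fun w => ‖g.evalEval z w‖).sum < ((s z).map fun _ => M).sum := by
    refine Multiset.sum_lt_sum_of_nonempty ?_ fun w hw => ?_
    · exact Multiset.card_pos.1 (by rw [hcard z hz]; exact hm)
    · obtain ⟨k1, k2, k3⟩ := hs z (hρρ hz) w hw
      exact hlarge z w k1 k2 k3 hyz
  have h3 := hFle z
  simp only [Multiset.map_const', Multiset.sum_replicate, nsmul_eq_mul] at h2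
  linarith

end Bivariate

section Tower

lemma eval_congr_of_mem_supported {n : ℕ} {f : MvPolynomial ℕ ℂ}
    (hf : f ∈ MvPolynomial.supported ℂ (Iio n)) {x y : ℕ → ℂ} (h : ∀ i < n, x i = y i) :
    MvPolynomial.eval x f = MvPolynomial.eval y f := by
  rw [MvPolynomial.mem_supported] at hf
  exact MvPolynomial.eval₂Hom_congr' rfl (fun i hi _ => h i (hf hi)) rfl

lemma exists_mem_supported_Iio (f : MvPolynomial ℕ ℂ) :
    ∃ n, f ∈ MvPolynomial.supported ℂ (Iio n) := by
  obtain ⟨n, hn⟩ := f.vars.exists_nat_subset_range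
  exact ⟨n, MvPolynomial.mem_supported.2 fun i hi => by simpa using hn hi⟩

lemma supported_Iio_mono {m n : ℕ} (h : m ≤ n) :
    MvPolynomial.supported ℂ (Iio m) ≤ MvPolynomial.supported ℂ (Iio n) :=
  MvPolynomial.supported_mono (Iio_subset_Iio h)

lemma exists_eval_eq_evalEval {f : MvPolynomial ℕ ℂ}
    (hf : f ∈ MvPolynomial.supported ℂ (Iio 2)) :
    ∃ G : ℂ[X][Y], ∀ x : ℕ → ℂ, MvPolynomial.eval x f = G.evalEval (x 0) (x 1) := by
  rw [MvPolynomial.supported] at hf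
  induction hf using Algebra.adjoin_induction with
  | mem f hf =>
    obtain ⟨i, hi, rfl⟩ := hf
    obtain rfl | rfl : i = 0 ∨ i = 1 := by simp at hi; lia
    · exact ⟨C Polynomial.X, fun x => by simp [evalEval]⟩
    · exact ⟨Polynomial.X, fun x => by simp [evalEval]⟩
  | algebraMap c => exact ⟨C (C c), fun x => by simp [evalEval]⟩
  | add f g _ _ hf hg =>
    obtain ⟨F, hF⟩ := hf
    obtain ⟨G, hG⟩ := hg
    exact ⟨F + G, fun x => by simp [hF, hG]⟩
  | mul f g _ _ hf hg =>
    obtain ⟨F, hF⟩ := hf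
    obtain ⟨G, hG⟩ := hg
    exact ⟨F * G, fun x => by simp [hF, hG, evalEval_mul]⟩

/-- Modulo `X n ^ 2 = p`, every polynomial in the variables up to `n` is linear in `X n`. -/
lemma exists_eval_eq_add_mul {n : ℕ} {p f : MvPolynomial ℕ ℂ}
    (hp : p ∈ MvPolynomial.supported ℂ (Iio n))
    (hf : f ∈ MvPolynomial.supported ℂ (Iio (n + 1))) :
    ∃ a ∈ MvPolynomial.supported ℂ (Iio n), ∃ b ∈ MvPolynomial.supported ℂ (Iio n),
      ∀ x : ℕ → ℂ, x n ^ 2 = MvPolynomial.eval x p →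
        MvPolynomial.eval x f = MvPolynomial.eval x a + MvPolynomial.eval x b * x n := by
  rw [MvPolynomial.supported] at hf
  induction hf using Algebra.adjoin_induction with
  | mem f hf =>
    obtain ⟨i, hi, rfl⟩ := hf
    obtain hi | rfl : i < n ∨ i = n := by simp at hi; lia
    · exact ⟨.X i, Algebra.subset_adjoin ⟨i, hi, rfl⟩, 0, zero_mem _, fun x _ => by simp⟩
    · exact ⟨0, zero_mem _, 1, one_mem _, fun x _ => by simp⟩
  | algebraMap c =>
    exact ⟨algebraMap _ _ c, Subalgebra.algebraMap_mem _ _, 0, zero_mem _, fun x _ => by simp⟩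
  | add f g _ _ hf hg =>
    obtain ⟨a, ha, b, hb, hf⟩ := hf
    obtain ⟨a', ha', b', hb', hg⟩ := hg
    refine ⟨a + a', add_mem ha ha', b + b', add_mem hb hb', fun x hx => ?_⟩
    simp only [map_add, hf x hx, hg x hx]
    ring
  | mul f g _ _ hf hg =>
    obtain ⟨a, ha, b, hb, hf⟩ := hf
    obtain ⟨a', ha', b', hb', hg⟩ := hg
    refine ⟨a * a' + b * b' * p, add_mem (mul_mem ha ha') (mul_mem (mul_mem hb hb') hp),
      a * b' + b * a', add_mem (mul_mem ha hb') (mul_mem hb ha'), fun x hx => ?_⟩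
    simp only [map_add, map_mul, hf x hx, hg x hx, ← hx]
    ring

/-- The points `x` such that `x i` is a square root of `p i` at `x` for `2 ≤ i < n`. -/
def rootTower (p : ℕ → MvPolynomial ℕ ℂ) (n : ℕ) : Set (ℕ → ℂ) :=
  {x | ∀ i, 2 ≤ i → i < n → x i ^ 2 = MvPolynomial.eval x (p i)}

variable {p : ℕ → MvPolynomial ℕ ℂ}

lemma rootTower_succ {n : ℕ} (hn : 2 ≤ n) :
    rootTower p (n + 1) = rootTower p n ∩ {x | x n ^ 2 = MvPolynomial.eval x (p n)} := by
  ext x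
  refine ⟨fun h => ⟨fun i hi hin => h i hi (by lia), h n hn (by lia)⟩, fun h i hi hin => ?_⟩
  obtain hin | rfl : i < n ∨ i = n := by lia
  · exact h.1 i hi hin
  · exact h.2

lemma rootTower_anti {m n : ℕ} (h : m ≤ n) : rootTower p n ⊆ rootTower p m :=
  fun _ hx i hi him => hx i hi (him.trans_le h)

lemma mem_rootTower_congr (hp : ∀ n, 2 ≤ n → p n ∈ MvPolynomial.supported ℂ (Iio n)) {n : ℕ}
    {x y : ℕ → ℂ} (h : ∀ i < n, x i = y i) (hx : x ∈ rootTower p n) : y ∈ rootTower p n := by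
  intro i hi hin
  rw [← h i hin, hx i hi hin]
  exact eval_congr_of_mem_supported (hp i hi) fun k hk => h k (hk.trans hin)

lemma le_of_forall_pow_le_mul_pow {a b C : ℝ} (hb : 0 ≤ b) (h : ∀ k : ℕ, a ^ k ≤ C * b ^ k) :
    a ≤ b := by
  by_contra! hab
  have ha : 0 < a := hb.trans_lt hab
  have h1 : Tendsto (fun k : ℕ => C * (b / a) ^ k) atTop (𝓝 (C * 0)) :=
    (tendsto_pow_atTop_nhds_zero_of_lt_one (by positivity) ((div_lt_one ha).2 hab)).const_mul C
  have h2 : (1 : ℝ) ≤ C * 0 := by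
    refine ge_of_tendsto' h1 fun k => ?_
    rw [div_pow, mul_div_assoc', le_div_iff₀ (by positivity), one_mul]
    exact h k
  linarith

/-- The maximum principle on the level sets of a polynomial in the base variables. -/
theorem norm_eval_le_of_forall_boundary
    (hp : ∀ n, 2 ≤ n → p n ∈ MvPolynomial.supported ℂ (Iio n)) {P : MvPolynomial ℕ ℂ}
    (hP : P ∈ MvPolynomial.supported ℂ (Iio 2)) {c : ℂ} {n : ℕ} (hn : 2 ≤ n) :
    ∀ {g : MvPolynomial ℕ ℂ}, g ∈ MvPolynomial.supported ℂ (Iio n) → ∀ {R : ℝ}, 0 ≤ R →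
      (∀ s ∈ rootTower p n, ‖s 0‖ ≤ 1 → ‖s 1‖ ≤ 1 → (‖s 0‖ = 1 ∨ ‖s 1‖ = 1) →
        MvPolynomial.eval s P = c → ‖MvPolynomial.eval s g‖ ≤ R) →
      ∀ {x : ℕ → ℂ}, x ∈ rootTower p n → ‖x 0‖ ≤ 1 → ‖x 1‖ ≤ 1 → MvPolynomial.eval x P = c →
        ‖MvPolynomial.eval x g‖ ≤ R := by
  induction n, hn using Nat.le_induction with
  | base =>
    intro g hg R _ h x _ hx0 hx1 hxP
    obtain ⟨G, hG⟩ := exists_eval_eq_evalEval hg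
    obtain ⟨Q, hQ⟩ := exists_eval_eq_evalEval (sub_mem hP (Subalgebra.algebraMap_mem _ c))
    have hQ' : ∀ y : ℕ → ℂ, Q.evalEval (y 0) (y 1) = MvPolynomial.eval y P - c := by
      intro y
      rw [← hQ]
      simp
    rw [hG]
    refine norm_evalEval_le_of_forall_boundary (P := Q) (fun z w hz hw hzw h0 => ?_) hx0 hx1
      (by rw [hQ', hxP, sub_self])
    let s : ℕ → ℂ := fun i => if i = 0 then z else w
    have h2 := h s (fun i hi hi2 => by lia) hz hw hzw (by
      rw [← sub_eq_zero, ← hQ' s]; exact h0)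
    rwa [hG] at h2
  | succ n hn ih =>
    have main : ∀ {g : MvPolynomial ℕ ℂ}, g ∈ MvPolynomial.supported ℂ (Iio (n + 1)) →
        ∀ {R : ℝ}, 0 ≤ R →
        (∀ s ∈ rootTower p (n + 1), ‖s 0‖ ≤ 1 → ‖s 1‖ ≤ 1 → (‖s 0‖ = 1 ∨ ‖s 1‖ = 1) →
          MvPolynomial.eval s P = c → ‖MvPolynomial.eval s g‖ ≤ R) →
        ∀ {x : ℕ → ℂ}, x ∈ rootTower p (n + 1) → ‖x 0‖ ≤ 1 → ‖x 1‖ ≤ 1 →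
          MvPolynomial.eval x P = c → ‖MvPolynomial.eval x g‖ ≤ 3 * R := by
      intro g hg R hR h x hx hx0 hx1 hxP
      obtain ⟨a, ha, b, hb, hab⟩ := exists_eval_eq_add_mul (hp n hn) hg
      have key : ∀ s ∈ rootTower p n, ‖s 0‖ ≤ 1 → ‖s 1‖ ≤ 1 → (‖s 0‖ = 1 ∨ ‖s 1‖ = 1) →
          MvPolynomial.eval s P = c → ∀ w : ℂ, w ^ 2 = MvPolynomial.eval s (p n) →
          ‖MvPolynomial.eval s a + MvPolynomial.eval s b * w‖ ≤ R := by
        intro s hs h0 h1 hb1 hsP w hw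
        have hu : ∀ i < n, s i = Function.update s n w i := fun i hi => by
          rw [Function.update_of_ne hi.ne]
        have he : ∀ f ∈ MvPolynomial.supported ℂ (Iio n),
            MvPolynomial.eval (Function.update s n w) f = MvPolynomial.eval s f :=
          fun f hf => (eval_congr_of_mem_supported hf hu).symm
        have hw' : Function.update s n w n ^ 2 =
            MvPolynomial.eval (Function.update s n w) (p n) := by
          rw [Function.update_self, hw, he _ (hp n hn)]
        have h2 := h (Function.update s n w)
          (by rw [rootTower_succ hn]; exact ⟨mem_rootTower_congr hp hu hs, hw'⟩)
          (by rwa [← hu 0 (by lia)]) (by rwa [← hu 1 (by lia)])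
          (by rwa [← hu 0 (by lia), ← hu 1 (by lia)])
          (by rw [he _ (supported_Iio_mono hn hP), hsP])
        rwa [hab _ hw', he a ha, he b hb, Function.update_self] at h2
      rw [rootTower_succ hn] at hx
      have h1 : ‖MvPolynomial.eval x a‖ ≤ R := by
        refine ih ha hR (fun s hs h0 h1 hb1 hsP => ?_) hx.1 hx0 hx1 hxP
        obtain ⟨w, hw⟩ := IsAlgClosed.exists_pow_nat_eq (MvPolynomial.eval s (p n)) two_pos
        have k1 := key s hs h0 h1 hb1 hsP w hw
        have k2 := key s hs h0 h1 hb1 hsP (-w) (by rw [neg_sq, hw])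
        have k3 := (norm_add_le _ _).trans (add_le_add k1 k2)
        have k4 : MvPolynomial.eval s a + MvPolynomial.eval s b * w +
            (MvPolynomial.eval s a + MvPolynomial.eval s b * -w) =
            2 * MvPolynomial.eval s a := by ring
        rw [k4, norm_mul, Complex.norm_ofNat] at k3
        linarith
      have h2 : ‖MvPolynomial.eval x (a ^ 2 - b ^ 2 * p n)‖ ≤ R ^ 2 := by
        refine ih (sub_mem (pow_mem ha 2) (mul_mem (pow_mem hb 2) (hp n hn))) (by positivity)
          (fun s hs h0 h1 hb1 hsP => ?_) hx.1 hx0 hx1 hxP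
        obtain ⟨w, hw⟩ := IsAlgClosed.exists_pow_nat_eq (MvPolynomial.eval s (p n)) two_pos
        have k1 := key s hs h0 h1 hb1 hsP w hw
        have k2 := key s hs h0 h1 hb1 hsP (-w) (by rw [neg_sq, hw])
        have k4 : MvPolynomial.eval s (a ^ 2 - b ^ 2 * p n) =
            (MvPolynomial.eval s a + MvPolynomial.eval s b * w) *
            (MvPolynomial.eval s a + MvPolynomial.eval s b * -w) := by
          simp only [map_sub, map_mul, map_pow, ← hw]
          ring
        rw [k4, norm_mul, sq]
        exact mul_le_mul k1 k2 (norm_nonneg _) hR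
      have h3 : MvPolynomial.eval x g ^ 2 = 2 * MvPolynomial.eval x a * MvPolynomial.eval x g -
          MvPolynomial.eval x (a ^ 2 - b ^ 2 * p n) := by
        have : x n ^ 2 = MvPolynomial.eval x (p n) := hx.2
        rw [hab x this]
        simp only [map_sub, map_mul, map_pow, ← this]
        ring
      have h4 := congrArg norm h3
      rw [norm_pow] at h4
      have h5 : ‖MvPolynomial.eval x g‖ ^ 2 ≤ 2 * R * ‖MvPolynomial.eval x g‖ + R ^ 2 := by
        rw [h4]
        refine (norm_sub_le _ _).trans (add_le_add ?_ h2)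
        rw [norm_mul, norm_mul, Complex.norm_ofNat]
        gcongr
      nlinarith [norm_nonneg (MvPolynomial.eval x g)]
    intro g hg R hR h x hx hx0 hx1 hxP
    refine le_of_forall_pow_le_mul_pow (C := 3) hR fun k => ?_
    have := main (pow_mem hg k) (pow_nonneg hR k) (fun s hs h0 h1 hb1 hsP => ?_) hx hx0 hx1 hxP
    · simpa using this
    · rw [map_pow, norm_pow]
      exact pow_le_pow_left₀ (norm_nonneg _) (h s hs h0 h1 hb1 hsP) k

end Tower

section Recursion

/-- The closed unit polydisc in `ℕ → ℂ`. -/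
def polydisc : Set (ℕ → ℂ) := {x | ∀ i, ‖x i‖ ≤ 1}

lemma polydisc_eq_pi : polydisc = Set.pi univ fun _ => closedBall (0 : ℂ) 1 := by
  ext x
  simp [polydisc]

lemma isCompact_polydisc : IsCompact polydisc := by
  rw [polydisc_eq_pi]
  exact isCompact_univ_pi fun _ => isCompact_closedBall _ _

lemma zero_mem_polydisc : (0 : ℕ → ℂ) ∈ polydisc := fun i => by simp

lemma exists_norm_eval_le (f : MvPolynomial ℕ ℂ) :
    ∃ M : ℝ, 1 ≤ M ∧ ∀ x ∈ polydisc, ‖MvPolynomial.eval x f‖ ≤ M := by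
  obtain ⟨M, hM⟩ := isCompact_polydisc.exists_bound_of_continuousOn
    (MvPolynomial.continuous_eval f).continuousOn
  exact ⟨max 1 M, le_max_left _ _, fun x hx => (hM x hx).trans (le_max_right _ _)⟩

lemma exists_seq_dense_polynomials :
    ∃ q : ℕ → MvPolynomial ℕ ℂ, ∀ f, ∀ ε > 0, ∃ n, ∀ x ∈ polydisc,
      ‖MvPolynomial.eval x f - MvPolynomial.eval x (q n)‖ ≤ ε := by
  have : CompactSpace polydisc := isCompact_iff_compactSpace.1 isCompact_polydisc
  let φ : MvPolynomial ℕ ℂ → C(polydisc, ℂ) := fun f =>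
    ⟨fun x => MvPolynomial.eval x.1 f, (MvPolynomial.continuous_eval f).comp continuous_subtype_val⟩
  have : Nonempty (range φ) := ⟨⟨φ 0, 0, rfl⟩⟩
  obtain ⟨u, hu⟩ := TopologicalSpace.exists_dense_seq (range φ)
  choose q hq using fun n => (u n).2
  refine ⟨q, fun f ε hε => ?_⟩
  obtain ⟨n, hn⟩ := hu.exists_dist_lt ⟨φ f, f, rfl⟩ hε
  refine ⟨n, fun x hx => ?_⟩
  have h1 : dist (φ f) (φ (q n)) < ε := by rw [hq]; exact hn
  have h2 := (ContinuousMap.dist_apply_le_dist (f := φ f) (g := φ (q n)) ⟨x, hx⟩).trans h1.le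
  rwa [dist_eq_norm] at h2

lemma exists_seq_of_forall_exists {α : Type*} {Inv : ℕ → α → Prop} {Rel : ℕ → α → α → Prop}
    {a : α} (h0 : Inv 0 a) (step : ∀ n a, Inv n a → ∃ b, Inv (n + 1) b ∧ Rel n a b) :
    ∃ s : ℕ → α, s 0 = a ∧ ∀ n, Inv n (s n) ∧ Rel n (s n) (s (n + 1)) := by
  choose F hF using step
  let t : ∀ n, {a // Inv n a} := fun n =>
    Nat.rec ⟨a, h0⟩ (fun n b => ⟨F n b.1 b.2, (hF n b.1 b.2).1⟩) n
  exact ⟨fun n => (t n).1, rfl, fun n => ⟨(t n).2, (hF n (t n).1 (t n).2).2⟩⟩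

/-- The properties of the set `E` of points of a finite tower of square roots over the
variables `0` and `1` which are inherited by the next stage. -/
structure IsRootLevel (n : ℕ) (E : Set (ℕ → ℂ)) : Prop where
  congr : ∀ x y : ℕ → ℂ, (∀ i < n, x i = y i) → x ∈ E → y ∈ E
  exists_norm : ∀ f ∈ MvPolynomial.supported ℂ (Iio n), ∃ N ∈ MvPolynomial.supported ℂ (Iio 2),
    ∃ r : MvPolynomial ℕ ℂ, (∀ x ∈ E, MvPolynomial.eval x f * MvPolynomial.eval x r =
      MvPolynomial.eval x N) ∧
    (MvPolynomial.eval 0 N = 0 → ∃ x ∈ E, x 0 = 0 ∧ x 1 = 0 ∧ MvPolynomial.eval x f = 0)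
  finite : ∀ f ∈ MvPolynomial.supported ℂ (Iio n),
    {v | ∃ x ∈ E, x 0 = 0 ∧ x 1 = 0 ∧ MvPolynomial.eval x f = v}.Finite

lemma isRootLevel_univ : IsRootLevel 2 univ where
  congr _ _ _ _ := mem_univ _
  exists_norm f hf := ⟨f, hf, 1, fun x _ => by simp, fun h => ⟨0, mem_univ _, rfl, rfl, h⟩⟩
  finite f hf := by
    refine (finite_singleton (MvPolynomial.eval 0 f)).subset ?_
    rintro v ⟨x, -, h0, h1, rfl⟩
    refine eval_congr_of_mem_supported hf fun i hi => ?_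
    obtain rfl | rfl : i = 0 ∨ i = 1 := by lia
    · exact h0
    · exact h1

lemma finite_setOf_sub_sq_eq (a b : ℂ) : {v : ℂ | (v - a) ^ 2 = b}.Finite := by
  obtain ⟨w, hw⟩ := IsAlgClosed.exists_pow_nat_eq b two_pos
  refine (toFinite {a + w, a - w}).subset fun v hv => ?_
  rcases sq_eq_sq_iff_eq_or_eq_neg.1 ((hv : (v - a) ^ 2 = b).trans hw.symm) with h | h
  · left; linear_combination h
  · right; simp only [mem_singleton_iff]; linear_combination h

lemma IsRootLevel.succ {n : ℕ} {E : Set (ℕ → ℂ)} (hn : 2 ≤ n) (hE : IsRootLevel n E)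
    {p : MvPolynomial ℕ ℂ} (hp : p ∈ MvPolynomial.supported ℂ (Iio n)) :
    IsRootLevel (n + 1) (E ∩ {x | x n ^ 2 = MvPolynomial.eval x p}) where
  congr x y h hx := by
    refine ⟨hE.congr x y (fun i hi => h i (by lia)) hx.1, ?_⟩
    have h2 : x n ^ 2 = MvPolynomial.eval x p := hx.2
    rw [h n (by lia), eval_congr_of_mem_supported hp fun i hi => h i (by lia)] at h2
    exact h2
  exists_norm f hf := by
    obtain ⟨a, ha, b, hb, hab⟩ := exists_eval_eq_add_mul hp hf
    obtain ⟨N, hN, r, hr, h0⟩ := hE.exists_norm (a ^ 2 - b ^ 2 * p)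
      (sub_mem (pow_mem ha 2) (mul_mem (pow_mem hb 2) hp))
    refine ⟨N, hN, (a - b * .X n) * r, fun x hx => ?_, fun h => ?_⟩
    · have hx2 : x n ^ 2 = MvPolynomial.eval x p := hx.2
      rw [← hr x hx.1, hab x hx2]
      simp only [map_sub, map_mul, map_pow, MvPolynomial.eval_X, ← hx2]
      ring
    · obtain ⟨x, hxE, hx0, hx1, hx⟩ := h0 h
      obtain ⟨w, hw⟩ := IsAlgClosed.exists_pow_nat_eq (MvPolynomial.eval x p) two_pos
      have key : ∀ w : ℂ, w ^ 2 = MvPolynomial.eval x p →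
          MvPolynomial.eval x a + MvPolynomial.eval x b * w = 0 →
          ∃ y ∈ E ∩ {x | x n ^ 2 = MvPolynomial.eval x p}, y 0 = 0 ∧ y 1 = 0 ∧
            MvPolynomial.eval y f = 0 := by
        intro w hw hz
        have hu : ∀ i < n, x i = Function.update x n w i := fun i hi => by
          rw [Function.update_of_ne hi.ne]
        have he : ∀ f ∈ MvPolynomial.supported ℂ (Iio n),
            MvPolynomial.eval (Function.update x n w) f = MvPolynomial.eval x f :=
          fun f hf => (eval_congr_of_mem_supported hf hu).symm
        have hw' : Function.update x n w n ^ 2 =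
            MvPolynomial.eval (Function.update x n w) p := by
          rw [Function.update_self, hw, he _ hp]
        refine ⟨Function.update x n w, ⟨hE.congr _ _ hu hxE, hw'⟩, ?_, ?_, ?_⟩
        · rw [← hu 0 (by lia), hx0]
        · rw [← hu 1 (by lia), hx1]
        · rw [hab _ hw', he a ha, he b hb, Function.update_self, hz]
      have h3 : (MvPolynomial.eval x a + MvPolynomial.eval x b * w) *
          (MvPolynomial.eval x a + MvPolynomial.eval x b * -w) = 0 := by
        rw [← hx]
        simp only [map_sub, map_mul, map_pow, ← hw]
        ring
      rcases mul_eq_zero.1 h3 with h3 | h3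
      · exact key w hw h3
      · exact key (-w) (by rw [neg_sq, hw]) h3
  finite f hf := by
    obtain ⟨a, ha, b, hb, hab⟩ := exists_eval_eq_add_mul hp hf
    refine ((hE.finite a ha).biUnion fun α _ =>
      (hE.finite (b ^ 2 * p) (mul_mem (pow_mem hb 2) hp)).biUnion fun β _ =>
        finite_setOf_sub_sq_eq α β).subset ?_
    rintro v ⟨x, hx, h0, h1, rfl⟩
    have hx2 : x n ^ 2 = MvPolynomial.eval x p := hx.2
    simp only [mem_iUnion]
    refine ⟨_, ⟨x, hx.1, h0, h1, rfl⟩, _, ⟨x, hx.1, h0, h1, rfl⟩, ?_⟩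
    change (_ - _) ^ 2 = _
    rw [hab x hx2]
    simp only [map_mul, map_pow, ← hx2]
    ring

lemma IsRootLevel.exists_approx {n : ℕ} {E : Set (ℕ → ℂ)} (hE : IsRootLevel n E)
    {q : MvPolynomial ℕ ℂ} (hq : q ∈ MvPolynomial.supported ℂ (Iio n)) {τ : ℝ} (hτ : 0 < τ) :
    ∃ p ∈ MvPolynomial.supported ℂ (Iio n), ∃ l : ℂ, l ≠ 0 ∧
      (∀ x ∈ polydisc, ‖MvPolynomial.eval x p‖ ≤ 1) ∧
      (∀ x ∈ polydisc, ‖MvPolynomial.eval x q - l * MvPolynomial.eval x p‖ ≤ τ) ∧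
      ∃ N ∈ MvPolynomial.supported ℂ (Iio 2), ∃ r : MvPolynomial ℕ ℂ,
        (∀ x ∈ E, MvPolynomial.eval x p * MvPolynomial.eval x r = MvPolynomial.eval x N) ∧
        (∀ x ∈ polydisc, ‖MvPolynomial.eval x N‖ ≤ 1) ∧ MvPolynomial.eval 0 N ≠ 0 := by
  obtain ⟨ε, hε, hεE⟩ : ∃ ε ∈ ball (0 : ℂ) τ,
      ε ∉ {v | ∃ x ∈ E, x 0 = 0 ∧ x 1 = 0 ∧ MvPolynomial.eval x q = v} := by
    by_contra! H
    exact infinite_of_mem_nhds (0 : ℂ) (ball_mem_nhds 0 hτ) ((hE.finite q hq).subset H)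
  have hC : ∀ (z : ℂ) (m : ℕ), MvPolynomial.C z ∈ MvPolynomial.supported ℂ (Iio m) :=
    fun z m => Subalgebra.algebraMap_mem _ z
  obtain ⟨N, hN, r, hr, h0⟩ := hE.exists_norm (q - .C ε) (sub_mem hq (hC ε n))
  obtain ⟨M, hM, hMq⟩ := exists_norm_eval_le (q - .C ε)
  obtain ⟨L, hL, hLN⟩ := exists_norm_eval_le N
  have hM0 : (M : ℂ) ≠ 0 := by exact_mod_cast (by linarith : M ≠ 0)
  have hL0 : (L : ℂ) ≠ 0 := by exact_mod_cast (by linarith : L ≠ 0)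
  have hsc : ∀ {K : ℝ} {v : ℂ}, 1 ≤ K → ‖v‖ ≤ K → ‖(K : ℂ)⁻¹ * v‖ ≤ 1 := by
    intro K v hK hv
    rw [norm_mul, norm_inv, Complex.norm_real, Real.norm_of_nonneg (by linarith),
      inv_mul_le_one₀ (by linarith)]
    exact hv
  refine ⟨.C (M : ℂ)⁻¹ * (q - .C ε), mul_mem (hC _ n) (sub_mem hq (hC ε n)), M, hM0, ?_, ?_,
    .C (L : ℂ)⁻¹ * N, mul_mem (hC _ 2) hN, .C (M * (L : ℂ)⁻¹) * r, ?_, ?_, ?_⟩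
  · intro x hx
    rw [map_mul, MvPolynomial.eval_C]
    exact hsc hM (hMq x hx)
  · intro x hx
    rw [map_mul, MvPolynomial.eval_C, mul_inv_cancel_left₀ hM0, map_sub, MvPolynomial.eval_C,
      sub_sub_cancel]
    exact (mem_ball_zero_iff.1 hε).le
  · intro x hx
    simp only [map_mul, MvPolynomial.eval_C, ← hr x hx]
    field_simp
  · intro x hx
    rw [map_mul, MvPolynomial.eval_C]
    exact hsc hL (hLN x hx)
  · rw [map_mul, MvPolynomial.eval_C]
    refine mul_ne_zero (inv_ne_zero hL0) fun h => hεE ?_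
    obtain ⟨x, hx, hx0, hx1, hxq⟩ := h0 h
    rw [map_sub, MvPolynomial.eval_C, sub_eq_zero] at hxq
    exact ⟨x, hx, hx0, hx1, hxq⟩

lemma exists_pow_lt_mul_pow {a b ν : ℝ} (ha : 0 < a) (hab : a < b) (hν : 0 < ν) :
    ∃ k : ℕ, 2 ≤ k ∧ a ^ k < b ^ k * ν := by
  have hb : 0 < b := ha.trans hab
  have h1 := (tendsto_pow_atTop_nhds_zero_of_lt_one (div_pos ha hb).le
    ((div_lt_one hb).2 hab)).eventually_lt_const hν
  obtain ⟨k, hk, hk0⟩ := (h1.and (eventually_ge_atTop 2)).exists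
  refine ⟨k, hk0, ?_⟩
  rwa [div_pow, div_lt_iff₀' (by positivity)] at hk

/-- An infinite tower of square roots of polynomials `p n`, dense up to scalars, together with
polynomials `Q n` in the variables `0` and `1` through which every `p n` becomes invertible. -/
structure SquareRootTower where
  p : ℕ → MvPolynomial ℕ ℂ
  Q : ℕ → MvPolynomial ℕ ℂ
  c : ℕ → ℝ
  p_mem : ∀ n, 2 ≤ n → p n ∈ MvPolynomial.supported ℂ (Iio n)
  norm_p_le : ∀ n, 2 ≤ n → ∀ x ∈ polydisc, ‖MvPolynomial.eval x (p n)‖ ≤ 1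
  Q_mem : ∀ n, Q n ∈ MvPolynomial.supported ℂ (Iio 2)
  c_pos : ∀ n, 0 < c n
  c_lt : ∀ n, c n < ‖MvPolynomial.eval 0 (Q n)‖
  Q_dvd : ∀ n, ∃ H ∈ MvPolynomial.supported ℂ (Iio 2), Q (n + 1) = Q n ^ 2 * H
  le_of_succ : ∀ n, ∀ x ∈ polydisc, c (n + 1) ≤ ‖MvPolynomial.eval x (Q (n + 1))‖ →
    c n ≤ ‖MvPolynomial.eval x (Q n)‖
  exists_mul : ∀ n, 2 ≤ n → ∃ (m : ℕ) (r : MvPolynomial ℕ ℂ), ∀ x ∈ rootTower p n,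
    MvPolynomial.eval x (p n) * MvPolynomial.eval x r = MvPolynomial.eval x (Q m)
  dense : ∀ (f : MvPolynomial ℕ ℂ) (ε : ℝ), 0 < ε → ∃ n, 2 ≤ n ∧ ∃ l : ℂ, l ≠ 0 ∧
    ∀ x ∈ polydisc, ‖MvPolynomial.eval x f - l * MvPolynomial.eval x (p n)‖ ≤ ε

/-- A stage of the construction of a `SquareRootTower`. -/
structure RootStage where
  E : Set (ℕ → ℂ)
  Q : MvPolynomial ℕ ℂ
  c : ℝ
  p : MvPolynomial ℕ ℂ

lemma IsRootLevel.exists_next {n : ℕ} {a : RootStage} (hn : 2 ≤ n) (hE : IsRootLevel n a.E)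
    (hQ : a.Q ∈ MvPolynomial.supported ℂ (Iio 2)) (hc : 0 < a.c)
    (hcQ : a.c < ‖MvPolynomial.eval 0 a.Q‖) {q : MvPolynomial ℕ ℂ}
    (hq : q ∈ MvPolynomial.supported ℂ (Iio n)) {τ : ℝ} (hτ : 0 < τ) :
    ∃ b : RootStage, (IsRootLevel (n + 1) b.E ∧ b.Q ∈ MvPolynomial.supported ℂ (Iio 2) ∧
      0 < b.c ∧ b.c < ‖MvPolynomial.eval 0 b.Q‖) ∧
      b.p ∈ MvPolynomial.supported ℂ (Iio n) ∧
      (∀ x ∈ polydisc, ‖MvPolynomial.eval x b.p‖ ≤ 1) ∧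
      b.E = a.E ∩ {x | x n ^ 2 = MvPolynomial.eval x b.p} ∧
      (∃ H ∈ MvPolynomial.supported ℂ (Iio 2), b.Q = a.Q ^ 2 * H) ∧
      (∀ x ∈ polydisc, b.c ≤ ‖MvPolynomial.eval x b.Q‖ → a.c ≤ ‖MvPolynomial.eval x a.Q‖) ∧
      (∃ r : MvPolynomial ℕ ℂ, ∀ x ∈ a.E,
        MvPolynomial.eval x b.p * MvPolynomial.eval x r = MvPolynomial.eval x b.Q) ∧
      ∃ l : ℂ, l ≠ 0 ∧
        ∀ x ∈ polydisc, ‖MvPolynomial.eval x q - l * MvPolynomial.eval x b.p‖ ≤ τ := by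
  obtain ⟨p, hp, l, hl, hp1, hpq, N, hN, r, hr, hN1, hN0⟩ := hE.exists_approx hq hτ
  obtain ⟨k, hk, hck⟩ := exists_pow_lt_mul_pow hc hcQ (norm_pos_iff.2 hN0)
  refine ⟨⟨a.E ∩ {x | x n ^ 2 = MvPolynomial.eval x p}, a.Q ^ k * N, a.c ^ k, p⟩,
    ⟨hE.succ hn hp, mul_mem (pow_mem hQ k) hN, by positivity, by simpa using hck⟩, hp, hp1, rfl,
    ⟨a.Q ^ (k - 2) * N, mul_mem (pow_mem hQ _) hN, ?_⟩, fun x hx h => ?_,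
    ⟨a.Q ^ k * r, fun x hx => ?_⟩, l, hl, hpq⟩
  · rw [← mul_assoc, ← pow_add, Nat.add_sub_cancel' hk]
  · simp only [map_mul, map_pow, norm_mul, norm_pow] at h
    refine le_of_pow_le_pow_left₀ (by lia : k ≠ 0) (norm_nonneg _) (h.trans ?_)
    exact mul_le_of_le_one_right (by positivity) (hN1 x hx)
  · simp only [map_mul, map_pow, ← hr x hx]
    ring

theorem nonempty_squareRootTower : Nonempty SquareRootTower := by
  classical
  obtain ⟨q, hq⟩ := exists_seq_dense_polynomials
  let u : ℕ → MvPolynomial ℕ ℂ := fun n =>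
    if q n.unpair.1 ∈ MvPolynomial.supported ℂ (Iio (n + 2)) then q n.unpair.1 else 1
  have hu : ∀ n, u n ∈ MvPolynomial.supported ℂ (Iio (n + 2)) := by
    intro n
    simp only [u]
    split_ifs with h
    · exact h
    · exact one_mem _
  obtain ⟨s, hs0, hs⟩ := exists_seq_of_forall_exists (a := (⟨univ, 1, 1 / 2, 0⟩ : RootStage))
    (Inv := fun n b => IsRootLevel (n + 2) b.E ∧ b.Q ∈ MvPolynomial.supported ℂ (Iio 2) ∧
      0 < b.c ∧ b.c < ‖MvPolynomial.eval 0 b.Q‖)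
    (Rel := fun n a b => b.p ∈ MvPolynomial.supported ℂ (Iio (n + 2)) ∧
      (∀ x ∈ polydisc, ‖MvPolynomial.eval x b.p‖ ≤ 1) ∧
      b.E = a.E ∩ {x | x (n + 2) ^ 2 = MvPolynomial.eval x b.p} ∧
      (∃ H ∈ MvPolynomial.supported ℂ (Iio 2), b.Q = a.Q ^ 2 * H) ∧
      (∀ x ∈ polydisc, b.c ≤ ‖MvPolynomial.eval x b.Q‖ → a.c ≤ ‖MvPolynomial.eval x a.Q‖) ∧
      (∃ r : MvPolynomial ℕ ℂ, ∀ x ∈ a.E,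
        MvPolynomial.eval x b.p * MvPolynomial.eval x r = MvPolynomial.eval x b.Q) ∧
      ∃ l : ℂ, l ≠ 0 ∧ ∀ x ∈ polydisc,
        ‖MvPolynomial.eval x (u n) - l * MvPolynomial.eval x b.p‖ ≤ 1 / ((n : ℝ) + 1))
    ⟨isRootLevel_univ, one_mem _, by norm_num, by simp; norm_num⟩
    (fun n a ⟨h1, h2, h3, h4⟩ =>
      h1.exists_next (by lia) h2 h3 h4 (hu n) (by positivity))
  have hE : ∀ n, (s n).E = rootTower (fun i => (s (i - 1)).p) (n + 2) := by
    intro n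
    induction n with
    | zero =>
      rw [hs0]
      exact (eq_univ_of_forall fun x i h2 hi => by lia).symm
    | succ n ih =>
      rw [(hs n).2.2.2.1, ih, rootTower_succ (n := n + 2) (by lia)]
      rfl
  have hsub : ∀ n, 2 ≤ n → n - 2 + 1 = n - 1 ∧ n - 2 + 2 = n := fun n hn => by lia
  refine ⟨⟨fun i => (s (i - 1)).p, fun i => (s i).Q, fun i => (s i).c, fun n hn => ?_,
    fun n hn => ?_, fun n => (hs n).1.2.1, fun n => (hs n).1.2.2.1, fun n => (hs n).1.2.2.2,
    fun n => (hs n).2.2.2.2.1, fun n => (hs n).2.2.2.2.2.1, fun n hn => ?_, fun f ε hε => ?_⟩⟩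
  · have := (hs (n - 2)).2.1
    rwa [(hsub n hn).1, (hsub n hn).2] at this
  · have := (hs (n - 2)).2.2.1
    rwa [(hsub n hn).1] at this
  · obtain ⟨r, hr⟩ := (hs (n - 2)).2.2.2.2.2.2.1
    rw [(hsub n hn).1, hE, (hsub n hn).2] at hr
    exact ⟨n - 1, r, hr⟩
  · obtain ⟨k, hk⟩ := hq f (ε / 2) (by positivity)
    obtain ⟨m, hm⟩ := exists_mem_supported_Iio (q k)
    obtain ⟨j, hj⟩ := exists_nat_one_div_lt (half_pos hε)
    set n := Nat.pair k (max j m) with hn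
    have hnm : max j m ≤ n := Nat.right_le_pair _ _
    have hun : u n = q k := by
      have h1 : n.unpair.1 = k := by rw [hn, Nat.unpair_pair]
      simp only [u, h1]
      exact if_pos (supported_Iio_mono (by lia) hm)
    obtain ⟨l, hl, hlp⟩ := (hs n).2.2.2.2.2.2.2
    refine ⟨n + 2, by lia, l, hl, fun x hx => ?_⟩
    have h1 := hk x hx
    have h2 := hlp x hx
    rw [hun] at h2
    have h3 : 1 / ((n : ℝ) + 1) ≤ 1 / ((j : ℝ) + 1) := by
      have : (j : ℝ) ≤ n := by exact_mod_cast (le_max_left j m).trans hnm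
      gcongr
    calc _ ≤ _ := norm_sub_le_norm_sub_add_norm_sub _ (MvPolynomial.eval x (q k)) _
      _ ≤ ε / 2 + 1 / ((n : ℝ) + 1) := add_le_add h1 h2
      _ ≤ ε := by linarith

end Recursion

section Gleason

lemma norm_sub_le_norm_one_sub_mul {z : ℂ} {a : ℝ} (hz : ‖z‖ ≤ 1) (ha : |a| ≤ 1) :
    ‖z - a‖ ≤ ‖1 - a * z‖ := by
  refine le_of_sq_le_sq ?_ (norm_nonneg _)
  rw [← Complex.normSq_eq_norm_sq, ← Complex.normSq_eq_norm_sq]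
  have h1 : Complex.normSq z ≤ 1 := by
    rw [Complex.normSq_eq_norm_sq]
    exact pow_le_one₀ (norm_nonneg _) hz
  have h2 : a ^ 2 ≤ 1 := (sq_le_one_iff_abs_le_one a).2 ha
  simp only [Complex.normSq_apply, Complex.sub_re, Complex.sub_im, Complex.mul_re, Complex.mul_im,
    Complex.ofReal_re, Complex.ofReal_im, Complex.one_re, Complex.one_im] at h1 ⊢
  nlinarith [mul_nonneg (sub_nonneg.2 h2) (sub_nonneg.2 h1)]

variable {A : Type*} [NormedCommRing A] [NormedAlgebra ℂ A] [CompleteSpace A] [NormOneClass A]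

/-- If squares are dense, distinct characters are separated by functions vanishing at one of
them and almost unimodular at the other. -/
lemma exists_lt_norm_character (hnorm : ∀ h : A, ‖h ^ 2‖ = ‖h‖ ^ 2)
    (hsq : ∀ f : A, ∀ ε > 0, ∃ h : A, ‖f - h ^ 2‖ ≤ ε) {φ ψ : A →ₐ[ℂ] ℂ} (hφψ : φ ≠ ψ)
    {t : ℝ} (ht : t < 1) : ∃ f : A, ‖f‖ ≤ 1 ∧ ψ f = 0 ∧ t < ‖φ f‖ := by
  let B : Set ℝ := {r | ∃ f : A, ‖f‖ ≤ 1 ∧ ψ f = 0 ∧ r = ‖φ f‖}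
  have hB1 : ∀ r ∈ B, r ≤ 1 := by
    rintro r ⟨f, hf, -, rfl⟩
    exact (AlgHom.norm_apply_le_self φ f).trans hf
  have hBb : BddAbove B := ⟨1, hB1⟩
  have hB0 : B.Nonempty := ⟨0, 0, by simp, by simp, by simp⟩
  set δ := sSup B with hδ
  have hhom : ∀ f : A, ψ f = 0 → ‖φ f‖ ≤ δ * ‖f‖ := by
    intro f hf
    rcases (norm_nonneg f).eq_or_lt with h0 | h0
    · have := AlgHom.norm_apply_le_self φ f
      rw [← h0] at this ⊢
      simpa using this
    · have hc : ‖((‖f‖ : ℂ))⁻¹‖ = ‖f‖⁻¹ := by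
        rw [norm_inv, Complex.norm_real, norm_norm]
      have h1 : ‖f‖⁻¹ * ‖φ f‖ ∈ B := by
        refine ⟨((‖f‖ : ℂ))⁻¹ • f, ?_, ?_, ?_⟩
        · rw [norm_smul, hc, inv_mul_cancel₀ h0.ne']
        · rw [map_smul, hf, smul_zero]
        · rw [map_smul, norm_smul, hc]
      have h2 := le_csSup hBb h1
      rwa [inv_mul_le_iff₀ h0, mul_comm] at h2
  have hδ0 : 0 < δ := by
    obtain ⟨f, hf⟩ : ∃ f, φ f ≠ ψ f := by
      by_contra! H
      exact hφψ (AlgHom.ext H)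
    have h1 := hhom (f - algebraMap ℂ A (ψ f)) (by simp)
    have h2 : 0 < ‖φ (f - algebraMap ℂ A (ψ f))‖ := by
      refine norm_pos_iff.2 ?_
      rw [map_sub, AlgHom.commutes]
      exact sub_ne_zero.2 hf
    by_contra! hle
    nlinarith [norm_nonneg (f - algebraMap ℂ A (ψ f))]
  have hbound : ∀ τ : ℝ, 0 < τ → δ ≤ (δ * (1 + 2 * τ) + τ) ^ 2 + τ ^ 2 := by
    intro τ hτ
    refine csSup_le hB0 ?_
    rintro r ⟨f, hf, hψf, rfl⟩
    obtain ⟨h, hh⟩ := hsq f (τ ^ 2) (by positivity)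
    have hψ : ‖ψ h‖ ≤ τ := by
      have h1 := (AlgHom.norm_apply_le_self ψ _).trans hh
      rw [map_sub, hψf, zero_sub, norm_neg, map_pow, norm_pow] at h1
      exact le_of_sq_le_sq h1 hτ.le
    have hh1 : ‖h‖ ≤ 1 + τ := by
      have h1 := norm_le_norm_add_norm_sub f (h ^ 2)
      rw [hnorm] at h1
      refine le_of_sq_le_sq (h1.trans ?_) (by positivity)
      nlinarith
    have h1 : ‖h - algebraMap ℂ A (ψ h)‖ ≤ 1 + 2 * τ := by
      have h2 := norm_sub_le h (algebraMap ℂ A (ψ h))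
      rw [norm_algebraMap'] at h2
      linarith
    have h2 := hhom (h - algebraMap ℂ A (ψ h)) (by simp)
    rw [map_sub, AlgHom.commutes] at h2
    have h3 : ‖φ h‖ ≤ δ * (1 + 2 * τ) + τ := by
      have h4 : ‖φ h‖ ≤ ‖φ h - ψ h‖ + ‖ψ h‖ := by
        simpa using norm_add_le (φ h - ψ h) (ψ h)
      have h5 : ‖φ h - ψ h‖ ≤ δ * (1 + 2 * τ) := h2.trans (by gcongr)
      linarith
    have h4 : ‖φ f - φ h ^ 2‖ ≤ τ ^ 2 := by
      have := (AlgHom.norm_apply_le_self φ _).trans hh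
      rwa [map_sub, map_pow] at this
    have h5 : ‖φ f‖ ≤ ‖φ h ^ 2‖ + ‖φ f - φ h ^ 2‖ := norm_le_norm_add_norm_sub' _ _
    rw [norm_pow] at h5
    have h6 := pow_le_pow_left₀ (norm_nonneg _) h3 2
    linarith
  have hδsq : δ ≤ δ ^ 2 := by
    have h1 : Tendsto (fun τ : ℝ => (δ * (1 + 2 * τ) + τ) ^ 2 + τ ^ 2) (𝓝[>] 0) (𝓝 (δ ^ 2)) := by
      have : Continuous fun τ : ℝ => (δ * (1 + 2 * τ) + τ) ^ 2 + τ ^ 2 := by fun_prop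
      simpa using (this.tendsto 0).mono_left nhdsWithin_le_nhds
    exact ge_of_tendsto h1 (by filter_upwards [self_mem_nhdsWithin] with τ hτ using hbound τ hτ)
  have hδ1 : 1 ≤ δ := by nlinarith
  obtain ⟨r, ⟨f, hf, hψf, rfl⟩, hr⟩ := exists_lt_of_lt_csSup hB0 (ht.trans_le hδ1)
  exact ⟨f, hf, hψf, hr⟩

/-- If squares and Möbius transforms behave as in a uniform algebra and squares are dense, then
distinct characters have distance `2`. -/
theorem sSup_norm_character_sub_eq_two (hnorm : ∀ h : A, ‖h ^ 2‖ = ‖h‖ ^ 2)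
    (hmoebius : ∀ f : A, ‖f‖ ≤ 1 → ∀ a : ℝ, 0 ≤ a → a < 1 →
      ∃ F : A, ‖F‖ ≤ 1 ∧ F * (1 - (a : ℂ) • f) = f - algebraMap ℂ A a)
    (hsq : ∀ f : A, ∀ ε > 0, ∃ h : A, ‖f - h ^ 2‖ ≤ ε) {φ ψ : A →ₐ[ℂ] ℂ} (hφψ : φ ≠ ψ) :
    sSup {r : ℝ | ∃ f : A, ‖f‖ ≤ 1 ∧ r = ‖φ f - ψ f‖} = 2 := by
  refine csSup_eq_of_forall_le_of_forall_lt_exists_gt ⟨0, 0, by simp, by simp⟩ ?_ fun w hw => ?_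
  · rintro r ⟨f, hf, rfl⟩
    have h1 := (AlgHom.norm_apply_le_self φ f).trans hf
    have h2 := (AlgHom.norm_apply_le_self ψ f).trans hf
    linarith [norm_sub_le (φ f) (ψ f)]
  obtain ⟨a, ha, ha1⟩ := exists_between (max_lt (by linarith : w - 1 < 1) one_pos)
  have ha0 : 0 < a := (le_max_right _ _).trans_lt ha
  have hwa : w < 1 + a := by linarith [le_max_left (w - 1) 0]
  obtain ⟨t, ht1, ht⟩ : ∃ t < 1, ∀ s : ℝ, t < s → s ≤ 1 →
      w < s * (1 - a ^ 2) / (1 - a * s) := by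
    have hc : ContinuousAt (fun s : ℝ => s * (1 - a ^ 2) / (1 - a * s)) 1 :=
      ContinuousAt.div (by fun_prop) (by fun_prop) (by linarith)
    have h1 : w < 1 * (1 - a ^ 2) / (1 - a * 1) := by
      rw [lt_div_iff₀ (by linarith)]
      nlinarith
    obtain ⟨ε, hε, h2⟩ := Metric.eventually_nhds_iff.1 (hc.eventually (lt_mem_nhds h1))
    refine ⟨1 - ε, by linarith, fun s hs hs1 => h2 ?_⟩
    rw [Real.dist_eq, abs_lt]
    constructor <;> linarith
  obtain ⟨f, hf, hψf, hφf⟩ := exists_lt_norm_character hnorm hsq hφψ (max_lt ht1 one_pos)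
  have hφ0 : 0 < ‖φ f‖ := (le_max_right _ _).trans_lt hφf
  have hφ1 : ‖φ f‖ ≤ 1 := (AlgHom.norm_apply_le_self φ f).trans hf
  set s := ‖φ f‖ with hs
  set l : ℂ := s / φ f with hl
  have hφne : φ f ≠ 0 := norm_pos_iff.1 hφ0
  have hl1 : ‖l‖ = 1 := by
    rw [hl, norm_div, Complex.norm_real, hs, norm_norm, div_self hφ0.ne']
  obtain ⟨F, hF, hFm⟩ := hmoebius (l • f)
    (by rw [norm_smul, hl1, one_mul]; exact hf) a ha0.le ha1
  have has : 1 - a * s > 0 := by nlinarith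
  have hne : (1 - a * s : ℂ) ≠ 0 := by exact_mod_cast has.ne'
  have h1 : φ F = (s - a) / (1 - a * s) := by
    have h2 := congrArg φ hFm
    simp only [map_mul, map_sub, map_one, map_smul, AlgHom.commutes, smul_eq_mul, hl,
      div_mul_cancel₀ _ hφne] at h2
    rw [eq_div_iff hne]
    exact h2
  have h2 : ψ F = -a := by
    have h2 := congrArg ψ hFm
    simpa only [map_mul, map_sub, map_one, map_smul, AlgHom.commutes, smul_eq_mul, hψf, mul_zero,
      sub_zero, mul_one, zero_sub, Complex.coe_algebraMap, Algebra.algebraMap_self, RingHom.id_apply] using h2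
  refine ⟨_, ⟨F, hF, rfl⟩, (ht s ((le_max_left _ _).trans_lt hφf) hφ1).trans_le (le_of_eq ?_)⟩
  have h3 : φ F - ψ F = ((s * (1 - a ^ 2) / (1 - a * s) : ℝ) : ℂ) := by
    rw [h1, h2]
    push_cast
    have hne' : (1 - s * a : ℂ) ≠ 0 := by rwa [mul_comm]
    field_simp
    ring
  rw [h3, Complex.norm_real, Real.norm_of_nonneg]
  have : a ^ 2 ≤ 1 := by nlinarith
  exact div_nonneg (mul_nonneg hφ0.le (by linarith)) has.le

end Gleason

section UniformAlgebra

variable {X : Type*} [TopologicalSpace X] [CompactSpace X] {A : Subalgebra ℂ C(X, ℂ)}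

lemma norm_sq_continuousMap (f : C(X, ℂ)) : ‖f ^ 2‖ = ‖f‖ ^ 2 := by
  refine le_antisymm (norm_pow_le' f two_pos) ?_
  refine (Real.le_sqrt (norm_nonneg _) (norm_nonneg _)).1 ?_
  refine (ContinuousMap.norm_le _ (Real.sqrt_nonneg _)).2 fun x => ?_
  refine (Real.le_sqrt (norm_nonneg _) (norm_nonneg _)).2 ?_
  rw [← norm_pow]
  exact (f ^ 2).norm_coe_le_norm x

lemma exists_moebius (hA : IsClosed (A : Set C(X, ℂ))) {f : A} (hf : ‖f‖ ≤ 1) {a : ℝ}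
    (ha0 : 0 ≤ a) (ha1 : a < 1) :
    ∃ F : A, ‖F‖ ≤ 1 ∧ F * (1 - (a : ℂ) • f) = f - algebraMap ℂ A a := by
  have : CompleteSpace A := hA.completeSpace_coe
  have hlt : ‖(a : ℂ) • f‖ < 1 := by
    rw [norm_smul, Complex.norm_real, Real.norm_of_nonneg ha0]
    nlinarith [norm_nonneg f]
  set u := Units.oneSub ((a : ℂ) • f) hlt with hu
  have hF : (f - algebraMap ℂ A a) * (↑u⁻¹ : A) * (1 - (a : ℂ) • f) = f - algebraMap ℂ A a := by
    have : (1 - (a : ℂ) • f) = (u : A) := rfl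
    rw [this, mul_assoc, Units.inv_mul, mul_one]
  refine ⟨(f - algebraMap ℂ A a) * (↑u⁻¹ : A), ?_, hF⟩
  generalize (f - algebraMap ℂ A a) * (↑u⁻¹ : A) = F at hF
  refine (ContinuousMap.norm_le _ zero_le_one).2 fun x => ?_
  have h1 : (F : C(X, ℂ)) x * (1 - a * (f : C(X, ℂ)) x) = (f : C(X, ℂ)) x - a :=
    congrArg (fun g : A => (g : C(X, ℂ)) x) hF
  have hfx : ‖(f : C(X, ℂ)) x‖ ≤ 1 := ((f : C(X, ℂ)).norm_coe_le_norm x).trans hf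
  have h2 : 0 < ‖1 - a * (f : C(X, ℂ)) x‖ := by
    refine norm_pos_iff.2 fun h0 => ?_
    have h3 : ‖(a : ℂ) * (f : C(X, ℂ)) x‖ = 1 := by rw [← sub_eq_zero.1 h0, norm_one]
    rw [norm_mul, Complex.norm_real, Real.norm_of_nonneg ha0] at h3
    nlinarith [norm_nonneg ((f : C(X, ℂ)) x)]
  have h3 := norm_sub_le_norm_one_sub_mul hfx (a := a) (by rw [abs_of_nonneg ha0]; exact ha1.le)
  rw [← h1, norm_mul] at h3
  exact le_of_mul_le_mul_right (h3.trans_eq (one_mul _).symm) h2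

theorem sSup_norm_character_sub_eq_two_of_isClosed (hA : IsClosed (A : Set C(X, ℂ)))
    (hsq : ∀ f : A, ∀ ε > 0, ∃ h : A, ‖f - h ^ 2‖ ≤ ε) [NormOneClass A] {φ ψ : A →ₐ[ℂ] ℂ}
    (hφψ : φ ≠ ψ) : sSup {r : ℝ | ∃ f : A, ‖f‖ ≤ 1 ∧ r = ‖φ f - ψ f‖} = 2 := by
  have : CompleteSpace A := hA.completeSpace_coe
  refine sSup_norm_character_sub_eq_two (fun h => ?_)
    (fun f hf a ha0 ha1 => exists_moebius hA hf ha0 ha1) hsq hφψ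
  exact norm_sq_continuousMap (h : C(X, ℂ))

end UniformAlgebra

namespace SquareRootTower

variable (T : SquareRootTower)

lemma le_norm_of_le {n m : ℕ} (h : n ≤ m) {x : ℕ → ℂ} (hx : x ∈ polydisc)
    (hm : T.c m ≤ ‖MvPolynomial.eval x (T.Q m)‖) : T.c n ≤ ‖MvPolynomial.eval x (T.Q n)‖ := by
  induction m, h using Nat.le_induction with
  | base => exact hm
  | succ m _ ih => exact ih (T.le_of_succ m x hx hm)

lemma exists_eq_mul {n m : ℕ} (h : n ≤ m) :
    ∃ H ∈ MvPolynomial.supported ℂ (Iio 2), T.Q m = T.Q n * H := by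
  induction m, h using Nat.le_induction with
  | base => exact ⟨1, one_mem _, by simp⟩
  | succ m _ ih =>
    obtain ⟨H, hH, h1⟩ := ih
    obtain ⟨H', hH', h2⟩ := T.Q_dvd m
    exact ⟨H * T.Q m * H', mul_mem (mul_mem hH (T.Q_mem m)) hH', by rw [h2, h1]; ring⟩

lemma exists_eq_mul_mul (n m : ℕ) : ∃ (k : ℕ) (H : MvPolynomial ℕ ℂ),
    T.Q k = T.Q n * T.Q m * H := by
  obtain ⟨H, -, h1⟩ := T.exists_eq_mul (le_max_left n m)
  obtain ⟨H', -, h2⟩ := T.exists_eq_mul (le_max_right n m)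
  obtain ⟨H'', -, h3⟩ := T.Q_dvd (max n m)
  refine ⟨max n m + 1, H * H' * H'', ?_⟩
  rw [h3, sq]
  nth_rw 1 [h1]
  rw [h2]
  ring

lemma norm_le_one_of_mem_rootTower {n : ℕ} {x : ℕ → ℂ} (hx : x ∈ rootTower T.p n)
    (h0 : ‖x 0‖ ≤ 1) (h1 : ‖x 1‖ ≤ 1) : ∀ i < n, ‖x i‖ ≤ 1 := by
  intro i
  induction i using Nat.strong_induction_on with
  | _ i ih =>
    intro hi
    obtain rfl | rfl | h2 : i = 0 ∨ i = 1 ∨ 2 ≤ i := by lia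
    · exact h0
    · exact h1
    let y : ℕ → ℂ := fun k => if k < i then x k else 0
    have hy : y ∈ polydisc := by
      intro k
      simp only [y]
      split_ifs with hk
      · exact ih k hk (hk.trans hi)
      · simp
    have h3 : MvPolynomial.eval x (T.p i) = MvPolynomial.eval y (T.p i) :=
      eval_congr_of_mem_supported (T.p_mem i h2) fun k hk => by simp [y, hk]
    have h4 := T.norm_p_le i h2 y hy
    rw [← h3, ← hx i h2 hi, norm_pow] at h4
    exact le_of_sq_le_sq (by rwa [one_pow]) zero_le_one

lemma isClosed_rootTower (n : ℕ) : IsClosed (rootTower T.p n) := by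
  simp only [rootTower, ofPred_forall]
  refine isClosed_iInter fun i => isClosed_iInter fun _ => isClosed_iInter fun _ => ?_
  exact isClosed_eq (by fun_prop) (MvPolynomial.continuous_eval _)

lemma isClosed_polydisc : IsClosed polydisc := isCompact_polydisc.isClosed

/-- The character space of the uniform algebra attached to a tower. -/
def space : Set (ℕ → ℂ) :=
  {x | x ∈ polydisc ∧ (∀ n, x ∈ rootTower T.p n) ∧
    ∀ n, T.c n ≤ ‖MvPolynomial.eval x (T.Q n)‖}

lemma isClosed_le_norm_eval (f g : MvPolynomial ℕ ℂ) (a : ℝ) :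
    IsClosed {x : ℕ → ℂ | a * ‖MvPolynomial.eval x f‖ ≤ ‖MvPolynomial.eval x g‖} :=
  isClosed_le (continuous_const.mul (MvPolynomial.continuous_eval f).norm)
    (MvPolynomial.continuous_eval g).norm

lemma isClosed_const_le_norm_eval (g : MvPolynomial ℕ ℂ) (a : ℝ) :
    IsClosed {x : ℕ → ℂ | a ≤ ‖MvPolynomial.eval x g‖} :=
  isClosed_le continuous_const (MvPolynomial.continuous_eval g).norm

lemma isCompact_space : IsCompact T.space := by
  refine isCompact_polydisc.of_isClosed_subset ?_ fun x hx => hx.1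
  have : T.space = polydisc ∩ ((⋂ n, rootTower T.p n) ∩
      ⋂ n, {x | T.c n ≤ ‖MvPolynomial.eval x (T.Q n)‖}) := by
    ext x
    simp only [space, mem_inter_iff, mem_iInter]
    rfl
  rw [this]
  exact isClosed_polydisc.inter ((isClosed_iInter T.isClosed_rootTower).inter
    (isClosed_iInter fun n => isClosed_const_le_norm_eval _ _))

instance : CompactSpace T.space := isCompact_iff_compactSpace.1 T.isCompact_space

lemma exists_mem_rootTower_zero (n : ℕ) :
    ∃ x ∈ polydisc, x 0 = 0 ∧ x 1 = 0 ∧ x ∈ rootTower T.p n := by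
  induction n with
  | zero => exact ⟨0, zero_mem_polydisc, rfl, rfl, fun i _ hi => by lia⟩
  | succ n ih =>
    obtain ⟨x, hx, hx0, hx1, hxn⟩ := ih
    by_cases hn : 2 ≤ n
    · obtain ⟨w, hw⟩ := IsAlgClosed.exists_pow_nat_eq (MvPolynomial.eval x (T.p n)) two_pos
      have hu : ∀ i < n, x i = Function.update x n w i := fun i hi => by
        rw [Function.update_of_ne hi.ne]
      refine ⟨Function.update x n w, fun i => ?_, ?_, ?_, ?_⟩
      · by_cases hi : i = n
        · rw [hi, Function.update_self]
          have h1 := T.norm_p_le n hn x hx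
          rw [← hw, norm_pow] at h1
          exact le_of_sq_le_sq (by rwa [one_pow]) zero_le_one
        · rw [Function.update_of_ne hi]
          exact hx i
      · rw [← hu 0 (by lia), hx0]
      · rw [← hu 1 (by lia), hx1]
      · rw [rootTower_succ hn]
        refine ⟨mem_rootTower_congr T.p_mem hu hxn, ?_⟩
        change Function.update x n w n ^ 2 = _
        rw [Function.update_self, hw]
        exact eval_congr_of_mem_supported (T.p_mem n hn) hu
    · exact ⟨x, hx, hx0, hx1, fun i hi hin => by lia⟩

lemma exists_mem_space_zero : ∃ x ∈ T.space, x 0 = 0 ∧ x 1 = 0 := by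
  obtain ⟨x, hx⟩ := IsCompact.nonempty_iInter_of_sequence_nonempty_isCompact_isClosed
    (fun n => polydisc ∩ ({x | x 0 = 0} ∩ ({x | x 1 = 0} ∩ rootTower T.p n)))
    (fun n x hx => ⟨hx.1, hx.2.1, hx.2.2.1, rootTower_anti n.le_succ hx.2.2.2⟩)
    (fun n => by
      obtain ⟨x, h1, h2, h3, h4⟩ := T.exists_mem_rootTower_zero n
      exact ⟨x, h1, h2, h3, h4⟩)
    (isCompact_polydisc.inter_right
      ((isClosed_eq (by fun_prop) continuous_const).inter
        ((isClosed_eq (by fun_prop) continuous_const).inter (T.isClosed_rootTower 0))))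
    (fun n => isClosed_polydisc.inter ((isClosed_eq (by fun_prop) continuous_const).inter
        ((isClosed_eq (by fun_prop) continuous_const).inter (T.isClosed_rootTower n))))
  rw [mem_iInter] at hx
  have h0 : x 0 = 0 := (hx 0).2.1
  have h1 : x 1 = 0 := (hx 0).2.2.1
  refine ⟨x, ⟨(hx 0).1, fun n => (hx n).2.2.2, fun n => ?_⟩, h0, h1⟩
  rw [eval_congr_of_mem_supported (T.Q_mem n) (y := 0) fun i hi => ?_]
  · exact (T.c_lt n).le
  · obtain rfl | rfl : i = 0 ∨ i = 1 := by lia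
    · exact h0
    · exact h1

instance : Nonempty T.space :=
  let ⟨x, hx, _⟩ := T.exists_mem_space_zero
  ⟨⟨x, hx⟩⟩

variable {T}

lemma eval_Q_ne_zero (x : T.space) (n : ℕ) : MvPolynomial.eval x.1 (T.Q n) ≠ 0 := by
  refine norm_pos_iff.1 ((T.c_pos n).trans_le (x.2.2.2 n))

lemma coord_sq (x : T.space) {n : ℕ} (hn : 2 ≤ n) :
    x.1 n ^ 2 = MvPolynomial.eval x.1 (T.p n) :=
  x.2.2.1 (n + 1) n hn n.lt_succ_self

variable (T)

/-- The `i`-th coordinate function. -/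
def coord (i : ℕ) : C(T.space, ℂ) := ⟨fun x => x.1 i, (continuous_apply i).comp continuous_subtype_val⟩

/-- Polynomials as functions on the character space. -/
noncomputable def polyMap : MvPolynomial ℕ ℂ →ₐ[ℂ] C(T.space, ℂ) := MvPolynomial.aeval T.coord

@[simp] lemma polyMap_apply (f : MvPolynomial ℕ ℂ) (x : T.space) :
    T.polyMap f x = MvPolynomial.eval x.1 f := by
  induction f using MvPolynomial.induction_on with
  | C a => simp [polyMap]
  | add f g hf hg => simp [hf, hg]
  | mul_X f i hf => simp [hf]; simp [polyMap, coord]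

/-- The inverse of `Q n` on the character space. -/
noncomputable def invQ (n : ℕ) : C(T.space, ℂ) :=
  ⟨fun x => (MvPolynomial.eval x.1 (T.Q n))⁻¹,
    ((MvPolynomial.continuous_eval _).comp continuous_subtype_val).inv₀
      fun x => eval_Q_ne_zero x n⟩

/-- The functions of the form `g / Q n` with a polynomial `g`. -/
def preAlgebra : Subalgebra ℂ C(T.space, ℂ) where
  carrier := {f | ∃ (n : ℕ) (g : MvPolynomial ℕ ℂ), ∀ x : T.space,
    f x * MvPolynomial.eval x.1 (T.Q n) = MvPolynomial.eval x.1 g}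
  mul_mem' := by
    rintro f f' ⟨n, g, hf⟩ ⟨m, g', hf'⟩
    obtain ⟨k, H, hk⟩ := T.exists_eq_mul_mul n m
    refine ⟨k, g * g' * H, fun x => ?_⟩
    simp only [ContinuousMap.mul_apply, hk, map_mul, ← hf, ← hf']
    ring
  add_mem' := by
    rintro f f' ⟨n, g, hf⟩ ⟨m, g', hf'⟩
    obtain ⟨k, H, hk⟩ := T.exists_eq_mul_mul n m
    refine ⟨k, (g * T.Q m + g' * T.Q n) * H, fun x => ?_⟩
    simp only [ContinuousMap.add_apply, hk, map_mul, map_add, ← hf, ← hf']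
    ring
  algebraMap_mem' a := ⟨0, .C a * T.Q 0, fun x => by simp⟩

lemma polyMap_mem (f : MvPolynomial ℕ ℂ) : T.polyMap f ∈ T.preAlgebra :=
  ⟨0, f * T.Q 0, fun x => by simp⟩

lemma invQ_mem (n : ℕ) : T.invQ n ∈ T.preAlgebra :=
  ⟨n, 1, fun x => by simp [invQ, eval_Q_ne_zero]⟩

lemma norm_invQ_le (n : ℕ) : ‖T.invQ n‖ ≤ (T.c n)⁻¹ := by
  refine (ContinuousMap.norm_le _ (inv_pos.2 (T.c_pos n)).le).2 fun x => ?_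
  change ‖(_ : ℂ)⁻¹‖ ≤ _
  rw [norm_inv]
  exact inv_anti₀ (T.c_pos n) (x.2.2.2 n)

/-- Invertible squares are dense in the algebra of functions `g / Q n`. -/
lemma exists_sq_approx {f : C(T.space, ℂ)} (hf : f ∈ T.preAlgebra) {ε : ℝ} (hε : 0 < ε) :
    ∃ h ∈ T.preAlgebra, ∃ v ∈ T.preAlgebra, h ^ 2 * v = 1 ∧ ‖f - h ^ 2‖ ≤ ε := by
  obtain ⟨n, g, hg⟩ := hf
  have hcn := T.c_pos n
  obtain ⟨m, hm, l, hl, hlp⟩ := T.dense (g * T.Q n) (ε * T.c n ^ 2) (by positivity)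
  obtain ⟨μ, rfl⟩ := IsAlgClosed.exists_pow_nat_eq l two_pos
  have hμ : μ ≠ 0 := by
    rintro rfl
    simp at hl
  obtain ⟨k, r, hr⟩ := T.exists_mul m hm
  have hh : ∀ x : T.space, (μ • (T.polyMap (.X m) * T.invQ n)) x =
      μ * (x.1 m * (MvPolynomial.eval x.1 (T.Q n))⁻¹) := fun x => by
    simp [invQ]
  refine ⟨μ • (T.polyMap (.X m) * T.invQ n),
    Subalgebra.smul_mem _ (mul_mem (T.polyMap_mem _) (T.invQ_mem n)) _,
    (μ ^ 2)⁻¹ • (T.polyMap (r * T.Q n ^ 2) * T.invQ k),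
    Subalgebra.smul_mem _ (mul_mem (T.polyMap_mem _) (T.invQ_mem k)) _, ?_, ?_⟩
  · ext x
    have h1 := eval_Q_ne_zero x n
    have h2 := eval_Q_ne_zero x k
    have h3 : (T.polyMap (r * T.Q n ^ 2) * T.invQ k) x = MvPolynomial.eval x.1 r *
        MvPolynomial.eval x.1 (T.Q n) ^ 2 * (MvPolynomial.eval x.1 (T.Q k))⁻¹ := by
      simp [invQ]
    rw [ContinuousMap.mul_apply, ContinuousMap.pow_apply, hh, ContinuousMap.smul_apply, h3,
      smul_eq_mul, ContinuousMap.one_apply]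
    have h4 := hr x.1 (x.2.2.1 m)
    rw [← coord_sq x hm] at h4
    field_simp
    rw [← h4]
  · refine (ContinuousMap.norm_le _ hε.le).2 fun x => ?_
    have h1 := eval_Q_ne_zero x n
    have h2 := hlp x.1 x.2.1
    rw [ContinuousMap.sub_apply, ContinuousMap.pow_apply, hh]
    have h3 : (f x - (μ * (x.1 m * (MvPolynomial.eval x.1 (T.Q n))⁻¹)) ^ 2) *
        MvPolynomial.eval x.1 (T.Q n) ^ 2 =
        MvPolynomial.eval x.1 (g * T.Q n) - μ ^ 2 * MvPolynomial.eval x.1 (T.p m) := by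
      rw [map_mul, ← hg x, ← coord_sq x hm]
      field_simp
    rw [← h3, norm_mul, norm_pow] at h2
    have h4 := pow_le_pow_left₀ hcn.le (x.2.2.2 n) 2
    have h5 : 0 < T.c n ^ 2 := by positivity
    by_contra! hlt
    have h6 := mul_lt_mul_of_pos_right hlt h5
    have h7 := mul_le_mul_of_nonneg_left h4
      (norm_nonneg (f x - (μ * (x.1 m * (MvPolynomial.eval x.1 (T.Q n))⁻¹)) ^ 2))
    linarith

/-- The part of the character space over the boundary of the bidisc. -/
def boundary : Set T.space := {x | ‖x.1 0‖ = 1 ∨ ‖x.1 1‖ = 1}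

lemma isClosed_boundary : IsClosed T.boundary :=
  (isClosed_eq (T.coord 0).continuous.norm continuous_const).union
    (isClosed_eq (T.coord 1).continuous.norm continuous_const)

lemma boundary_ne_univ : T.boundary ≠ univ := by
  obtain ⟨x, hx, h0, h1⟩ := T.exists_mem_space_zero
  intro h
  have : (⟨x, hx⟩ : T.space) ∈ T.boundary := h ▸ mem_univ _
  simp [boundary, h0, h1] at this

lemma exists_forall_norm_eval_lt {f : C(T.space, ℂ)} {n : ℕ} {g : MvPolynomial ℕ ℂ}
    (hg : ∀ x : T.space, f x * MvPolynomial.eval x.1 (T.Q n) = MvPolynomial.eval x.1 g)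
    {R R' : ℝ} (hR : R < R') (h : ∀ s ∈ T.boundary, ‖f s‖ ≤ R) :
    ∃ N, ∀ m ≥ N, ∀ s ∈ polydisc, s ∈ rootTower T.p m → (‖s 0‖ = 1 ∨ ‖s 1‖ = 1) →
      T.c m ≤ ‖MvPolynomial.eval s (T.Q m)‖ →
      ‖MvPolynomial.eval s g‖ < R' * ‖MvPolynomial.eval s (T.Q n)‖ := by
  by_contra! H
  let K : ℕ → Set (ℕ → ℂ) := fun m => polydisc ∩ (rootTower T.p m ∩
    (({s | ‖s 0‖ = 1} ∪ {s | ‖s 1‖ = 1}) ∩ ({s | T.c m ≤ ‖MvPolynomial.eval s (T.Q m)‖} ∩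
      {s | R' * ‖MvPolynomial.eval s (T.Q n)‖ ≤ ‖MvPolynomial.eval s g‖})))
  have hanti : ∀ {m k : ℕ}, m ≤ k → K k ⊆ K m := fun hmk s hs =>
    ⟨hs.1, rootTower_anti hmk hs.2.1, hs.2.2.1, T.le_norm_of_le hmk hs.1 hs.2.2.2.1,
      hs.2.2.2.2⟩
  have hcl : ∀ m, IsClosed (K m) := fun m => isClosed_polydisc.inter
    ((T.isClosed_rootTower m).inter
      (((isClosed_eq (by fun_prop) continuous_const).union
        (isClosed_eq (by fun_prop) continuous_const)).inter
        ((isClosed_const_le_norm_eval _ _).inter (isClosed_le_norm_eval _ _ _))))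
  obtain ⟨x, hx⟩ := IsCompact.nonempty_iInter_of_sequence_nonempty_isCompact_isClosed K
    (fun m => hanti m.le_succ)
    (fun m => by
      obtain ⟨k, hk, s, h1, h2, h3, h4, h5⟩ := H m
      exact ⟨s, hanti hk ⟨h1, h2, h3, h4, h5⟩⟩)
    (isCompact_polydisc.of_isClosed_subset (hcl 0) inter_subset_left) hcl
  rw [mem_iInter] at hx
  let y : T.space := ⟨x, (hx 0).1, fun m => (hx m).2.1, fun m => (hx m).2.2.2.1⟩
  have h1 : ‖f y‖ ≤ R := h y (hx 0).2.2.1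
  have h2 : R' * ‖MvPolynomial.eval x (T.Q n)‖ ≤ ‖MvPolynomial.eval x g‖ := (hx 0).2.2.2.2
  have h3 : f y * MvPolynomial.eval x (T.Q n) = MvPolynomial.eval x g := hg y
  rw [← h3, norm_mul] at h2
  have h4 : 0 < ‖MvPolynomial.eval x (T.Q n)‖ := norm_pos_iff.2 (eval_Q_ne_zero y n)
  have h5 := le_of_mul_le_mul_right h2 h4
  linarith

lemma norm_le_of_forall_boundary {f : C(T.space, ℂ)} (hf : f ∈ T.preAlgebra) {R : ℝ}
    (hR : 0 ≤ R) (h : ∀ s ∈ T.boundary, ‖f s‖ ≤ R) (x : T.space) : ‖f x‖ ≤ R := by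
  obtain ⟨n, g, hg⟩ := hf
  refine le_of_forall_gt_imp_ge_of_dense fun R' hR' => ?_
  have hR'0 : 0 ≤ R' := hR.trans hR'.le
  obtain ⟨N, hN⟩ := T.exists_forall_norm_eval_lt hg hR' h
  obtain ⟨d, hd⟩ := exists_mem_supported_Iio g
  set J := max (max N n) (max d 2) with hJ
  have hJ2 : 2 ≤ J := by lia
  obtain ⟨H, hH, hQ⟩ := T.exists_eq_mul (by lia : n ≤ J)
  have hgJ : g ∈ MvPolynomial.supported ℂ (Iio J) := supported_Iio_mono (by lia) hd
  have hHJ : H ∈ MvPolynomial.supported ℂ (Iio J) := supported_Iio_mono hJ2 hH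
  have hQJ : ∀ m, T.Q m ∈ MvPolynomial.supported ℂ (Iio J) :=
    fun m => supported_Iio_mono hJ2 (T.Q_mem m)
  have key := norm_eval_le_of_forall_boundary T.p_mem (T.Q_mem J)
    (c := MvPolynomial.eval x.1 (T.Q J)) hJ2 (mul_mem hgJ hHJ)
    (R := R' * ‖MvPolynomial.eval x.1 (T.Q J)‖) (by positivity) (fun s hs h0 h1 hb hsc => ?_)
    (x.2.2.1 J) (x.2.1 0) (x.2.1 1) rfl
  · rw [map_mul, ← hg x, mul_assoc, ← map_mul, ← hQ, norm_mul] at key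
    exact le_of_mul_le_mul_right key (norm_pos_iff.2 (eval_Q_ne_zero x J))
  · let t : ℕ → ℂ := fun i => if i < J then s i else 0
    have hst : ∀ i < J, s i = t i := fun i hi => by simp [t, hi]
    have ht : t ∈ polydisc := by
      intro i
      simp only [t]
      split_ifs with hi
      · exact T.norm_le_one_of_mem_rootTower hs h0 h1 i hi
      · simp
    have htQ : MvPolynomial.eval t (T.Q J) = MvPolynomial.eval x.1 (T.Q J) := by
      rw [← hsc]
      exact (eval_congr_of_mem_supported (hQJ J) hst).symm
    have h2 := hN J (by lia) t ht (mem_rootTower_congr T.p_mem hst hs)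
      (by rwa [← hst 0 (by lia), ← hst 1 (by lia)]) (by rw [htQ]; exact x.2.2.2 J)
    rw [eval_congr_of_mem_supported (mul_mem hgJ hHJ) hst, ← htQ, hQ, map_mul, map_mul, norm_mul,
      norm_mul, ← mul_assoc]
    exact mul_le_mul_of_nonneg_right h2.le (norm_nonneg _)

/-- The uniform algebra attached to a tower. -/
noncomputable def uniformAlgebra : Subalgebra ℂ C(T.space, ℂ) := T.preAlgebra.topologicalClosure

lemma isClosed_uniformAlgebra : IsClosed (T.uniformAlgebra : Set C(T.space, ℂ)) :=
  T.preAlgebra.isClosed_topologicalClosure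

lemma preAlgebra_le : T.preAlgebra ≤ T.uniformAlgebra := T.preAlgebra.le_topologicalClosure

lemma exists_preAlgebra_approx {f : C(T.space, ℂ)} (hf : f ∈ T.uniformAlgebra) {ε : ℝ}
    (hε : 0 < ε) : ∃ g ∈ T.preAlgebra, ‖f - g‖ < ε := by
  obtain ⟨g, hg, hfg⟩ := Metric.mem_closure_iff.1
    (hf : f ∈ closure (T.preAlgebra : Set C(T.space, ℂ))) ε hε
  exact ⟨g, hg, by rwa [← dist_eq_norm]⟩

lemma norm_le_of_forall_boundary_of_mem {f : C(T.space, ℂ)} (hf : f ∈ T.uniformAlgebra) {R : ℝ}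
    (hR : 0 ≤ R) (h : ∀ s ∈ T.boundary, ‖f s‖ ≤ R) (x : T.space) : ‖f x‖ ≤ R := by
  refine le_of_forall_pos_le_add fun ε hε => ?_
  obtain ⟨g, hg, hfg⟩ := T.exists_preAlgebra_approx hf (half_pos hε)
  have h1 : ∀ y, ‖f y - g y‖ ≤ ε / 2 := fun y => ((f - g).norm_coe_le_norm y).trans hfg.le
  have h2 := T.norm_le_of_forall_boundary hg (R := R + ε / 2) (by positivity) (fun s hs => by
    linarith [h s hs, h1 s, norm_le_norm_add_norm_sub (f s) (g s)]) x
  linarith [h1 x, norm_le_norm_add_norm_sub' (f x) (g x)]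

lemma sSup_boundary {f : C(T.space, ℂ)} (hf : f ∈ T.uniformAlgebra) :
    sSup ((fun x => ‖f x‖) '' T.boundary) = sSup ((fun x => ‖f x‖) '' univ) := by
  have hne : T.boundary.Nonempty := by
    by_contra! he
    have := T.norm_le_of_forall_boundary (one_mem T.preAlgebra) le_rfl (by simp [he])
      (Classical.arbitrary _)
    simp at this
    linarith
  have hbdd : ∀ S : Set T.space, BddAbove ((fun x => ‖f x‖) '' S) := by
    intro S
    refine ⟨‖f‖, ?_⟩
    rintro _ ⟨x, -, rfl⟩
    exact f.norm_coe_le_norm x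
  refine le_antisymm (csSup_le_csSup (hbdd _) (hne.image _) (image_mono (subset_univ _))) ?_
  refine csSup_le (univ_nonempty.image _) ?_
  rintro _ ⟨x, -, rfl⟩
  refine T.norm_le_of_forall_boundary_of_mem hf ?_ (fun s hs => ?_) x
  · exact Real.sSup_nonneg (by rintro _ ⟨s, -, rfl⟩; exact norm_nonneg _)
  · exact le_csSup (hbdd _) ⟨s, hs, rfl⟩

lemma exists_unit_sq_approx (f : T.uniformAlgebra) {ε : ℝ} (hε : 0 < ε) :
    ∃ h : T.uniformAlgebra, IsUnit (h ^ 2) ∧ ‖f - h ^ 2‖ ≤ ε := by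
  obtain ⟨g, hg, hfg⟩ := T.exists_preAlgebra_approx f.2 (half_pos hε)
  obtain ⟨h, hh, v, hv, hhv, hgh⟩ := T.exists_sq_approx hg (half_pos hε)
  let h' : T.uniformAlgebra := ⟨h, T.preAlgebra_le hh⟩
  let v' : T.uniformAlgebra := ⟨v, T.preAlgebra_le hv⟩
  have h1 : h' ^ 2 * v' = 1 := Subtype.ext hhv
  have h2 : ‖(f : C(T.space, ℂ)) - h ^ 2‖ ≤ ε := by
    linarith [norm_sub_le_norm_sub_add_norm_sub (f : C(T.space, ℂ)) g (h ^ 2)]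
  exact ⟨h', IsUnit.of_mul_eq_one v' h1, h2⟩

instance : NormOneClass T.uniformAlgebra where
  norm_one := (norm_one : ‖(1 : C(T.space, ℂ))‖ = 1)

lemma exists_forall_character_eq (φ : T.uniformAlgebra →ₐ[ℂ] ℂ) :
    ∃ x : T.space, ∀ f : T.uniformAlgebra, φ f = (f : C(T.space, ℂ)) x := by
  have : CompleteSpace T.uniformAlgebra := T.isClosed_uniformAlgebra.completeSpace_coe
  have hφ : ∀ f : T.uniformAlgebra, ‖φ f‖ ≤ ‖f‖ := AlgHom.norm_apply_le_self φ
  let P : MvPolynomial ℕ ℂ →ₐ[ℂ] T.uniformAlgebra :=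
    T.polyMap.codRestrict _ fun f => T.preAlgebra_le (T.polyMap_mem f)
  let x : ℕ → ℂ := fun i => φ (P (.X i))
  have hx : ∀ f, φ (P f) = MvPolynomial.eval x f := by
    have h1 : φ.comp P = MvPolynomial.aeval x := MvPolynomial.algHom_ext fun i => by simp [x]
    intro f
    have h2 := DFunLike.congr_fun h1 f
    rwa [MvPolynomial.aeval_eq_eval] at h2
  have hPcongr : ∀ f g : MvPolynomial ℕ ℂ,
      (∀ y : T.space, MvPolynomial.eval y.1 f = MvPolynomial.eval y.1 g) → P f = P g :=
    fun f g h => Subtype.ext (ContinuousMap.ext fun y => by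
      change T.polyMap f y = T.polyMap g y
      rw [polyMap_apply, polyMap_apply, h])
  have hQ : ∀ n, T.c n ≤ ‖MvPolynomial.eval x (T.Q n)‖ := by
    intro n
    have h1 : P (T.Q n) * ⟨T.invQ n, T.preAlgebra_le (T.invQ_mem n)⟩ = 1 := by
      refine Subtype.ext (ContinuousMap.ext fun y => ?_)
      change T.polyMap (T.Q n) y * (MvPolynomial.eval y.1 (T.Q n))⁻¹ = 1
      rw [polyMap_apply, mul_inv_cancel₀ (eval_Q_ne_zero y n)]
    have h2 := congrArg (fun z => ‖φ z‖) h1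
    simp only [map_mul, map_one, norm_mul, norm_one, hx] at h2
    have h3 := (hφ ⟨T.invQ n, T.preAlgebra_le (T.invQ_mem n)⟩).trans (T.norm_invQ_le n)
    have h4 := mul_le_mul_of_nonneg_left h3 (norm_nonneg (MvPolynomial.eval x (T.Q n)))
    rw [h2, ← div_eq_mul_inv, one_le_div (T.c_pos n)] at h4
    exact h4
  have hxT : x ∈ T.space := by
    refine ⟨fun i => (hφ _).trans ?_, fun n i hi _ => ?_, hQ⟩
    · refine (ContinuousMap.norm_le _ zero_le_one).2 fun y => ?_
      change ‖T.polyMap (.X i) y‖ ≤ 1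
      rw [polyMap_apply, MvPolynomial.eval_X]
      exact y.2.1 i
    · rw [← hx, ← map_pow, ← map_pow]
      exact congrArg φ (hPcongr _ _ fun y => by simp [coord_sq y hi])
  refine ⟨⟨x, hxT⟩, fun f => ?_⟩
  have hpre : ∀ g (hg : g ∈ T.preAlgebra), φ ⟨g, T.preAlgebra_le hg⟩ = g ⟨x, hxT⟩ := by
    rintro g ⟨n, q, hq⟩
    have h1 : (⟨g, T.preAlgebra_le ⟨n, q, hq⟩⟩ : T.uniformAlgebra) * P (T.Q n) = P q := by
      refine Subtype.ext (ContinuousMap.ext fun y => ?_)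
      change g y * T.polyMap (T.Q n) y = T.polyMap q y
      rw [polyMap_apply, polyMap_apply, hq]
    have h2 := congrArg φ h1
    rw [map_mul, hx, hx, ← hq ⟨x, hxT⟩] at h2
    exact mul_right_cancel₀ (eval_Q_ne_zero ⟨x, hxT⟩ n) h2
  refine eq_of_forall_dist_le fun ε hε => ?_
  obtain ⟨g, hg, hfg⟩ := T.exists_preAlgebra_approx f.2 (half_pos hε)
  have h1 : ‖φ f - φ ⟨g, T.preAlgebra_le hg⟩‖ ≤ ε / 2 := by
    rw [← map_sub]
    exact (hφ _).trans hfg.le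
  have h2 : ‖(f : C(T.space, ℂ)) ⟨x, hxT⟩ - g ⟨x, hxT⟩‖ ≤ ε / 2 :=
    (((f : C(T.space, ℂ)) - g).norm_coe_le_norm _).trans hfg.le
  rw [hpre g hg] at h1
  rw [dist_eq_norm]
  rw [norm_sub_rev] at h2
  linarith [norm_sub_le_norm_sub_add_norm_sub (φ f) (g ⟨x, hxT⟩) ((f : C(T.space, ℂ)) ⟨x, hxT⟩)]

lemma exists_mem_uniformAlgebra_ne {x y : T.space} (h : x ≠ y) :
    ∃ f ∈ T.uniformAlgebra, f x ≠ f y := by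
  by_contra! hf
  refine h (Subtype.ext (funext fun i => ?_))
  simpa using hf _ (T.preAlgebra_le (T.polyMap_mem (.X i)))

lemma dense_isUnit : Dense {f : T.uniformAlgebra | IsUnit f} := fun f => by
  refine Metric.mem_closure_iff.2 fun ε hε => ?_
  obtain ⟨h, hu, hh⟩ := T.exists_unit_sq_approx f (half_pos hε)
  exact ⟨h ^ 2, hu, by rw [dist_eq_norm]; linarith⟩

lemma sSup_norm_character_sub {φ ψ : T.uniformAlgebra →ₐ[ℂ] ℂ} (h : φ ≠ ψ) :
    sSup {r : ℝ | ∃ f : T.uniformAlgebra, ‖f‖ ≤ 1 ∧ r = ‖φ f - ψ f‖} = 2 :=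
  sSup_norm_character_sub_eq_two_of_isClosed T.isClosed_uniformAlgebra
    (fun f _ hε => (T.exists_unit_sq_approx f hε).imp fun _ hg => hg.2) h

end SquareRootTower

/-- There exist a compact metrizable space `X` and a natural uniform algebra `A` on `X`
such that: (i) `A` has dense invertibles; (ii) every Gleason part of `A` is a single
point, i.e. any two distinct characters `φ, ψ` of `A` are at dual-norm distance `2`;
and (iii) the Shilov boundary of `A` is a proper subset of `X`: there is a proper closed
subset `S ⊊ X` on which every `f ∈ A` attains its sup norm. -/
theorem stmt12 :
    ∃ (X : Type) (_ : TopologicalSpace X) (_ : CompactSpace X) (_ : TopologicalSpace.MetrizableSpace X)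
      (_ : T2Space X) (A : Subalgebra ℂ C(X, ℂ)),
      IsClosed (A : Set C(X, ℂ)) ∧
      (∀ x y : X, x ≠ y → ∃ f ∈ A, f x ≠ f y) ∧
      (∀ φ : A →ₐ[ℂ] ℂ, ∃ x : X, ∀ f : A, φ f = (f : C(X, ℂ)) x) ∧
      Dense {f : A | IsUnit f} ∧
      (∀ φ ψ : A →ₐ[ℂ] ℂ, φ ≠ ψ →
        sSup {r : ℝ | ∃ f : A, ‖f‖ ≤ 1 ∧ r = ‖φ f - ψ f‖} = 2) ∧
      (∃ S : Set X, IsClosed S ∧ S ≠ Set.univ ∧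
        ∀ f ∈ A, sSup ((fun x => ‖f x‖) '' S) = sSup ((fun x => ‖f x‖) '' Set.univ)) := by
  obtain ⟨T⟩ := nonempty_squareRootTower
  exact ⟨T.space, inferInstance, inferInstance, inferInstance, inferInstance, T.uniformAlgebra,
    T.isClosed_uniformAlgebra, fun _ _ => T.exists_mem_uniformAlgebra_ne,
    T.exists_forall_character_eq, T.dense_isUnit, fun _ _ => T.sSup_norm_character_sub,
    T.boundary, T.isClosed_boundary, T.boundary_ne_univ, fun _ => T.sSup_boundary⟩
end

section
/- Let X be a compact Hausdorff space and let A be a natural uniform algebra on X. Suppose A is approximately regular, in the sense that every closed subset E of X is A-convex: for every x ∈ X \ E there exists f ∈ A with |f(x)| > sup_{e ∈ E} |f(e)|. If A has dense invertibles, then the invertible elements of C(X, ℂ) are dense in C(X, ℂ). -/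
namespace EllOne

section Norm

variable {B M : Type*} [NormedCommRing B] [AddCommMonoid M]

/-- The `ℓ¹` seminorm on an additive monoid algebra over a normed commutative ring. -/
noncomputable def addGroupSeminorm (B M : Type*) [NormedCommRing B] [AddCommMonoid M] :
    AddGroupSeminorm (AddMonoidAlgebra B M) where
  toFun P := P.coeff.sum fun _ a => ‖a‖
  map_zero' := by simp
  add_le' P Q := by
    classical
    rw [AddMonoidAlgebra.coeff_add,
      Finsupp.sum_of_support_subset _ Finsupp.support_add _ (by simp),
      Finsupp.sum_of_support_subset P.coeff Finset.subset_union_left _ (by simp),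
      Finsupp.sum_of_support_subset Q.coeff Finset.subset_union_right _ (by simp),
      ← Finset.sum_add_distrib]
    exact Finset.sum_le_sum fun i _ => norm_add_le _ _
  neg' P := by
    simp [Finsupp.sum_neg_index]

lemma addGroupSeminorm_apply (P : AddMonoidAlgebra B M) :
    addGroupSeminorm B M P = P.coeff.sum fun _ a => ‖a‖ := rfl

lemma addGroupSeminorm_single (m : M) (b : B) :
    addGroupSeminorm B M (AddMonoidAlgebra.single m b) = ‖b‖ := by
  simp [addGroupSeminorm_apply]

lemma addGroupSeminorm_sum_le {ι : Type*} (s : Finset ι) (g : ι → AddMonoidAlgebra B M) :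
    addGroupSeminorm B M (∑ i ∈ s, g i) ≤ ∑ i ∈ s, addGroupSeminorm B M (g i) :=
  Finset.le_sum_of_subadditive _ (map_zero _).le (map_add_le_add _) s g

/-- The `ℓ¹` norm on an additive monoid algebra over a normed commutative ring. -/
noncomputable instance : SeminormedCommRing (AddMonoidAlgebra B M) where
  __ := RingSeminorm.toSeminormedRing
    { addGroupSeminorm B M with
      mul_le' := fun P Q => by
        change addGroupSeminorm B M (P * Q) ≤
          (P.coeff.sum fun _ a => ‖a‖) * (Q.coeff.sum fun _ a => ‖a‖)
        rw [AddMonoidAlgebra.mul_def, Finsupp.sum, Finsupp.sum, Finsupp.sum, Finset.sum_mul]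
        refine (addGroupSeminorm_sum_le _ _).trans (Finset.sum_le_sum fun m _ => ?_)
        rw [Finsupp.sum, Finset.mul_sum]
        refine (addGroupSeminorm_sum_le _ _).trans (Finset.sum_le_sum fun n _ => ?_)
        rw [addGroupSeminorm_single]
        exact norm_mul_le _ _ }
  mul_comm := mul_comm

lemma norm_def (P : AddMonoidAlgebra B M) : ‖P‖ = P.coeff.sum fun _ a => ‖a‖ := rfl

lemma norm_single (m : M) (b : B) : ‖AddMonoidAlgebra.single m b‖ = ‖b‖ :=
  addGroupSeminorm_single m b

noncomputable instance [NormedAlgebra ℂ B] : NormedAlgebra ℂ (AddMonoidAlgebra B M) where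
  norm_smul_le c P := by
    rw [norm_def, norm_def, AddMonoidAlgebra.coeff_smul,
      Finsupp.sum_of_support_subset _ Finsupp.support_smul _ (by simp), Finsupp.sum,
      Finset.mul_sum]
    exact Finset.sum_le_sum fun i _ => norm_smul_le _ _

/-- An additive map out of an `ℓ¹` monoid algebra is a contraction as soon as it is one on
monomials. -/
lemma norm_map_le {G : Type*} [SeminormedAddCommGroup G] (F : AddMonoidAlgebra B M →+ G)
    (hF : ∀ m b, ‖F (AddMonoidAlgebra.single m b)‖ ≤ ‖b‖) (P : AddMonoidAlgebra B M) :
    ‖F P‖ ≤ ‖P‖ := by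
  conv_lhs => rw [← AddMonoidAlgebra.sum_coeff_single P]
  rw [Finsupp.sum, map_sum, norm_def]
  exact (norm_sum_le _ _).trans (Finset.sum_le_sum fun m _ => hF m _)

/-- The additive map out of a monoid algebra determined by its values on monomials. -/
noncomputable def liftAdd {B M G : Type*} [NormedCommRing B] [AddCommGroup G] (g : M → B →+ G) :
    AddMonoidAlgebra B M →+ G :=
  (Finsupp.liftAddHom g).comp AddMonoidAlgebra.coeffAddEquiv.toAddMonoidHom

lemma liftAdd_single {B M G : Type*} [NormedCommRing B] [AddCommGroup G]
    (g : M → B →+ G) (m : M) (b : B) :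
    liftAdd g (AddMonoidAlgebra.single m b) = g m b := by
  simp [liftAdd]

end Norm

end EllOne

section Localization

open AddMonoidAlgebra (single)
open EllOne

variable {B M : Type*} [NormedCommRing B] [NormedAlgebra ℂ B] [AddCommMonoid M]

/-- The Banach algebra obtained from `B` by freely adjoining contractions indexed by the
monoid `M`, subject to the relation `p = 0`. -/
abbrev AdjoinRel (p : AddMonoidAlgebra B M) : Type _ :=
  UniformSpace.Completion (AddMonoidAlgebra B M ⧸ Ideal.span {p})

namespace AdjoinRel

variable (p : AddMonoidAlgebra B M)

/-- The canonical map from the monoid algebra. -/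
noncomputable def mk : AddMonoidAlgebra B M →ₐ[ℂ] AdjoinRel p where
  __ := UniformSpace.Completion.coeRingHom.comp (Ideal.Quotient.mk (Ideal.span {p}))
  commutes' _ := rfl

lemma norm_mk_le (P : AddMonoidAlgebra B M) : ‖mk p P‖ ≤ ‖P‖ :=
  (UniformSpace.Completion.norm_coe _).trans_le (Ideal.Quotient.norm_mk_le _ P)

lemma mk_self : mk p p = 0 := by
  have : Ideal.Quotient.mk (Ideal.span {p}) p = 0 :=
    Ideal.Quotient.eq_zero_iff_mem.2 (Ideal.mem_span_singleton_self p)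
  change ((Ideal.Quotient.mk (Ideal.span {p}) p :) : AdjoinRel p) = 0
  rw [this]; rfl

lemma exists_norm_sub_mul_lt {P : AddMonoidAlgebra B M} {ε : ℝ} (h : ‖mk p P‖ < ε) :
    ∃ u, ‖P - p * u‖ < ε := by
  have h' : ‖Ideal.Quotient.mk (Ideal.span {p}) P‖ < ε :=
    (UniformSpace.Completion.norm_coe _).symm.trans_lt h
  obtain ⟨r, hr, hlt⟩ := Ideal.Quotient.norm_mk_lt (Ideal.Quotient.mk (Ideal.span {p}) P)
    (sub_pos.2 h')
  obtain ⟨u, hu⟩ := Ideal.mem_span_singleton.1 (Ideal.Quotient.eq.1 hr)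
  refine ⟨-u, ?_⟩
  have : P - p * -u = r := by rw [mul_neg, ← hu]; ring
  rw [this]; linarith

lemma exists_mk_near (b : AdjoinRel p) {ε : ℝ} (hε : 0 < ε) :
    ∃ P, ‖b - mk p P‖ < ε ∧ ‖P‖ < ‖b‖ + ε := by
  obtain ⟨q, hq⟩ := (UniformSpace.Completion.denseRange_coe (α := AddMonoidAlgebra B M ⧸
    Ideal.span {p})).exists_dist_lt b (half_pos hε)
  obtain ⟨P, rfl, hP⟩ := Ideal.Quotient.norm_mk_lt q (half_pos hε)
  rw [dist_eq_norm] at hq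
  refine ⟨P, hq.trans (half_lt_self hε), ?_⟩
  have h1 : ‖Ideal.Quotient.mk (Ideal.span {p}) P‖ ≤ ‖b‖ + ε / 2 := by
    rw [← UniformSpace.Completion.norm_coe]
    have := norm_sub_norm_le ((Ideal.Quotient.mk (Ideal.span {p}) P :) : AdjoinRel p) b
    rw [norm_sub_rev] at this
    linarith
  linarith

lemma denseRange_mk : DenseRange (mk p) := fun b => Metric.mem_closure_range_iff.2 fun ε hε => by
  obtain ⟨P, hP, -⟩ := exists_mk_near p b hε
  exact ⟨P, by rwa [dist_eq_norm]⟩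

variable {C : Type*} [NormedCommRing C] [NormedAlgebra ℂ C] [CompleteSpace C]

/-- The universal property of `AdjoinRel p`. -/
lemma exists_lift (φ : B →ₐ[ℂ] C) (t : Multiplicative M →* C)
    (hφ : ∀ m b, ‖φ b * t (Multiplicative.ofAdd m)‖ ≤ ‖b‖)
    (hp : AddMonoidAlgebra.liftNCAlgHom φ t (fun _ _ => Commute.all _ _) p = 0) :
    ∃ Φ : AdjoinRel p →ₐ[ℂ] C, (∀ x, ‖Φ x‖ ≤ ‖x‖) ∧
      ∀ m b, Φ (mk p (single m b)) = φ b * t (Multiplicative.ofAdd m) := by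
  set F := AddMonoidAlgebra.liftNCAlgHom φ t (fun _ _ => Commute.all _ _) with hF
  have hs : ∀ m b, F (single m b) = φ b * t (Multiplicative.ofAdd m) := fun m b => by
    simp [hF]
  have hle : ∀ P, ‖F P‖ ≤ ‖P‖ := norm_map_le (F : AddMonoidAlgebra B M →+ C) fun m b => by
    change ‖F (single m b)‖ ≤ _
    rw [hs]
    exact hφ m b
  have hker : ∀ a ∈ Ideal.span {p}, F a = 0 := fun a ha => by
    obtain ⟨u, rfl⟩ := Ideal.mem_span_singleton.1 ha
    rw [map_mul, hp, zero_mul]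
  let Q : AddMonoidAlgebra B M ⧸ Ideal.span {p} →+* C :=
    Ideal.Quotient.lift _ (F : AddMonoidAlgebra B M →+* C) hker
  have hQle : ∀ x, ‖Q x‖ ≤ ‖x‖ := fun x => le_of_forall_pos_lt_add fun ε hε => by
    obtain ⟨P, rfl, hP⟩ := Ideal.Quotient.norm_mk_lt x hε
    exact (hle P).trans_lt hP
  have hQ : Continuous Q := by
    refine AddMonoidHomClass.continuous_of_bound Q 1 fun x => ?_
    simpa using hQle x
  let E := UniformSpace.Completion.extensionHom Q hQ
  have hE : ∀ P, E (mk p P) = F P := fun P =>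
    UniformSpace.Completion.extensionHom_coe Q hQ (Ideal.Quotient.mk _ P)
  have hEc : Continuous E := UniformSpace.Completion.continuous_extension
  refine ⟨{ E with commutes' := fun c => ?_ }, fun x => ?_, fun m b => ?_⟩
  · have := hE (algebraMap ℂ _ c)
    rw [AlgHom.commutes, AlgHom.commutes] at this
    exact this
  · change ‖E x‖ ≤ ‖x‖
    refine (denseRange_mk p).induction_on (p := fun x => ‖E x‖ ≤ ‖x‖) x
      (isClosed_le hEc.norm continuous_norm) fun P => ?_
    exact (congrArg norm (UniformSpace.Completion.extensionHom_coe Q hQ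
      (Ideal.Quotient.mk _ P))).trans_le ((hQle _).trans_eq
        (UniformSpace.Completion.norm_coe _).symm)
  · exact (hE _).trans (hs m b)

end AdjoinRel

end Localization

namespace AdjoinRel

section

open AddMonoidAlgebra (single)
open EllOne

variable {B M : Type*} [NormedCommRing B] [NormedAlgebra ℂ B] [AddCommMonoid M]
  (p : AddMonoidAlgebra B M)

/-- The canonical map from the base algebra. -/
noncomputable def incl : B →ₐ[ℂ] AdjoinRel p :=
  (mk p).comp AddMonoidAlgebra.singleZeroAlgHom

lemma incl_apply (b : B) : incl p b = mk p (single 0 b) := rfl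

/-- The adjoined contractions. -/
noncomputable def gen : Multiplicative M →* AdjoinRel p :=
  ((mk p : AddMonoidAlgebra B M →ₐ[ℂ] AdjoinRel p) : AddMonoidAlgebra B M →* AdjoinRel p).comp
    (AddMonoidAlgebra.of B M)

lemma gen_apply (m : M) : gen p (Multiplicative.ofAdd m) = mk p (single m 1) := rfl

lemma incl_mul_gen (b : B) (m : M) :
    incl p b * gen p (Multiplicative.ofAdd m) = mk p (single m b) := by
  rw [incl_apply, gen_apply, ← map_mul, AddMonoidAlgebra.single_mul_single, zero_add, mul_one]

lemma norm_mk_single_le (m : M) (b : B) : ‖mk p (single m b)‖ ≤ ‖b‖ :=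
  (norm_mk_le p _).trans_eq (norm_single m b)

/-- Functoriality of `AdjoinRel` in the monoid. -/
lemma exists_map {N : Type*} [AddCommMonoid N] (q : AddMonoidAlgebra B N) (j : M →+ N)
    (h : mk q (AddMonoidAlgebra.mapDomainAlgHom ℂ B j p) = 0) :
    ∃ Φ : AdjoinRel p →ₐ[ℂ] AdjoinRel q, (∀ x, ‖Φ x‖ ≤ ‖x‖) ∧
      ∀ P, Φ (mk p P) = mk q (AddMonoidAlgebra.mapDomainAlgHom ℂ B j P) := by
  have key : ∀ m b, incl q b * (gen q).comp (AddMonoidHom.toMultiplicative j)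
      (Multiplicative.ofAdd m) = mk q (single (j m) b) := fun m b => incl_mul_gen q b (j m)
  have hF : AddMonoidAlgebra.liftNCAlgHom (incl q) ((gen q).comp (AddMonoidHom.toMultiplicative j))
      (fun _ _ => Commute.all _ _) = (mk q).comp (AddMonoidAlgebra.mapDomainAlgHom ℂ B j) := by
    refine AlgHom.ext fun P => ?_
    induction P using AddMonoidAlgebra.induction_linear with
    | zero => simp
    | add x y hx hy => rw [map_add, map_add, hx, hy]
    | single m b => simpa using key m b
  obtain ⟨Φ, hΦ, hs⟩ := exists_lift p (incl q) ((gen q).comp (AddMonoidHom.toMultiplicative j))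
    (fun m b => by rw [key]; exact norm_mk_single_le q _ b) (by rw [hF]; exact h)
  refine ⟨Φ, hΦ, fun P => ?_⟩
  induction P using AddMonoidAlgebra.induction_linear with
  | zero => simp
  | add x y hx hy => simp only [map_add, hx, hy]
  | single m b => rw [hs, key]; simp

end

end AdjoinRel

section Laurent

open AddMonoidAlgebra (single)
open EllOne

variable {B : Type*} [NormedCommRing B] [NormedAlgebra ℂ B]

/-- The relation defining the localization of a Banach algebra to `{‖f‖ ≤ 1}`. -/
noncomputable def relLE (f : B) : AddMonoidAlgebra B ℕ := single 1 1 - single 0 f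

/-- The relation defining the localization of a Banach algebra to `{1 ≤ ‖f‖}`. -/
noncomputable def relGE (f : B) : AddMonoidAlgebra B ℕ := single 0 1 - single 1 f

/-- The relation defining the localization of a Banach algebra to `{‖f‖ = 1}`. -/
noncomputable def relEQ (f : B) : AddMonoidAlgebra B ℤ := single 0 1 - single (-1) f

/-- The inclusion of polynomials in the variable into Laurent polynomials. -/
noncomputable abbrev polyPos (B : Type*) [NormedCommRing B] [NormedAlgebra ℂ B] :
    AddMonoidAlgebra B ℕ →ₐ[ℂ] AddMonoidAlgebra B ℤ :=
  AddMonoidAlgebra.mapDomainAlgHom ℂ B (Nat.castAddMonoidHom ℤ)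

/-- The inclusion of polynomials in the inverse variable into Laurent polynomials. -/
noncomputable abbrev polyNeg (B : Type*) [NormedCommRing B] [NormedAlgebra ℂ B] :
    AddMonoidAlgebra B ℕ →ₐ[ℂ] AddMonoidAlgebra B ℤ :=
  AddMonoidAlgebra.mapDomainAlgHom ℂ B (-Nat.castAddMonoidHom ℤ)

lemma polyPos_single (n : ℕ) (b : B) : polyPos B (single n b) = single (n : ℤ) b := by simp

lemma polyNeg_single (n : ℕ) (b : B) : polyNeg B (single n b) = single (-n : ℤ) b := by simp

lemma polyPos_relLE (f : B) : polyPos B (relLE f) = relEQ f * single 1 1 := by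
  rw [relLE, relEQ, map_sub, polyPos_single, polyPos_single, sub_mul,
    AddMonoidAlgebra.single_mul_single, AddMonoidAlgebra.single_mul_single]
  norm_num

lemma polyNeg_relGE (f : B) : polyNeg B (relGE f) = relEQ f := by
  rw [relGE, relEQ, map_sub, polyNeg_single, polyNeg_single]
  norm_num

/-- The part of a Laurent polynomial in positive degrees. -/
noncomputable def laurentPos (B : Type*) [NormedCommRing B] :
    AddMonoidAlgebra B ℤ →+ AddMonoidAlgebra B ℕ :=
  liftAdd fun n => if 0 < n then AddMonoidAlgebra.singleAddHom n.toNat else 0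

/-- The part of a Laurent polynomial in nonpositive degrees. -/
noncomputable def laurentNonpos (B : Type*) [NormedCommRing B] :
    AddMonoidAlgebra B ℤ →+ AddMonoidAlgebra B ℕ :=
  liftAdd fun n => if 0 < n then 0 else AddMonoidAlgebra.singleAddHom (-n).toNat

lemma laurentPos_single {B : Type*} [NormedCommRing B] (n : ℤ) (b : B) :
    laurentPos B (single n b) = if 0 < n then single n.toNat b else 0 := by
  rw [laurentPos, liftAdd_single]; split_ifs <;> simp

lemma laurentNonpos_single {B : Type*} [NormedCommRing B] (n : ℤ) (b : B) :
    laurentNonpos B (single n b) = if 0 < n then 0 else single (-n).toNat b := by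
  rw [laurentNonpos, liftAdd_single]; split_ifs <;> simp

lemma norm_laurentPos_le {B : Type*} [NormedCommRing B]
    (P : AddMonoidAlgebra B ℤ) : ‖laurentPos B P‖ ≤ ‖P‖ :=
  norm_map_le _ (fun m b => by rw [laurentPos_single]; split_ifs <;> simp [norm_single]) P

lemma norm_laurentNonpos_le {B : Type*} [NormedCommRing B]
    (P : AddMonoidAlgebra B ℤ) : ‖laurentNonpos B P‖ ≤ ‖P‖ :=
  norm_map_le _ (fun m b => by rw [laurentNonpos_single]; split_ifs <;> simp [norm_single]) P

lemma polyPos_laurentPos_add (P : AddMonoidAlgebra B ℤ) :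
    polyPos B (laurentPos B P) + polyNeg B (laurentNonpos B P) = P := by
  induction P using AddMonoidAlgebra.induction_linear with
  | zero => simp
  | add x y hx hy =>
    conv_rhs => rw [← hx, ← hy]
    simp only [map_add]; abel
  | single n b =>
    rw [laurentPos_single, laurentNonpos_single]
    split_ifs with h
    · rw [polyPos_single, Int.toNat_of_nonneg h.le]; simp
    · rw [polyNeg_single, Int.toNat_of_nonneg (by lia)]; simp

lemma laurentPos_polyPos (P : AddMonoidAlgebra B ℕ) :
    laurentPos B (polyPos B P) = P - single 0 (P.coeff 0) := by
  induction P using AddMonoidAlgebra.induction_linear with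
  | zero => simp
  | add x y hx hy =>
    simp only [map_add, hx, hy, AddMonoidAlgebra.coeff_add, Finsupp.add_apply,
      AddMonoidAlgebra.single_add]; abel
  | single n b =>
    rw [polyPos_single, laurentPos_single]
    rcases Nat.eq_zero_or_pos n with rfl | h
    · simp
    · simp [h, h.ne']

lemma laurentNonpos_polyPos (P : AddMonoidAlgebra B ℕ) :
    laurentNonpos B (polyPos B P) = single 0 (P.coeff 0) := by
  induction P using AddMonoidAlgebra.induction_linear with
  | zero => simp
  | add x y hx hy =>
    simp only [map_add, hx, hy, AddMonoidAlgebra.coeff_add, Finsupp.add_apply,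
      AddMonoidAlgebra.single_add]
  | single n b =>
    rw [polyPos_single, laurentNonpos_single]
    rcases Nat.eq_zero_or_pos n with rfl | h
    · simp
    · simp [h, h.ne']

lemma laurentPos_polyNeg (P : AddMonoidAlgebra B ℕ) : laurentPos B (polyNeg B P) = 0 := by
  induction P using AddMonoidAlgebra.induction_linear with
  | zero => simp
  | add x y hx hy => simp only [map_add, hx, hy, add_zero]
  | single n b => rw [polyNeg_single, laurentPos_single, if_neg (by lia)]

lemma laurentNonpos_polyNeg (P : AddMonoidAlgebra B ℕ) : laurentNonpos B (polyNeg B P) = P := by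
  induction P using AddMonoidAlgebra.induction_linear with
  | zero => simp
  | add x y hx hy => simp only [map_add, hx, hy]
  | single n b => rw [polyNeg_single, laurentNonpos_single, if_neg (by lia)]; simp

lemma exists_relEQ_mul_eq (f : B) (u : AddMonoidAlgebra B ℤ) :
    ∃ x y, relEQ f * u = polyPos B (relLE f * x) + polyNeg B (relGE f * y) := by
  induction u using AddMonoidAlgebra.induction_linear with
  | zero => exact ⟨0, 0, by simp⟩
  | add u v hu hv =>
    obtain ⟨x, y, h⟩ := hu
    obtain ⟨x', y', h'⟩ := hv
    refine ⟨x + x', y + y', ?_⟩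
    simp only [mul_add, map_add, h, h']; abel
  | single n b =>
    by_cases h : 0 < n
    · refine ⟨single (n - 1).toNat b, 0, ?_⟩
      rw [map_mul, polyPos_relLE, polyPos_single, mul_assoc, AddMonoidAlgebra.single_mul_single,
        Int.toNat_of_nonneg (by lia)]
      simp
    · refine ⟨0, single (-n).toNat b, ?_⟩
      rw [map_mul, map_mul, polyNeg_relGE, polyNeg_single, Int.toNat_of_nonneg (by lia)]
      simp

/-- Surjectivity of the difference map to the localization on `{‖f‖ = 1}`. -/
lemma exists_sub_eq (f : B) (s₁ : AdjoinRel (relLE f) →ₐ[ℂ] AdjoinRel (relEQ f))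
    (s₂ : AdjoinRel (relGE f) →ₐ[ℂ] AdjoinRel (relEQ f))
    (hs₁ : ∀ x, ‖s₁ x‖ ≤ ‖x‖) (hs₂ : ∀ x, ‖s₂ x‖ ≤ ‖x‖)
    (hmk₁ : ∀ P, s₁ (AdjoinRel.mk (relLE f) P) = AdjoinRel.mk (relEQ f) (polyPos B P))
    (hmk₂ : ∀ P, s₂ (AdjoinRel.mk (relGE f) P) = AdjoinRel.mk (relEQ f) (polyNeg B P))
    (b : AdjoinRel (relEQ f)) : ∃ b₁ b₂, s₁ b₁ - s₂ b₂ = b := by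
  let S : NormedAddGroupHom (AdjoinRel (relLE f) × AdjoinRel (relGE f)) (AdjoinRel (relEQ f)) :=
    AddMonoidHom.mkNormedAddGroupHom
      ((s₁ : AdjoinRel (relLE f) →+ AdjoinRel (relEQ f)).comp (AddMonoidHom.fst _ _) -
        (s₂ : AdjoinRel (relGE f) →+ AdjoinRel (relEQ f)).comp (AddMonoidHom.snd _ _)) 2 fun x => by
      have h1 := hs₁ x.1
      have h2 := hs₂ x.2
      have h3 := norm_sub_le (s₁ x.1) (s₂ x.2)
      have h4 := norm_fst_le x
      have h5 := norm_snd_le x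
      change ‖s₁ x.1 - s₂ x.2‖ ≤ _
      linarith
  have hS : ∀ x, S x = s₁ x.1 - s₂ x.2 := fun _ => rfl
  have hK : S.SurjectiveOnWith
      (AddMonoidHomClass.toAddMonoidHom (AdjoinRel.mk (relEQ f))).range 2 := by
    rintro _ ⟨P, rfl⟩
    change ∃ g, S g = AdjoinRel.mk _ P ∧ ‖g‖ ≤ 2 * ‖AdjoinRel.mk _ P‖
    by_cases h0 : AdjoinRel.mk (relEQ f) P = 0
    · exact ⟨0, by simp [h0]⟩
    obtain ⟨u, hu⟩ := AdjoinRel.exists_norm_sub_mul_lt (relEQ f) (P := P)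
      (ε := 2 * ‖AdjoinRel.mk (relEQ f) P‖) (by linarith [norm_pos_iff.2 h0])
    set R := P - relEQ f * u with hR
    refine ⟨(AdjoinRel.mk _ (laurentPos B R), -AdjoinRel.mk _ (laurentNonpos B R)), ?_, ?_⟩
    · rw [hS]
      change s₁ (AdjoinRel.mk _ (laurentPos B R)) - s₂ (-AdjoinRel.mk _ (laurentNonpos B R)) = _
      rw [map_neg, sub_neg_eq_add, hmk₁, hmk₂, ← map_add]
      rw [polyPos_laurentPos_add, hR, map_sub, map_mul, AdjoinRel.mk_self, zero_mul, sub_zero]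
    · refine norm_prod_le_iff.2 ⟨?_, ?_⟩
      · exact ((AdjoinRel.norm_mk_le _ _).trans (norm_laurentPos_le _)).trans hu.le
      · refine (norm_neg _).trans_le ?_
        exact ((AdjoinRel.norm_mk_le _ _).trans (norm_laurentNonpos_le _)).trans hu.le
  obtain ⟨g, hg, -⟩ := controlled_closure_of_complete two_pos one_pos hK b
    (AdjoinRel.denseRange_mk (relEQ f) b)
  exact ⟨g.1, g.2, hg⟩

/-- Approximate exactness of the Čech complex of the cover by `{‖f‖ ≤ 1}` and `{1 ≤ ‖f‖}`. -/
theorem exists_transition_maps (f : B) :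
    ∃ (s₁ : AdjoinRel (relLE f) →ₐ[ℂ] AdjoinRel (relEQ f))
      (s₂ : AdjoinRel (relGE f) →ₐ[ℂ] AdjoinRel (relEQ f)),
      Continuous s₁ ∧ Continuous s₂ ∧
      (∀ b, s₁ (AdjoinRel.incl _ b) = AdjoinRel.incl _ b) ∧
      (∀ b, s₂ (AdjoinRel.incl _ b) = AdjoinRel.incl _ b) ∧
      (∀ b₁ b₂, s₁ b₁ = s₂ b₂ → ∀ ε > 0, ∃ a : B,
        ‖AdjoinRel.incl _ a - b₁‖ < ε ∧ ‖AdjoinRel.incl _ a - b₂‖ < ε) ∧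
      (∀ b, ∃ b₁ b₂, s₁ b₁ - s₂ b₂ = b) := by
  obtain ⟨s₁, hs₁, hmk₁⟩ := AdjoinRel.exists_map (relLE f) (relEQ f) (Nat.castAddMonoidHom ℤ)
    (by
      change AdjoinRel.mk _ (polyPos B _) = 0
      rw [polyPos_relLE, map_mul, AdjoinRel.mk_self, zero_mul])
  obtain ⟨s₂, hs₂, hmk₂⟩ := AdjoinRel.exists_map (relGE f) (relEQ f) (-Nat.castAddMonoidHom ℤ)
    (by
      change AdjoinRel.mk _ (polyNeg B _) = 0
      rw [polyNeg_relGE, AdjoinRel.mk_self])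
  refine ⟨s₁, s₂, AddMonoidHomClass.continuous_of_bound s₁ 1 fun x => by simpa using hs₁ x,
    AddMonoidHomClass.continuous_of_bound s₂ 1 fun x => by simpa using hs₂ x,
    fun b => ?_, fun b => ?_, fun b₁ b₂ hb ε hε => ?_, fun b => ?_⟩
  · rw [AdjoinRel.incl_apply, hmk₁]; simp [AdjoinRel.incl_apply]
  · rw [AdjoinRel.incl_apply, hmk₂]; simp [AdjoinRel.incl_apply]
  · obtain ⟨P, hP, -⟩ := AdjoinRel.exists_mk_near _ b₁ (by positivity : 0 < ε / 4)
    obtain ⟨Q, hQ, -⟩ := AdjoinRel.exists_mk_near _ b₂ (by positivity : 0 < ε / 4)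
    have hPQ : ‖AdjoinRel.mk (relEQ f) (polyPos B P - polyNeg B Q)‖ < ε / 2 := by
      have h1 := (hs₁ (b₁ - AdjoinRel.mk _ P)).trans_lt hP
      have h2 := (hs₂ (b₂ - AdjoinRel.mk _ Q)).trans_lt hQ
      rw [map_sub, hmk₁] at h1
      rw [map_sub, hmk₂, ← hb] at h2
      have h3 := norm_sub_le (s₁ b₁ - AdjoinRel.mk (relEQ f) (polyNeg B Q))
        (s₁ b₁ - AdjoinRel.mk (relEQ f) (polyPos B P))
      rw [sub_sub_sub_cancel_left, ← map_sub] at h3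
      linarith
    obtain ⟨u, hu⟩ := AdjoinRel.exists_norm_sub_mul_lt _ hPQ
    obtain ⟨x, y, hxy⟩ := exists_relEQ_mul_eq f u
    set W := P - relLE f * x with hW
    set V := Q + relGE f * y with hV
    have hD : polyPos B P - polyNeg B Q - relEQ f * u = polyPos B W - polyNeg B V := by
      rw [hxy, hW, hV, map_sub, map_add]; abel
    rw [hD] at hu
    have hWmk : AdjoinRel.mk (relLE f) W = AdjoinRel.mk (relLE f) P := by
      rw [hW, map_sub, map_mul, AdjoinRel.mk_self, zero_mul, sub_zero]
    have hVmk : AdjoinRel.mk (relGE f) V = AdjoinRel.mk (relGE f) Q := by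
      rw [hV, map_add, map_mul, AdjoinRel.mk_self, zero_mul, add_zero]
    refine ⟨W.coeff 0, ?_, ?_⟩
    · have h1 := (norm_laurentPos_le _).trans_lt hu
      rw [map_sub, laurentPos_polyPos, laurentPos_polyNeg, sub_zero] at h1
      have h2 := (AdjoinRel.norm_mk_le (relLE f) _).trans_lt h1
      rw [map_sub, ← AdjoinRel.incl_apply, hWmk] at h2
      have h3 := norm_sub_le_norm_sub_add_norm_sub (AdjoinRel.incl (relLE f) (W.coeff 0))
        (AdjoinRel.mk (relLE f) P) b₁
      rw [norm_sub_rev (AdjoinRel.incl _ _) (AdjoinRel.mk _ P),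
        norm_sub_rev (AdjoinRel.mk _ P) b₁] at h3
      linarith
    · have h1 := (norm_laurentNonpos_le _).trans_lt hu
      rw [map_sub, laurentNonpos_polyPos, laurentNonpos_polyNeg] at h1
      have h2 := (AdjoinRel.norm_mk_le (relGE f) _).trans_lt h1
      rw [map_sub, ← AdjoinRel.incl_apply, hVmk] at h2
      have h3 := norm_sub_le_norm_sub_add_norm_sub (AdjoinRel.incl (relGE f) (W.coeff 0))
        (AdjoinRel.mk (relGE f) Q) b₂
      rw [norm_sub_rev (AdjoinRel.mk _ Q) b₂] at h3
      linarith
  · exact exists_sub_eq f s₁ s₂ hs₁ hs₂ hmk₁ hmk₂ b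

end Laurent

section Characters

open WeakDual

variable {B : Type*} [NormedCommRing B] [NormedAlgebra ℂ B] [CompleteSpace B]

lemma norm_character_apply_le (φ : characterSpace ℂ B) (b : B) : ‖φ b‖ ≤ ‖b‖ := by
  by_contra! h
  have hpos : 0 < ‖φ b‖ := (norm_nonneg b).trans_lt h
  have hlim := (tendsto_pow_atTop_nhds_zero_of_lt_one (by positivity)
    ((div_lt_one hpos).2 h)).mul_const ‖(1 : B)‖
  rw [zero_mul] at hlim
  obtain ⟨n, hn⟩ := ((Filter.Tendsto.eventually_lt_const one_pos hlim).and
    (Filter.eventually_gt_atTop 0)).exists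
  have h1 := (AlgHom.norm_apply_le_self_mul_norm_one φ (b ^ n)).trans
    (mul_le_mul_of_nonneg_right (norm_pow_le' b hn.2) (norm_nonneg _))
  rw [map_pow, norm_pow] at h1
  have h2 := hn.1
  rw [div_pow, div_mul_eq_mul_div, div_lt_one (by positivity)] at h2
  linarith

lemma isUnit_of_character_ne_zero {b : B} (h : ∀ φ : characterSpace ℂ B, φ b ≠ 0) : IsUnit b := by
  by_contra hb
  obtain ⟨φ, hφ⟩ := WeakDual.CharacterSpace.exists_apply_eq_zero hb
  exact h φ hφ

lemma character_ne_zero_of_isUnit {B : Type*} [NormedCommRing B] [NormedAlgebra ℂ B] {b : B}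
    (h : IsUnit b) (φ : characterSpace ℂ B) : φ b ≠ 0 :=
  (h.map φ).ne_zero

/-- Restriction of characters along an algebra homomorphism. -/
noncomputable def pullCharacter {C : Type*} [NormedCommRing C] [NormedAlgebra ℂ C]
    [CompleteSpace C] (ι : B →ₐ[ℂ] C) : C(characterSpace ℂ C, characterSpace ℂ B) where
  toFun φ := CharacterSpace.equivAlgHom.symm ((CharacterSpace.equivAlgHom φ).comp ι)
  continuous_toFun := continuous_induced_rng.2 <| WeakDual.continuous_of_continuous_eval fun b =>
    map_continuous (gelfandTransform ℂ C (ι b))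

@[simp]
lemma pullCharacter_apply {C : Type*} [NormedCommRing C] [NormedAlgebra ℂ C]
    [CompleteSpace C] (ι : B →ₐ[ℂ] C) (φ : characterSpace ℂ C) (b : B) :
    pullCharacter ι φ b = φ (ι b) := rfl

/-- The Gelfand transform, as a continuous function on the character space. -/
noncomputable abbrev hat (b : B) : C(characterSpace ℂ B, ℂ) := gelfandTransform ℂ B b

lemma hat_apply {B : Type*} [NormedCommRing B] [NormedAlgebra ℂ B] (b : B)
    (φ : characterSpace ℂ B) : hat b φ = φ b := rfl

section Lift

variable {M : Type*} [AddCommMonoid M]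

lemma exists_pullCharacter_incl_eq (p : AddMonoidAlgebra B M) (φ : characterSpace ℂ B)
    (t : Multiplicative M →* ℂ) (ht : ∀ m, ‖t m‖ ≤ 1)
    (hp : AddMonoidAlgebra.liftNCAlgHom (CharacterSpace.equivAlgHom φ) t
      (fun _ _ => Commute.all _ _) p = 0) :
    ∃ ψ, pullCharacter (AdjoinRel.incl p) ψ = φ := by
  obtain ⟨Φ, -, hΦ⟩ := AdjoinRel.exists_lift p (CharacterSpace.equivAlgHom φ) t (fun m b => by
    rw [norm_mul]
    exact (mul_le_of_le_one_right (norm_nonneg _) (ht _)).trans (norm_character_apply_le φ b)) hp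
  refine ⟨CharacterSpace.equivAlgHom.symm Φ, DFunLike.ext _ _ fun b => ?_⟩
  have := hΦ 0 b
  rw [ofAdd_zero, map_one, mul_one] at this
  exact this

lemma character_adjoinRel_ext (p : AddMonoidAlgebra B M)
    {ψ ψ' : characterSpace ℂ (AdjoinRel p)}
    (h : pullCharacter (AdjoinRel.incl p) ψ = pullCharacter (AdjoinRel.incl p) ψ')
    (hgen : ∀ m, ψ (AdjoinRel.gen p m) = ψ' (AdjoinRel.gen p m)) : ψ = ψ' := by
  refine DFunLike.ext _ _ fun x => ?_
  refine (AdjoinRel.denseRange_mk p).induction_on (p := fun x => ψ x = ψ' x) x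
    (isClosed_eq (map_continuous ψ) (map_continuous ψ')) fun P => ?_
  induction P using AddMonoidAlgebra.induction_linear with
  | zero => simp
  | add x y hx hy => simp only [map_add, hx, hy]
  | single m b =>
    rw [← AdjoinRel.incl_mul_gen, map_mul, map_mul, hgen, ← pullCharacter_apply, h,
      pullCharacter_apply]

end Lift

variable (f : B)

lemma incl_relLE_eq_gen {B : Type*} [NormedCommRing B] [NormedAlgebra ℂ B] (f : B) :
    AdjoinRel.incl (relLE f) f = AdjoinRel.gen (relLE f) (Multiplicative.ofAdd 1) := by
  rw [AdjoinRel.incl_apply, AdjoinRel.gen_apply, eq_comm, ← sub_eq_zero, ← map_sub]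
  exact AdjoinRel.mk_self _

lemma incl_mul_gen_relGE {B : Type*} [NormedCommRing B] [NormedAlgebra ℂ B] (f : B) :
    AdjoinRel.incl (relGE f) f * AdjoinRel.gen (relGE f) (Multiplicative.ofAdd 1) = 1 := by
  rw [AdjoinRel.incl_mul_gen, eq_comm, ← map_one (AdjoinRel.mk (relGE f)), ← sub_eq_zero,
    ← map_sub]
  exact AdjoinRel.mk_self _

lemma norm_character_gen_le {B : Type*} [NormedCommRing B] [NormedAlgebra ℂ B]
    {M : Type*} [AddCommMonoid M] (p : AddMonoidAlgebra B M)
    (ψ : characterSpace ℂ (AdjoinRel p)) (m : M) :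
    ‖ψ (AdjoinRel.gen p (Multiplicative.ofAdd m))‖ ≤ 1 := by
  have key : ∀ n : ℕ, ‖ψ (AdjoinRel.gen p (Multiplicative.ofAdd m))‖ ^ n ≤ ‖(1 : B)‖ := fun n => by
    rw [← norm_pow, ← map_pow, ← map_pow, ← ofAdd_nsmul, AdjoinRel.gen_apply]
    exact (norm_character_apply_le ψ _).trans (AdjoinRel.norm_mk_single_le p _ 1)
  by_contra! h
  obtain ⟨n, hn⟩ := pow_unbounded_of_one_lt ‖(1 : B)‖ h
  exact (key n).not_gt hn

lemma norm_character_relLE_le {B : Type*} [NormedCommRing B] [NormedAlgebra ℂ B] (f : B)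
    (ψ : characterSpace ℂ (AdjoinRel (relLE f))) :
    ‖ψ (AdjoinRel.incl _ f)‖ ≤ 1 := by
  rw [incl_relLE_eq_gen]
  exact norm_character_gen_le _ ψ 1

lemma character_relGE_mul {B : Type*} [NormedCommRing B] [NormedAlgebra ℂ B] (f : B)
    (ψ : characterSpace ℂ (AdjoinRel (relGE f))) :
    ψ (AdjoinRel.incl _ f) * ψ (AdjoinRel.gen _ (Multiplicative.ofAdd 1)) = 1 := by
  rw [← map_mul, incl_mul_gen_relGE, map_one]

lemma one_le_norm_character_relGE {B : Type*} [NormedCommRing B] [NormedAlgebra ℂ B] (f : B)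
    (ψ : characterSpace ℂ (AdjoinRel (relGE f))) :
    1 ≤ ‖ψ (AdjoinRel.incl _ f)‖ := by
  have h := congrArg norm (character_relGE_mul f ψ)
  rw [norm_mul, norm_one] at h
  rw [← h]
  exact mul_le_of_le_one_right (norm_nonneg _) (norm_character_gen_le _ ψ 1)

lemma gen_nat_eq_pow {B : Type*} [NormedCommRing B] [NormedAlgebra ℂ B]
    (p : AddMonoidAlgebra B ℕ) (m : Multiplicative ℕ) :
    AdjoinRel.gen p m = AdjoinRel.gen p (Multiplicative.ofAdd 1) ^ m.toAdd := by
  rw [← map_pow, ← ofAdd_nsmul, smul_eq_mul, mul_one, ofAdd_toAdd]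

lemma pullCharacter_relLE_injective :
    Function.Injective (pullCharacter (AdjoinRel.incl (relLE f))) := fun ψ ψ' h => by
  refine character_adjoinRel_ext _ h fun m => ?_
  rw [gen_nat_eq_pow, map_pow, map_pow, ← incl_relLE_eq_gen, ← pullCharacter_apply, h,
    pullCharacter_apply]

lemma pullCharacter_relGE_injective :
    Function.Injective (pullCharacter (AdjoinRel.incl (relGE f))) := fun ψ ψ' h => by
  refine character_adjoinRel_ext _ h fun m => ?_
  have h1 := character_relGE_mul f ψ
  have h2 := character_relGE_mul f ψ'
  rw [← pullCharacter_apply, h, pullCharacter_apply] at h1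
  rw [gen_nat_eq_pow, map_pow, map_pow,
    mul_left_cancel₀ (left_ne_zero_of_mul_eq_one h1) (h1.trans h2.symm)]

variable {f} {φ : characterSpace ℂ B}

lemma exists_pullCharacter_relLE (h : ‖φ f‖ ≤ 1) :
    ∃ ψ, pullCharacter (AdjoinRel.incl (relLE f)) ψ = φ := by
  refine exists_pullCharacter_incl_eq _ φ (powersHom ℂ (φ f)) (fun m => ?_) ?_
  · rw [powersHom_apply, norm_pow]
    exact pow_le_one₀ (norm_nonneg _) h
  · simp [relLE]

lemma exists_pullCharacter_relGE (h : 1 ≤ ‖φ f‖) :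
    ∃ ψ, pullCharacter (AdjoinRel.incl (relGE f)) ψ = φ := by
  refine exists_pullCharacter_incl_eq _ φ (powersHom ℂ (φ f)⁻¹) (fun m => ?_) ?_
  · rw [powersHom_apply, norm_pow, norm_inv]
    exact pow_le_one₀ (by positivity) (inv_le_one_of_one_le₀ h)
  · have : φ f ≠ 0 := norm_pos_iff.1 (one_pos.trans_le h)
    simp [relGE, this]

lemma exists_pullCharacter_relEQ (h : ‖φ f‖ = 1) :
    ∃ ψ, pullCharacter (AdjoinRel.incl (relEQ f)) ψ = φ := by
  have h0 : φ f ≠ 0 := norm_pos_iff.1 (one_pos.trans_eq h.symm)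
  refine exists_pullCharacter_incl_eq _ φ
    ((Units.coeHom ℂ).comp (zpowersHom ℂˣ (Units.mk0 (φ f) h0)))
    (fun m => ?_) ?_
  · simp [h]
  · rw [relEQ, map_sub]
    change AddMonoidAlgebra.liftNC _ _ _ - AddMonoidAlgebra.liftNC _ _ _ = 0
    rw [AddMonoidAlgebra.liftNC_single, AddMonoidAlgebra.liftNC_single]
    simp [h0]

end Characters

section Exponential

open WeakDual

open NormedSpace (exp)

variable {B : Type*} [NormedCommRing B] [NormedAlgebra ℂ B] [CompleteSpace B]

lemma banach_exp_add (x y : B) : exp (x + y) = exp x * exp y := by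
  let _ : NormedAlgebra ℚ B := .restrictScalars ℚ ℂ B
  exact NormedSpace.exp_add

lemma banach_exp_neg_mul (x : B) : exp (-x) * exp x = 1 := by
  rw [← banach_exp_add, neg_add_cancel, NormedSpace.exp_zero]

lemma banach_isUnit_exp (x : B) : IsUnit (exp x) :=
  .of_mul_eq_one_right _ (banach_exp_neg_mul x)

lemma algHom_exp {C : Type*} [NormedCommRing C] [NormedAlgebra ℂ C]
    (ι : B →ₐ[ℂ] C) (hι : Continuous ι) (x : B) : ι (exp x) = exp (ι x) := by
  let _ : NormedAlgebra ℚ B := .restrictScalars ℚ ℂ B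
  let _ : NormedAlgebra ℚ C := .restrictScalars ℚ ℂ C
  exact NormedSpace.map_exp ι hι x

lemma character_exp (φ : characterSpace ℂ B) (x : B) : φ (exp x) = Complex.exp (φ x) := by
  rw [Complex.exp_eq_exp_ℂ]
  exact algHom_exp (CharacterSpace.equivAlgHom φ) (map_continuous φ) x

lemma hasDerivAt_banach_exp {b : ℝ → B} {b' : B} {s : ℝ} (h : HasDerivAt b b' s) :
    HasDerivAt (fun t => exp (b t)) (exp (b s) * b') s := by
  have := (hasFDerivAt_exp (𝕂 := ℂ) (x := b s)).restrictScalars ℝ |>.comp_hasDerivAt s h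
  refine this.congr_deriv ?_
  simp

/-- The logarithm of an element whose Gelfand transform avoids the negative real axis. -/
theorem exists_exp_eq_of_mem_slitPlane {v : B}
    (hv : ∀ φ : characterSpace ℂ B, φ v ∈ Complex.slitPlane) :
    ∃ b, exp b = v ∧ ∀ φ : characterSpace ℂ B, φ b = Complex.log (φ v) := by
  set x := v - 1 with hx
  set R : ℝ → B := fun t => Ring.inverse (1 + t • x) with hR
  set U : Set ℝ := {t | IsUnit (1 + t • x)} with hU
  have hUo : IsOpen U := Units.isOpen.preimage (by fun_prop : Continuous fun t : ℝ => 1 + t • x)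
  have hφx : ∀ φ : characterSpace ℂ B, 1 + φ x = φ v := fun φ => by simp [hx]
  have hφ : ∀ (φ : characterSpace ℂ B) (t : ℝ), φ (1 + t • x) = 1 + t • φ x := fun φ t => by
    rw [map_add, map_one, ← Complex.coe_smul t x, map_smul, Complex.coe_smul]
  have hIU : Set.Icc 0 1 ⊆ U := fun t ht => isUnit_of_character_ne_zero fun φ => by
    rw [hφ]
    exact Complex.slitPlane_ne_zero <| StarConvex.add_smul_mem Complex.starConvex_one_slitPlane
      (by rw [hφx]; exact hv φ) ht.1 ht.2
  have hRc : ContinuousOn R U := fun t ht => by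
    obtain ⟨w, hw⟩ := ht
    refine (ContinuousAt.comp (g := Ring.inverse) (f := fun t : ℝ => 1 + t • x) ?_
      (by fun_prop)).continuousWithinAt
    rw [← hw]
    exact NormedRing.inverse_continuousAt w
  have hxR : ContinuousOn (fun t => x * R t) U := continuousOn_const.mul hRc
  have hint : ∀ s ∈ Set.Icc (0 : ℝ) 1,
      IntervalIntegrable (fun t => x * R t) MeasureTheory.volume 0 s :=
    fun s hs => (hxR.mono fun t ht => hIU
      ((Set.uIcc_of_le hs.1 ▸ Set.Icc_subset_Icc_right hs.2 : Set.uIcc 0 s ⊆ _) ht)).intervalIntegrable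
  set b : ℝ → B := fun s => ∫ t in (0 : ℝ)..s, x * R t with hb
  have hbd : ∀ s ∈ Set.Icc (0 : ℝ) 1, HasDerivAt b (x * R s) s := fun s hs =>
    intervalIntegral.integral_hasDerivAt_right (hint s hs)
      (hxR.stronglyMeasurableAtFilter hUo s (hIU hs)) (hxR.continuousAt (hUo.mem_nhds (hIU hs)))
  have hy : ∀ s ∈ Set.Icc (0 : ℝ) 1,
      HasDerivAt (fun s => exp (-b s) * (1 + s • x)) 0 s := fun s hs => by
    have h1 := (hasDerivAt_banach_exp (b := fun s => -b s) (hbd s hs).neg).mul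
      (((hasDerivAt_id s).smul_const x).const_add 1)
    have h2 : R s * (1 + s • x) = 1 := Ring.inverse_mul_cancel _ (hIU hs)
    refine h1.congr_deriv ?_
    simp only [id, one_smul]
    linear_combination (-(exp (-b s) * x)) * h2
  have hconst := constant_of_has_deriv_right_zero
    (fun s hs => (hy s hs).continuousAt.continuousWithinAt)
    (fun s hs => (hy s (Set.Ico_subset_Icc_self hs)).hasDerivWithinAt) 1 (by simp)
  have hb0 : b 0 = 0 := by simp [hb]
  refine ⟨b 1, ?_, fun φ => ?_⟩
  · simp only [hb0, neg_zero, NormedSpace.exp_zero, one_smul, zero_smul, add_zero, mul_one] at hconst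
    have h3 := banach_exp_neg_mul (b 1)
    rw [hx] at hconst
    linear_combination v * h3 - exp (b 1) * hconst
  · have h1 := ContinuousLinearMap.intervalIntegral_comp_comm
      ((CharacterSpace.toCLM φ).restrictScalars ℝ) (hint 1 (by simp))
    change ∫ t in (0 : ℝ)..1, φ (x * R t) = φ (b 1) at h1
    rw [← h1, ← hφx, Complex.log_eq_integral (by rw [hφx]; exact hv φ),
      ← intervalIntegral.integral_const_mul]
    refine intervalIntegral.integral_congr fun t ht => ?_
    rw [Set.uIcc_of_le zero_le_one] at ht
    have h2 := congrArg φ (Ring.inverse_mul_cancel _ (hIU ht))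
    rw [map_mul, map_one, hφ] at h2
    simp only [map_mul]
    rw [eq_inv_of_mul_eq_one_left h2]

/-- Logarithms with the same Gelfand transform agree. -/
theorem exp_injective_of_character_eq {b b' : B} (h : exp b = exp b')
    (hφ : ∀ φ : characterSpace ℂ B, φ b = φ b') : b = b' := by
  set q := b - b' with hq
  have hexp : exp q = 1 := by
    refine (banach_isUnit_exp b').mul_right_cancel ?_
    rw [← banach_exp_add, one_mul, hq, sub_add_cancel, h]
  have hc : Continuous fun t : ℝ => exp (t • q) :=
    continuous_iff_continuousAt.2 fun s =>
      (hasDerivAt_banach_exp ((hasDerivAt_id s).smul_const q)).continuousAt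
  have hint : IntervalIntegrable (fun t : ℝ => exp (t • q)) MeasureTheory.volume 0 1 :=
    hc.intervalIntegrable 0 1
  have hI : (∫ t in (0 : ℝ)..1, exp (t • q)) * q = 0 := by
    have h1 := ContinuousLinearMap.intervalIntegral_comp_comm
      ((ContinuousLinearMap.mul ℝ B).flip q) hint
    simp only [ContinuousLinearMap.flip_apply, ContinuousLinearMap.mul_apply'] at h1
    rw [← h1,
      intervalIntegral.integral_eq_sub_of_hasDerivAt (f := fun t : ℝ => exp (t • q))
        (f' := fun t : ℝ => exp (t • q) * q) (fun s _ => by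
          simpa using hasDerivAt_banach_exp ((hasDerivAt_id s).smul_const q))
        ((hc.mul_const q).intervalIntegrable _ _)]
    simp [hexp]
  have hu : IsUnit (∫ t in (0 : ℝ)..1, exp (t • q)) := isUnit_of_character_ne_zero fun φ => by
    have h1 := ContinuousLinearMap.intervalIntegral_comp_comm
      ((CharacterSpace.toCLM φ).restrictScalars ℝ) hint
    change ∫ t in (0 : ℝ)..1, φ (exp (t • q)) = φ _ at h1
    have h2 : ∀ t : ℝ, φ (exp (t • q)) = 1 := fun t => by
      rw [character_exp, ← Complex.coe_smul t q, map_smul, hq, map_sub, hφ, sub_self, smul_zero,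
        Complex.exp_zero]
    simp [← h1, h2]
  exact sub_eq_zero.1 ((hu.mul_right_eq_zero).1 hI)

end Exponential

section Separation

open WeakDual

variable {B : Type*} [NormedCommRing B] [NormedAlgebra ℂ B] [CompleteSpace B]

/-- Finitely many elements separate the pairs in a closed relation disjoint from the diagonal. -/
lemma exists_list_separating (r : Set (characterSpace ℂ B × characterSpace ℂ B))
    (hr : IsClosed r) (hd : ∀ x ∈ r, x.1 ≠ x.2) :
    ∃ l : List B, ∀ ψ ψ', (ψ, ψ') ∈ r → ∃ a ∈ l, ‖ψ a‖ < 1 ∧ 1 < ‖ψ' a‖ := by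
  obtain ⟨t, ht⟩ := hr.isCompact.elim_finite_subcover
    (fun a : B => {x : characterSpace ℂ B × characterSpace ℂ B | ‖x.1 a‖ < 1 ∧ 1 < ‖x.2 a‖})
    (fun a => by
      have h1 := ((map_continuous (hat a)).comp (continuous_fst (X := characterSpace ℂ B)
        (Y := characterSpace ℂ B))).norm
      have h2 := ((map_continuous (hat a)).comp (continuous_snd (X := characterSpace ℂ B)
        (Y := characterSpace ℂ B))).norm
      exact (isOpen_lt h1 continuous_const).inter (isOpen_lt continuous_const h2))
    (fun x hx => by
      obtain ⟨b, hb⟩ := DFunLike.ne_iff.1 (hd x hx)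
      have hb' : x.2 b - x.1 b ≠ 0 := sub_ne_zero.2 (Ne.symm hb)
      refine Set.mem_iUnion.2 ⟨(2 / (x.2 b - x.1 b)) • (b - algebraMap ℂ B (x.1 b)), ?_⟩
      have h1 : ∀ c, x.1 (algebraMap ℂ B c) = c := AlgHomClass.commutes x.1
      have h2 : ∀ c, x.2 (algebraMap ℂ B c) = c := AlgHomClass.commutes x.2
      simp only [Set.mem_ofPred_eq, map_smul, map_sub, h1, h2, smul_eq_mul, sub_self, mul_zero,
        norm_zero, div_mul_cancel₀ _ hb']
      norm_num)
  refine ⟨t.toList, fun ψ ψ' h => ?_⟩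
  obtain ⟨a, ha, h⟩ := Set.mem_iUnion₂.1 (ht h)
  exact ⟨a, Finset.mem_toList.2 ha, h⟩

variable {f : B} {l : List B} {r : characterSpace ℂ B → characterSpace ℂ B → Prop}

lemma separating_relLE
    (h : ∀ ψ ψ', r ψ ψ' → ∃ a ∈ f :: l, ‖ψ a‖ < 1 ∧ 1 < ‖ψ' a‖)
    (ψ ψ' : characterSpace ℂ (AdjoinRel (relLE f)))
    (hr : r (pullCharacter (AdjoinRel.incl _) ψ) (pullCharacter (AdjoinRel.incl _) ψ')) :
    ∃ a ∈ l.map (AdjoinRel.incl (relLE f)), ‖ψ a‖ < 1 ∧ 1 < ‖ψ' a‖ := by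
  obtain ⟨a, ha, h1, h2⟩ := h _ _ hr
  rcases List.mem_cons.1 ha with rfl | ha
  · exact absurd (norm_character_relLE_le a ψ') h2.not_ge
  · exact ⟨_, List.mem_map_of_mem ha, h1, h2⟩

lemma separating_relGE
    (h : ∀ ψ ψ', r ψ ψ' → ∃ a ∈ f :: l, ‖ψ a‖ < 1 ∧ 1 < ‖ψ' a‖)
    (ψ ψ' : characterSpace ℂ (AdjoinRel (relGE f)))
    (hr : r (pullCharacter (AdjoinRel.incl _) ψ) (pullCharacter (AdjoinRel.incl _) ψ')) :
    ∃ a ∈ l.map (AdjoinRel.incl (relGE f)), ‖ψ a‖ < 1 ∧ 1 < ‖ψ' a‖ := by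
  obtain ⟨a, ha, h1, h2⟩ := h _ _ hr
  rcases List.mem_cons.1 ha with rfl | ha
  · exact absurd (one_le_norm_character_relGE a ψ) h1.not_ge
  · exact ⟨_, List.mem_map_of_mem ha, h1, h2⟩

end Separation

section Logarithm

open WeakDual

open NormedSpace (exp)

universe v

variable {B : Type v} [NormedCommRing B] [NormedAlgebra ℂ B] [CompleteSpace B]

lemma exists_log_of_norm_sub_lt {h : characterSpace ℂ B → ℂ} {u : B}
    (hu : ∀ ψ : characterSpace ℂ B, ψ u = Complex.exp (h ψ)) (a : B)
    (ha : ∀ ψ : characterSpace ℂ B, ‖ψ a - h ψ‖ < 1) :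
    ∃ b, exp b = u ∧ ∀ ψ : characterSpace ℂ B, ψ b = h ψ := by
  have him : ∀ ψ, |(h ψ - ψ a).im| < 1 := fun ψ =>
    (Complex.abs_im_le_norm _).trans_lt (by rw [norm_sub_rev]; exact ha ψ)
  have hv : ∀ ψ : characterSpace ℂ B, ψ (u * exp (-a)) = Complex.exp (h ψ - ψ a) := fun ψ => by
    rw [map_mul, character_exp, hu, map_neg, ← Complex.exp_add, sub_eq_add_neg]
  obtain ⟨b, hb, hbψ⟩ := exists_exp_eq_of_mem_slitPlane (v := u * exp (-a)) fun ψ => by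
    have := abs_lt.1 (him ψ)
    rw [hv]
    left
    rw [Complex.exp_re]
    exact mul_pos (Real.exp_pos _) (Real.cos_pos_of_mem_Ioo
      ⟨by linarith [Real.pi_gt_three], by linarith [Real.pi_gt_three]⟩)
  refine ⟨b + a, ?_, fun ψ => ?_⟩
  · rw [banach_exp_add, hb, mul_assoc, banach_exp_neg_mul, mul_one]
  · have := abs_lt.1 (him ψ)
    rw [map_add, hbψ, hv, Complex.log_exp (by linarith [Real.pi_gt_three])
      (by linarith [Real.pi_gt_three]), sub_add_cancel]

lemma exists_log_of_separating (l : List B) (h : characterSpace ℂ B → ℂ) (u : B)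
    (hu : ∀ ψ : characterSpace ℂ B, ψ u = Complex.exp (h ψ))
    (hl : ∀ ψ ψ', 1 / 2 ≤ ‖h ψ - h ψ'‖ → ∃ a ∈ l, ‖ψ a‖ < 1 ∧ 1 < ‖ψ' a‖) :
    ∃ b, exp b = u ∧ ∀ ψ : characterSpace ℂ B, ψ b = h ψ := by
  induction hn : l.length generalizing B with
  | zero =>
    obtain rfl := List.length_eq_zero_iff.1 hn
    rcases isEmpty_or_nonempty (characterSpace ℂ B) with hE | ⟨⟨φ⟩⟩
    · exact exists_log_of_norm_sub_lt hu 0 fun ψ => hE.elim ψ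
    · refine exists_log_of_norm_sub_lt hu (algebraMap ℂ B (h φ)) fun ψ => ?_
      rw [show ψ (algebraMap ℂ B (h φ)) = h φ from AlgHomClass.commutes ψ _]
      by_contra! hlt
      simpa using hl φ ψ (by linarith)
  | succ n ih =>
    obtain ⟨f, l, rfl⟩ := List.exists_cons_of_length_eq_add_one hn
    obtain ⟨s₁, s₂, hc₁, hc₂, hs₁, hs₂, hglue, -⟩ := exists_transition_maps f
    have hlen : l.length = n := by simpa using hn
    obtain ⟨b₁, hb₁, hψ₁⟩ := ih (l.map (AdjoinRel.incl (relLE f)))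
      (fun ψ => h (pullCharacter (AdjoinRel.incl _) ψ)) (AdjoinRel.incl _ u)
      (fun ψ => by rw [← pullCharacter_apply]; exact hu _)
      (fun ψ ψ' hr => separating_relLE hl ψ ψ' hr) (by simpa using hlen)
    obtain ⟨b₂, hb₂, hψ₂⟩ := ih (l.map (AdjoinRel.incl (relGE f)))
      (fun ψ => h (pullCharacter (AdjoinRel.incl _) ψ)) (AdjoinRel.incl _ u)
      (fun ψ => by rw [← pullCharacter_apply]; exact hu _)
      (fun ψ ψ' hr => separating_relGE hl ψ ψ' hr) (by simpa using hlen)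
    have hb : s₁ b₁ = s₂ b₂ := by
      refine exp_injective_of_character_eq ?_ fun ψ => ?_
      · rw [← algHom_exp s₁ hc₁, ← algHom_exp s₂ hc₂, hb₁, hb₂, hs₁, hs₂]
      · have h1 := hψ₁ (pullCharacter s₁ ψ)
        have h2 := hψ₂ (pullCharacter s₂ ψ)
        rw [pullCharacter_apply] at h1 h2
        rw [h1, h2]
        congr 1
        refine DFunLike.ext _ _ fun b => ?_
        simp only [pullCharacter_apply, hs₁, hs₂]
    obtain ⟨a, ha₁, ha₂⟩ := hglue b₁ b₂ hb 1 one_pos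
    refine exists_log_of_norm_sub_lt hu a fun φ => ?_
    rcases le_total ‖φ f‖ 1 with hφ | hφ
    · obtain ⟨ψ, rfl⟩ := exists_pullCharacter_relLE hφ
      rw [← hψ₁, pullCharacter_apply, ← map_sub]
      exact (norm_character_apply_le ψ _).trans_lt ha₁
    · obtain ⟨ψ, rfl⟩ := exists_pullCharacter_relGE hφ
      rw [← hψ₂, pullCharacter_apply, ← map_sub]
      exact (norm_character_apply_le ψ _).trans_lt ha₂

/-- An element whose Gelfand transform has a continuous logarithm has a logarithm. -/
theorem exists_exp_eq (h : C(characterSpace ℂ B, ℂ)) (u : B)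
    (hu : ∀ ψ : characterSpace ℂ B, ψ u = Complex.exp (h ψ)) :
    ∃ b, exp b = u ∧ ∀ ψ : characterSpace ℂ B, ψ b = h ψ := by
  obtain ⟨l, hl⟩ := exists_list_separating (B := B) {x | 1 / 2 ≤ ‖h x.1 - h x.2‖}
    (isClosed_le continuous_const (by fun_prop)) fun x hx he => by
      simp only [Set.mem_ofPred_eq, he, sub_self, norm_zero] at hx
      linarith
  exact exists_log_of_separating l h u hu hl

end Logarithm

section ArensRoyden

open WeakDual

open NormedSpace (exp)

universe v

variable {B : Type v} [NormedCommRing B] [NormedAlgebra ℂ B] [CompleteSpace B]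

/-- Continuous functions on the two halves of the character space glue along the overlap. -/
lemma exists_glue (f : B) (s₁ : AdjoinRel (relLE f) →ₐ[ℂ] AdjoinRel (relEQ f))
    (s₂ : AdjoinRel (relGE f) →ₐ[ℂ] AdjoinRel (relEQ f))
    (hs₁ : ∀ b, s₁ (AdjoinRel.incl _ b) = AdjoinRel.incl _ b)
    (hs₂ : ∀ b, s₂ (AdjoinRel.incl _ b) = AdjoinRel.incl _ b)
    (H₁ : C(characterSpace ℂ (AdjoinRel (relLE f)), ℂ))
    (H₂ : C(characterSpace ℂ (AdjoinRel (relGE f)), ℂ))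
    (hH : ∀ χ, H₁ (pullCharacter s₁ χ) = H₂ (pullCharacter s₂ χ)) :
    ∃ H : C(characterSpace ℂ B, ℂ), (∀ ψ, H (pullCharacter (AdjoinRel.incl _) ψ) = H₁ ψ) ∧
      ∀ ψ, H (pullCharacter (AdjoinRel.incl _) ψ) = H₂ ψ := by
  let π : C(characterSpace ℂ (AdjoinRel (relLE f)) ⊕ characterSpace ℂ (AdjoinRel (relGE f)),
      characterSpace ℂ B) :=
    ⟨Sum.elim (pullCharacter (AdjoinRel.incl _)) (pullCharacter (AdjoinRel.incl _)),
      (map_continuous _).sumElim (map_continuous _)⟩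
  let K : C(characterSpace ℂ (AdjoinRel (relLE f)) ⊕ characterSpace ℂ (AdjoinRel (relGE f)), ℂ) :=
    ⟨Sum.elim H₁ H₂, (map_continuous _).sumElim (map_continuous _)⟩
  have hsurj : Function.Surjective π := fun φ => by
    rcases le_total ‖φ f‖ 1 with hφ | hφ
    · obtain ⟨ψ, rfl⟩ := exists_pullCharacter_relLE hφ
      exact ⟨.inl ψ, rfl⟩
    · obtain ⟨ψ, rfl⟩ := exists_pullCharacter_relGE hφ
      exact ⟨.inr ψ, rfl⟩
  have hπ : Topology.IsQuotientMap π := π.continuous.isClosedMap.isQuotientMap π.continuous hsurj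
  have hmix : ∀ ψ₁ ψ₂, pullCharacter (AdjoinRel.incl (relLE f)) ψ₁ =
      pullCharacter (AdjoinRel.incl (relGE f)) ψ₂ → H₁ ψ₁ = H₂ ψ₂ := fun ψ₁ ψ₂ h => by
    obtain ⟨χ, hχ⟩ := exists_pullCharacter_relEQ (f := f)
      (φ := pullCharacter (AdjoinRel.incl (relLE f)) ψ₁)
      (le_antisymm (norm_character_relLE_le f ψ₁) (h ▸ one_le_norm_character_relGE f ψ₂))
    have h₁ : pullCharacter s₁ χ = ψ₁ := pullCharacter_relLE_injective f <| by
      rw [← hχ]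
      exact DFunLike.ext _ _ fun b => by simp only [pullCharacter_apply, hs₁]
    have h₂ : pullCharacter s₂ χ = ψ₂ := pullCharacter_relGE_injective f <| by
      rw [← h, ← hχ]
      exact DFunLike.ext _ _ fun b => by simp only [pullCharacter_apply, hs₂]
    rw [← h₁, ← h₂, hH]
  have hK : Function.FactorsThrough K π := by
    rintro (ψ | ψ) (ψ' | ψ') h
    · exact congrArg H₁ (pullCharacter_relLE_injective f h)
    · exact hmix _ _ h
    · exact (hmix _ _ h.symm).symm
    · exact congrArg H₂ (pullCharacter_relGE_injective f h)
  have hl := hπ.lift_comp K hK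
  exact ⟨hπ.lift K hK, fun ψ => DFunLike.congr_fun hl (.inl ψ),
    fun ψ => DFunLike.congr_fun hl (.inr ψ)⟩

/-- An approximation `c` of `g * exp (-b)`, where `g * g' = 1`, agrees with `g` up to the exponential
of a continuous function on the character space. -/
lemma exists_continuous_log_of_near {g g' b c : B} {ε : ℝ} (hg : g * g' = 1)
    (hc : ‖c - g * exp (-b)‖ < ε) (hε : ε * ‖g' * exp b‖ ≤ 1) :
    ∃ m : C(characterSpace ℂ B, ℂ), (∀ φ, m φ = Complex.log (φ (c * (g' * exp b)))) ∧
      ∀ (φ : characterSpace ℂ B) (z : ℂ),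
        φ g * Complex.exp z = φ c * Complex.exp (z + φ b - m φ) := by
  have hw : g * exp (-b) * (g' * exp b) = 1 := by
    linear_combination g * g' * banach_exp_neg_mul b + hg
  have hlt : ∀ φ : characterSpace ℂ B, ‖φ (c * (g' * exp b)) - 1‖ < 1 := fun φ => by
    have h0 : φ (g' * exp b) ≠ 0 :=
      character_ne_zero_of_isUnit (.of_mul_eq_one_right _ hw) φ
    rw [← map_one φ, ← hw, ← map_sub, ← sub_mul, map_mul, norm_mul]
    exact (mul_lt_mul_of_pos_right ((norm_character_apply_le φ _).trans_lt hc)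
      (norm_pos_iff.2 h0)).trans_le <| (mul_le_mul_of_nonneg_left
        (norm_character_apply_le φ _) ((norm_nonneg _).trans hc.le)).trans hε
  have hmem : ∀ φ : characterSpace ℂ B, φ (c * (g' * exp b)) ∈ Complex.slitPlane := fun φ => by
    have := Complex.mem_slitPlane_of_norm_lt_one (hlt φ)
    rwa [add_sub_cancel] at this
  refine ⟨⟨fun φ => Complex.log (φ (c * (g' * exp b))), (map_continuous (hat _)).clog hmem⟩,
    fun φ => rfl, fun φ z => ?_⟩
  have e₂ := Complex.slitPlane_ne_zero (hmem φ)
  have e₃ := congrArg φ hg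
  change _ = φ c * Complex.exp (z + φ b - Complex.log (φ (c * (g' * exp b))))
  rw [Complex.exp_sub, Complex.exp_log e₂, Complex.exp_add, mul_div_assoc', eq_div_iff e₂]
  rw [map_mul, map_one] at e₃
  rw [map_mul, map_mul, character_exp]
  linear_combination (φ c * Complex.exp z * Complex.exp (φ b)) * e₃

/-- Splitting the logarithm of a transition function turns two units into compatible ones. -/
lemma mul_exp_neg_eq {C D : Type*} [NormedCommRing C] [NormedAlgebra ℂ C] [CompleteSpace C]
    [NormedCommRing D] [NormedAlgebra ℂ D] [CompleteSpace D] {s₁ : C →ₐ[ℂ] B} {s₂ : D →ₐ[ℂ] B}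
    (hc₁ : Continuous s₁) (hc₂ : Continuous s₂) {g₁ b₁ : C} {g₂ g₂' b₂ : D} (hg₂ : g₂ * g₂' = 1)
    (h : exp (s₁ b₁ - s₂ b₂) = s₁ g₁ * s₂ g₂') :
    s₁ (g₁ * exp (-b₁)) = s₂ (g₂ * exp (-b₂)) := by
  have e₁ := banach_exp_neg_mul (s₁ b₁)
  have e₃ := congrArg s₂ hg₂
  rw [map_mul, map_one] at e₃
  rw [sub_eq_add_neg, banach_exp_add] at h
  rw [map_mul, map_mul, algHom_exp s₁ hc₁, algHom_exp s₂ hc₂, map_neg, map_neg]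
  linear_combination (-(s₂ g₂ * exp (-s₁ b₁))) * h + (s₂ g₂ * exp (-s₂ b₂)) * e₁ -
    (s₁ g₁ * exp (-s₁ b₁)) * e₃

/-- The logarithmic transition function between two local factorizations of the same function. -/
lemma exists_exp_eq_mul {C D : Type*} [NormedCommRing C] [NormedAlgebra ℂ C] [CompleteSpace C]
    [NormedCommRing D] [NormedAlgebra ℂ D] [CompleteSpace D] {s₁ : C →ₐ[ℂ] B} {s₂ : D →ₐ[ℂ] B}
    {g₁ : C} {g₂ g₂' : D} (hg₂ : g₂ * g₂' = 1)
    (h₁ : C(characterSpace ℂ C, ℂ)) (h₂ : C(characterSpace ℂ D, ℂ))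
    (h : ∀ χ, χ (s₁ g₁) * Complex.exp (h₁ (pullCharacter s₁ χ)) =
      χ (s₂ g₂) * Complex.exp (h₂ (pullCharacter s₂ χ))) :
    ∃ b, exp b = s₁ g₁ * s₂ g₂' ∧ ∀ χ : characterSpace ℂ B,
      χ b = h₂ (pullCharacter s₂ χ) - h₁ (pullCharacter s₁ χ) := by
  refine exists_exp_eq (h₂.comp (pullCharacter s₂) - h₁.comp (pullCharacter s₁)) _ fun χ => ?_
  have e₁ := h χ
  have e₃ := congrArg χ (congrArg s₂ hg₂)
  rw [map_mul, map_mul, map_one, map_one] at e₃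
  rw [map_mul, ContinuousMap.sub_apply, ContinuousMap.comp_apply, ContinuousMap.comp_apply,
    Complex.exp_sub, eq_div_iff (Complex.exp_ne_zero _)]
  linear_combination χ (s₂ g₂') * e₁ + Complex.exp (h₂ (pullCharacter s₂ χ)) * e₃

lemma exists_eq_mul_exp_of_separating (l : List B) (f : C(characterSpace ℂ B, ℂ))
    (hf : ∀ ψ, f ψ ≠ 0)
    (hl : ∀ ψ ψ', 1 ≤ ‖f ψ' / f ψ - 1‖ → ∃ a ∈ l, ‖ψ a‖ < 1 ∧ 1 < ‖ψ' a‖) :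
    ∃ (g : B) (h : C(characterSpace ℂ B, ℂ)), ∀ ψ, f ψ = ψ g * Complex.exp (h ψ) := by
  induction hn : l.length generalizing B with
  | zero =>
    obtain rfl := List.length_eq_zero_iff.1 hn
    rcases isEmpty_or_nonempty (characterSpace ℂ B) with hE | ⟨⟨φ⟩⟩
    · exact ⟨0, 0, fun ψ => hE.elim ψ⟩
    · have hmem : ∀ ψ, f ψ / f φ ∈ Complex.slitPlane := fun ψ => by
        have h : ‖f ψ / f φ - 1‖ < 1 := by
          by_contra! hlt
          simpa using hl φ ψ hlt
        have := Complex.mem_slitPlane_of_norm_lt_one h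
        rwa [add_sub_cancel] at this
      refine ⟨algebraMap ℂ B (f φ), ⟨fun ψ => Complex.log (f ψ / f φ),
        ((map_continuous f).div_const _).clog hmem⟩, fun ψ => ?_⟩
      rw [show ψ (algebraMap ℂ B (f φ)) = f φ from AlgHomClass.commutes ψ _]
      change f ψ = f φ * Complex.exp (Complex.log (f ψ / f φ))
      rw [Complex.exp_log (Complex.slitPlane_ne_zero (hmem ψ)), mul_div_cancel₀ _ (hf φ)]
  | succ n ih =>
    obtain ⟨e, l, rfl⟩ := List.exists_cons_of_length_eq_add_one hn
    obtain ⟨s₁, s₂, hc₁, hc₂, hs₁, hs₂, hglue, hsplit⟩ := exists_transition_maps e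
    have hlen : l.length = n := by simpa using hn
    obtain ⟨g₁, h₁, hg₁⟩ := ih (l.map (AdjoinRel.incl (relLE e)))
      (f.comp (pullCharacter (AdjoinRel.incl _))) (fun ψ => hf _)
      (fun ψ ψ' hr => separating_relLE hl ψ ψ' hr) (by simpa using hlen)
    obtain ⟨g₂, h₂, hg₂⟩ := ih (l.map (AdjoinRel.incl (relGE e)))
      (f.comp (pullCharacter (AdjoinRel.incl _))) (fun ψ => hf _)
      (fun ψ ψ' hr => separating_relGE hl ψ ψ' hr) (by simpa using hlen)
    have hu₁ : IsUnit g₁ := isUnit_of_character_ne_zero fun ψ => left_ne_zero_of_mul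
      ((hg₁ ψ).symm.trans_ne (hf _))
    have hu₂ : IsUnit g₂ := isUnit_of_character_ne_zero fun ψ => left_ne_zero_of_mul
      ((hg₂ ψ).symm.trans_ne (hf _))
    obtain ⟨g₁', hg₁'⟩ := hu₁.exists_right_inv
    obtain ⟨g₂', hg₂'⟩ := hu₂.exists_right_inv
    have hcomp : ∀ χ : characterSpace ℂ (AdjoinRel (relEQ e)),
        pullCharacter (AdjoinRel.incl _) (pullCharacter s₁ χ) =
          pullCharacter (AdjoinRel.incl _) (pullCharacter s₂ χ) := fun χ =>
      DFunLike.ext _ _ fun b => by simp only [pullCharacter_apply, hs₁, hs₂]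
    obtain ⟨b, hb, hbχ⟩ := exists_exp_eq_mul (s₁ := s₁) (s₂ := s₂) (g₁ := g₁) hg₂' h₁ h₂ fun χ => by
      have e₁ := hg₁ (pullCharacter s₁ χ)
      have e₂ := hg₂ (pullCharacter s₂ χ)
      rw [ContinuousMap.comp_apply, pullCharacter_apply] at e₁ e₂
      rw [← e₁, ← e₂, hcomp]
    obtain ⟨b₁, b₂, rfl⟩ := hsplit b
    have hw := mul_exp_neg_eq hc₁ hc₂ hg₂' hb
    have hw' : s₁ (g₁' * exp b₁) = s₂ (g₂' * exp b₂) := by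
      have e₁ : s₁ (g₁ * exp (-b₁) * (g₁' * exp b₁)) = 1 := by
        rw [← map_one s₁]
        congr 1
        linear_combination g₁ * g₁' * banach_exp_neg_mul b₁ + hg₁'
      have e₂ : s₂ (g₂ * exp (-b₂) * (g₂' * exp b₂)) = 1 := by
        rw [← map_one s₂]
        congr 1
        linear_combination g₂ * g₂' * banach_exp_neg_mul b₂ + hg₂'
      rw [map_mul, hw] at e₁
      rw [map_mul] at e₂
      linear_combination (s₂ (g₂' * exp b₂)) * e₁ - (s₁ (g₁' * exp b₁)) * e₂
    have hN : 0 < 1 + ‖g₁' * exp b₁‖ + ‖g₂' * exp b₂‖ := by positivity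
    obtain ⟨a, ha₁, ha₂⟩ := hglue _ _ hw _ (inv_pos.2 hN)
    obtain ⟨m₁, hm₁, hm₁'⟩ := exists_continuous_log_of_near hg₁' ha₁ (by
      rw [inv_mul_le_iff₀ hN]
      linarith [norm_nonneg (g₂' * exp b₂)])
    obtain ⟨m₂, hm₂, hm₂'⟩ := exists_continuous_log_of_near hg₂' ha₂ (by
      rw [inv_mul_le_iff₀ hN]
      linarith [norm_nonneg (g₁' * exp b₁)])
    obtain ⟨H, hH₁, hH₂⟩ := exists_glue e s₁ s₂ hs₁ hs₂ (h₁ + hat b₁ - m₁) (h₂ + hat b₂ - m₂)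
      fun χ => by
        have e₁ := hbχ χ
        have e₂ : m₁ (pullCharacter s₁ χ) = m₂ (pullCharacter s₂ χ) := by
          rw [hm₁, hm₂, pullCharacter_apply, pullCharacter_apply, map_mul, map_mul s₂, hs₁, hs₂, hw']
        rw [map_sub] at e₁
        simp only [ContinuousMap.sub_apply, ContinuousMap.add_apply, hat_apply,
          pullCharacter_apply, e₂]
        linear_combination e₁
    refine ⟨a, H, fun φ => ?_⟩
    rcases le_total ‖φ e‖ 1 with hφ | hφ
    · obtain ⟨ψ, rfl⟩ := exists_pullCharacter_relLE hφ
      rw [hH₁]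
      exact (hg₁ ψ).trans (hm₁' ψ _)
    · obtain ⟨ψ, rfl⟩ := exists_pullCharacter_relGE hφ
      rw [hH₂]
      exact (hg₂ ψ).trans (hm₂' ψ _)

/-- The surjectivity half of the Arens–Royden theorem: a nowhere vanishing continuous function on
the character space is the Gelfand transform of a unit times the exponential of a continuous
function. -/
theorem exists_eq_mul_exp (f : C(characterSpace ℂ B, ℂ)) (hf : ∀ ψ, f ψ ≠ 0) :
    ∃ (g : B) (h : C(characterSpace ℂ B, ℂ)), ∀ ψ, f ψ = ψ g * Complex.exp (h ψ) := by
  obtain ⟨l, hl⟩ := exists_list_separating (B := B) {x | 1 ≤ ‖f x.2 / f x.1 - 1‖}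
    (isClosed_le continuous_const
      ((((map_continuous f).comp continuous_snd).div ((map_continuous f).comp continuous_fst)
        fun x => hf _).sub continuous_const).norm) fun x hx he => by
      simp only [Set.mem_ofPred_eq, he, div_self (hf _), sub_self, norm_zero] at hx
      linarith
  exact exists_eq_mul_exp_of_separating l f hf hl

end ArensRoyden

section UniformAlgebra

open WeakDual

variable {X : Type*} [TopologicalSpace X]

/-- Restriction of continuous functions to a subset, as an algebra homomorphism. -/
noncomputable def restrictAlgHom (E : Set X) : C(X, ℂ) →ₐ[ℂ] C(E, ℂ) :=
  ContinuousMap.compRightAlgHom ℂ ℂ ⟨Subtype.val, continuous_subtype_val⟩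

@[simp]
lemma restrictAlgHom_apply (E : Set X) (f : C(X, ℂ)) (e : E) : restrictAlgHom E f e = f e := rfl

/-- Evaluation at a point, as a character of a subalgebra of continuous functions. -/
noncomputable def evalCharacter {K : Type*} [TopologicalSpace K] [CompactSpace K]
    (S : Subalgebra ℂ C(K, ℂ)) [CompleteSpace S] : C(K, characterSpace ℂ S) where
  toFun e := CharacterSpace.equivAlgHom.symm ((ContinuousMap.evalAlgHom ℂ ℂ e).comp S.val)
  continuous_toFun := continuous_induced_rng.2 <| WeakDual.continuous_of_continuous_eval fun b =>
    map_continuous (b : C(K, ℂ))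

lemma evalCharacter_apply {K : Type*} [TopologicalSpace K] [CompactSpace K]
    (S : Subalgebra ℂ C(K, ℂ)) [CompleteSpace S] (e : K) (b : S) :
    evalCharacter S e b = (b : C(K, ℂ)) e := rfl

variable (A : Subalgebra ℂ C(X, ℂ)) (E : Set X) [CompactSpace E]

/-- The uniform closure of the restrictions to `E` of the elements of `A`. -/
noncomputable abbrev restrictClosure : Subalgebra ℂ C(E, ℂ) :=
  (A.map (restrictAlgHom E)).topologicalClosure

instance : CompleteSpace (restrictClosure A E) :=
  (Subalgebra.isClosed_topologicalClosure _).completeSpace_coe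

lemma exists_norm_restrict_sub_lt {g : C(E, ℂ)} (hg : g ∈ restrictClosure A E) {δ : ℝ}
    (hδ : 0 < δ) : ∃ a ∈ A, ‖restrictAlgHom E a - g‖ < δ := by
  obtain ⟨_, ⟨a, ha, rfl⟩, h⟩ := Metric.mem_closure_iff.1 hg δ hδ
  exact ⟨a, ha, by rwa [dist_comm, dist_eq_norm] at h⟩

variable {A E}

lemma injective_evalCharacter (hsep : ∀ x y : X, x ≠ y → ∃ f ∈ A, f x ≠ f y) :
    Function.Injective (evalCharacter (restrictClosure A E)) := fun x y h => by
  by_contra hne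
  obtain ⟨f, hf, hxy⟩ := hsep x y (fun h => hne (Subtype.ext h))
  exact hxy (DFunLike.congr_fun h
    ⟨restrictAlgHom E f, Subalgebra.le_topologicalClosure _ ⟨f, hf, rfl⟩⟩)

variable [CompactSpace X]

variable (E) in
lemma norm_restrictAlgHom_le_sSup (f : C(X, ℂ)) :
    ‖restrictAlgHom E f‖ ≤ sSup ((fun e => ‖f e‖) '' E) := by
  have hbdd : BddAbove ((fun e => ‖f e‖) '' E) := by
    refine ⟨‖f‖, ?_⟩
    rintro _ ⟨e, -, rfl⟩
    exact f.norm_coe_le_norm e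
  refine (ContinuousMap.norm_le _ (Real.sSup_nonneg ?_)).2 fun e =>
    le_csSup hbdd ⟨e, e.2, rfl⟩
  rintro _ ⟨e, -, rfl⟩
  exact norm_nonneg _

variable (E) in
lemma norm_restrictAlgHom_le (f : C(X, ℂ)) :
    ‖restrictAlgHom E f‖ ≤ ‖f‖ :=
  (ContinuousMap.norm_le _ (norm_nonneg _)).2 fun e => f.norm_coe_le_norm e

/-- Every character of the restriction closure is a point evaluation. -/
lemma surjective_evalCharacter
    (hnat : ∀ φ : A →ₐ[ℂ] ℂ, ∃ x : X, ∀ f : A, φ f = (f : C(X, ℂ)) x)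
    (hE : ∀ x ∉ E, ∃ f ∈ A, sSup ((fun e => ‖f e‖) '' E) < ‖f x‖) :
    Function.Surjective (evalCharacter (restrictClosure A E)) := fun ψ => by
  let ρ : A →ₐ[ℂ] restrictClosure A E := ((restrictAlgHom E).comp A.val).codRestrict _
    fun a => Subalgebra.le_topologicalClosure _ ⟨a, a.2, rfl⟩
  obtain ⟨x, hx⟩ := hnat ((CharacterSpace.equivAlgHom ψ).comp ρ)
  replace hx : ∀ a : A, ψ (ρ a) = (a : C(X, ℂ)) x := hx
  have hxE : x ∈ E := by
    by_contra hxE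
    obtain ⟨f, hf, hlt⟩ := hE x hxE
    have := hx ⟨f, hf⟩
    refine hlt.not_ge ?_
    change ‖(((⟨f, hf⟩ : A) : C(X, ℂ)) x)‖ ≤ _
    rw [← this]
    exact (norm_character_apply_le ψ _).trans (norm_restrictAlgHom_le_sSup E f)
  refine ⟨⟨x, hxE⟩, DFunLike.ext _ _ fun b => ?_⟩
  rw [evalCharacter_apply, ← sub_eq_zero, ← norm_le_zero_iff]
  refine le_of_forall_pos_le_add fun δ hδ => ?_
  obtain ⟨a, ha, hab⟩ := exists_norm_restrict_sub_lt A E b.2 (half_pos hδ)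
  have h1 : ‖ψ (ρ ⟨a, ha⟩ - b)‖ < δ / 2 := (norm_character_apply_le ψ _).trans_lt hab
  have h2 := ((restrictAlgHom E a - b).norm_coe_le_norm ⟨x, hxE⟩).trans_lt hab
  rw [map_sub, hx] at h1
  rw [ContinuousMap.sub_apply, restrictAlgHom_apply, norm_sub_rev] at h2
  have h3 := norm_sub_le_norm_sub_add_norm_sub ((b : C(E, ℂ)) ⟨x, hxE⟩) (a x) (ψ b)
  change ‖a x - ψ b‖ < _ at h1
  linarith

/-- A nowhere vanishing function on an `A`-convex set is an element of the restriction closure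
times an exponential. -/
lemma exists_mem_restrictClosure_eq_mul_exp
    (hsep : ∀ x y : X, x ≠ y → ∃ f ∈ A, f x ≠ f y)
    (hnat : ∀ φ : A →ₐ[ℂ] ℂ, ∃ x : X, ∀ f : A, φ f = (f : C(X, ℂ)) x)
    (hE : ∀ x ∉ E, ∃ f ∈ A, sSup ((fun e => ‖f e‖) '' E) < ‖f x‖)
    (f : C(E, ℂ)) (hf : ∀ e, f e ≠ 0) :
    ∃ g ∈ restrictClosure A E, ∃ h : C(E, ℂ), ∀ e, f e = g e * Complex.exp (h e) := by
  let T : E ≃ₜ characterSpace ℂ (restrictClosure A E) :=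
    Continuous.homeoOfEquivCompactToT2 (f := Equiv.ofBijective _
      ⟨injective_evalCharacter (E := E) hsep, surjective_evalCharacter hnat hE⟩)
      (map_continuous (evalCharacter (restrictClosure A E)))
  obtain ⟨g, h, hgh⟩ := exists_eq_mul_exp (f.comp ⟨T.symm, T.symm.continuous⟩) fun ψ => hf _
  refine ⟨g, g.2, h.comp ⟨T, T.continuous⟩, fun e => ?_⟩
  have := hgh (T e)
  change f (T.symm (T e)) = _ at this
  rwa [T.symm_apply_apply] at this

/-- If `A` has dense invertibles, the element of `A` above can be taken invertible. -/
lemma exists_isUnit_eq_mul_exp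
    (hsep : ∀ x y : X, x ≠ y → ∃ f ∈ A, f x ≠ f y)
    (hnat : ∀ φ : A →ₐ[ℂ] ℂ, ∃ x : X, ∀ f : A, φ f = (f : C(X, ℂ)) x)
    (hE : ∀ x ∉ E, ∃ f ∈ A, sSup ((fun e => ‖f e‖) '' E) < ‖f x‖)
    (hinv : Dense {f : A | IsUnit f}) (f : C(E, ℂ)) (hf : ∀ e, f e ≠ 0) :
    ∃ a : A, IsUnit a ∧ ∃ h : C(E, ℂ), ∀ e : E, f e = (a : C(X, ℂ)) e * Complex.exp (h e) := by
  obtain ⟨g, hg, h, hgh⟩ := exists_mem_restrictClosure_eq_mul_exp hsep hnat hE f hf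
  have hg0 : ∀ e, g e ≠ 0 := fun e => left_ne_zero_of_mul ((hgh e).symm.trans_ne (hf e))
  let k : C(E, ℂ) := ⟨fun e => (g e)⁻¹, (map_continuous g).inv₀ hg0⟩
  have hδ : 0 < (1 + ‖k‖)⁻¹ / 2 := by positivity
  obtain ⟨a, ha, hag⟩ := exists_norm_restrict_sub_lt A E hg hδ
  obtain ⟨a', ha', haa'⟩ := Metric.mem_closure_iff.1 (hinv ⟨a, ha⟩) _ hδ
  have hlt : ‖restrictAlgHom E (a' : C(X, ℂ)) - g‖ < (1 + ‖k‖)⁻¹ := by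
    rw [dist_comm, dist_eq_norm] at haa'
    have h1 := (norm_restrictAlgHom_le E ((a' : C(X, ℂ)) - a)).trans_lt haa'
    rw [map_sub] at h1
    have h2 := norm_sub_le_norm_sub_add_norm_sub (restrictAlgHom E (a' : C(X, ℂ)))
      (restrictAlgHom E a) g
    linarith
  have hmem : ∀ e : E, (a' : C(X, ℂ)) e * k e ∈ Complex.slitPlane := fun e => by
    have h1 : (a' : C(X, ℂ)) e * k e - 1 = ((restrictAlgHom E (a' : C(X, ℂ)) - g) * k) e := by
      have : g e * k e = 1 := mul_inv_cancel₀ (hg0 e)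
      rw [ContinuousMap.mul_apply, ContinuousMap.sub_apply, restrictAlgHom_apply, sub_mul, this]
    have h2 : ‖(a' : C(X, ℂ)) e * k e - 1‖ < 1 := by
      rw [h1]
      refine ((ContinuousMap.norm_coe_le_norm _ e).trans (norm_mul_le _ _)).trans_lt ?_
      have hpos : 0 < 1 + ‖k‖ := by positivity
      calc _ ≤ ‖restrictAlgHom E (a' : C(X, ℂ)) - g‖ * (1 + ‖k‖) := by gcongr; linarith
        _ < 1 := by rwa [← lt_div_iff₀ hpos, one_div]
    have := Complex.mem_slitPlane_of_norm_lt_one h2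
    rwa [add_sub_cancel] at this
  refine ⟨a', ha', h - ⟨fun e => Complex.log ((a' : C(X, ℂ)) e * k e),
    ((((map_continuous (a' : C(X, ℂ))).comp continuous_subtype_val).mul
      (map_continuous k))).clog hmem⟩, fun e => ?_⟩
  change f e = _ * Complex.exp (h e - Complex.log ((a' : C(X, ℂ)) e * (g e)⁻¹))
  have h0 : (a' : C(X, ℂ)) e * (g e)⁻¹ ≠ 0 := Complex.slitPlane_ne_zero (hmem e)
  rw [hgh, Complex.exp_sub, Complex.exp_log h0]
  have h1 := left_ne_zero_of_mul h0
  have h2 := hg0 e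
  field_simp

end UniformAlgebra

/-- Let `X` be a compact Hausdorff space and `A` a natural uniform algebra on `X`.
Suppose `A` is approximately regular: every closed `E ⊆ X` is `A`-convex, i.e. for every
`x ∈ X \ E` there is `f ∈ A` with `|f x| > sup_{e ∈ E} |f e|`.  If `A` has dense
invertibles, then the invertible elements of `C(X, ℂ)` are dense in `C(X, ℂ)`. -/
theorem stmt13 (X : Type*) [TopologicalSpace X] [CompactSpace X] [T2Space X]
    (A : Subalgebra ℂ C(X, ℂ))
    (hclosed : IsClosed (A : Set C(X, ℂ)))
    (hsep : ∀ x y : X, x ≠ y → ∃ f ∈ A, f x ≠ f y)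
    (hnat : ∀ φ : A →ₐ[ℂ] ℂ, ∃ x : X, ∀ f : A, φ f = (f : C(X, ℂ)) x)
    (hreg : ∀ E : Set X, IsClosed E → ∀ x ∉ E,
      ∃ f ∈ A, sSup ((fun e => ‖f e‖) '' E) < ‖f x‖)
    (hinv : Dense {f : A | IsUnit f}) :
    Dense {f : C(X, ℂ) | IsUnit f} := by
  refine fun f => Metric.mem_closure_iff.2 fun ε hε => ?_
  set E : Set X := {x | ε / 3 ≤ ‖f x‖} with hEdef
  have hEc : IsClosed E := isClosed_le continuous_const (map_continuous f).norm
  have : CompactSpace E := isCompact_iff_compactSpace.1 hEc.isCompact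
  obtain ⟨a, ha, h, hfa⟩ := exists_isUnit_eq_mul_exp hsep hnat (hreg E hEc) hinv
    (restrictAlgHom E f) fun e => norm_pos_iff.1 ((by positivity : 0 < ε / 3).trans_le e.2)
  obtain ⟨k, hk⟩ := ContinuousMap.exists_restrict_eq hEc h
  have hG0 : ∀ x, (a : C(X, ℂ)) x * Complex.exp (k x) ≠ 0 := fun x =>
    mul_ne_zero ((ha.map ((ContinuousMap.evalAlgHom ℂ ℂ x).comp A.val)).ne_zero)
      (Complex.exp_ne_zero _)
  have hGE : ∀ x ∈ E, (a : C(X, ℂ)) x * Complex.exp (k x) = f x := fun x hx => by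
    rw [← restrictAlgHom_apply E f ⟨x, hx⟩, hfa, ← hk]
    rfl
  let F : C(X, ℂ) := ⟨fun x => (a : C(X, ℂ)) x * Complex.exp (k x) /
      (‖(a : C(X, ℂ)) x * Complex.exp (k x)‖ : ℂ) * (max ‖f x‖ (ε / 3) : ℝ), by
    have hG : Continuous fun x => (a : C(X, ℂ)) x * Complex.exp (k x) := by fun_prop
    exact (hG.div (Complex.continuous_ofReal.comp hG.norm) fun x =>
      Complex.ofReal_ne_zero.2 (norm_ne_zero_iff.2 (hG0 x))).mul (by fun_prop)⟩
  have hmax : ∀ x, 0 < max ‖f x‖ (ε / 3) := fun x => lt_max_of_lt_right (by positivity)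
  have hF : ∀ x, ‖F x‖ = max ‖f x‖ (ε / 3) := fun x => by
    change ‖(a : C(X, ℂ)) x * Complex.exp (k x) /
      (‖(a : C(X, ℂ)) x * Complex.exp (k x)‖ : ℂ) * (max ‖f x‖ (ε / 3) : ℝ)‖ = _
    rw [norm_mul, norm_div, Complex.norm_real, norm_norm,
      div_self (norm_ne_zero_iff.2 (hG0 x)), one_mul, Complex.norm_real, Real.norm_of_nonneg
      (hmax x).le]
  refine ⟨F, ContinuousMap.isUnit_iff_forall_ne_zero _ |>.2 fun x =>
    norm_pos_iff.1 ((hF x).symm ▸ hmax x), ?_⟩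
  rw [dist_eq_norm]
  refine ((ContinuousMap.norm_le _ (by positivity : 0 ≤ ε / 3 + ε / 3)).2 fun x => ?_).trans_lt
    (by linarith)
  by_cases hx : x ∈ E
  · have h1 : F x = f x := by
      have h2 : (‖f x‖ : ℂ) ≠ 0 := Complex.ofReal_ne_zero.2
        (((by positivity : 0 < ε / 3).trans_le hx).ne')
      change (a : C(X, ℂ)) x * Complex.exp (k x) /
        (‖(a : C(X, ℂ)) x * Complex.exp (k x)‖ : ℂ) * (max ‖f x‖ (ε / 3) : ℝ) = _
      rw [hGE x hx, max_eq_left hx, div_mul_cancel₀ _ h2]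
    rw [ContinuousMap.sub_apply, h1, sub_self, norm_zero]
    positivity
  · have hx' : ‖f x‖ < ε / 3 := not_le.1 hx
    refine (norm_sub_le _ _).trans (add_le_add hx'.le ?_)
    rw [hF, max_eq_right hx'.le]
end
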